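/- Let V^L and V^R be vertex operator algebras satisfying conditions (i)–(iii). Then the tensor product vertex operator algebra V^L ⊗ V^R also satisfies conditions (i)–(iii): every ℂ-graded generalized V^L ⊗ V^R-module is a direct sum of ℂ-graded irreducible modules, there are only finitely many inequivalent ℂ-graded irreducible V^L ⊗ V^R-modules and they are all ℝ-graded, and every ℝ-graded irreducible V^L ⊗ V^R-module is C₁-cofinite. Consequently every module F for V^L ⊗ V^R is isomorphic to a finite direct sum ⊕_{a∈𝒜^L} ⊕_{b∈𝒜^R} ⊕_{m_{ab}=1}^{h_{ab}} (W^{L;a})^{(m_{ab})} ⊗ (W^{R;b})^{(m_{ab})}. -/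

import Mathlib

noncomputable section
open scoped BigOperators TensorProduct
open Complex

/-! ## General analytic helpers -/

/-- Binomial coefficient with complex argument. -/
def cchoose (a : ℂ) (k : ℕ) : ℂ := (∏ i ∈ Finset.range k, (a - (i : ℂ))) / (k.factorial : ℂ)

/-- The argument of a complex number, normalized to lie in `[0, 2π)`. -/
def argNN (z : ℂ) : ℝ := if 0 ≤ z.arg then z.arg else z.arg + 2 * Real.pi

/-- Logarithm with the branch `0 ≤ arg z < 2π` used in the paper. -/
def logNN (z : ℂ) : ℂ := (Real.log (‖z‖) : ℂ) + (argNN z : ℂ) * Complex.I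

/-- `z ^ w = e^{w log z}` with the branch `0 ≤ arg z < 2π`. -/
def cpowNN (z w : ℂ) : ℂ := Complex.exp (w * logNN z)

/-- `z̄ ^ w = e^{w conj (log z)}` with the branch `0 ≤ arg z < 2π`. -/
def cpowNNbar (z w : ℂ) : ℂ := Complex.exp (w * (starRingEnd ℂ) (logNN z))

/-- Wirtinger derivative `∂/∂z` of a function of one complex variable (viewed as a
smooth function of the real and imaginary parts). -/
def wdz (h : ℂ → ℂ) (z : ℂ) : ℂ :=
  (1 / 2 : ℂ) * (fderiv ℝ h z 1 - Complex.I * fderiv ℝ h z Complex.I)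

/-- Wirtinger derivative `∂/∂z̄`. -/
def wdzbar (h : ℂ → ℂ) (z : ℂ) : ℂ :=
  (1 / 2 : ℂ) * (fderiv ℝ h z 1 + Complex.I * fderiv ℝ h z Complex.I)

/-- The exponential `e^{c g}` of an operator `g`, applied to a vector, as a finite sum
(`finsum`); this is the honest exponential whenever `g` is locally nilpotent. -/
def funExp {V : Type} [AddCommGroup V] [Module ℂ V] (g : V → V) (c : ℂ) (x : V) : V :=
  ∑ᶠ j : ℕ, (c ^ j / (j.factorial : ℂ)) • g^[j] x

/-- Bilinearity of a complex-valued pairing. -/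
def IsBilinMap {V W : Type} [AddCommGroup V] [Module ℂ V] [AddCommGroup W] [Module ℂ W]
    (f : V → W → ℂ) : Prop :=
  (∀ x y z, f (x + y) z = f x z + f y z) ∧ (∀ (c : ℂ) x z, f (c • x) z = c * f x z) ∧
  (∀ x y z, f x (y + z) = f x y + f x z) ∧ (∀ (c : ℂ) x y, f x (c • y) = c * f x y)

/-- Two local branches are adjacent if they agree on some nonempty open set. -/
def BranchAdj {E : Type} [TopologicalSpace E] (B : Set (Set E × (E → ℂ)))
    (b b' : Set E × (E → ℂ)) : Prop :=
  b ∈ B ∧ b' ∈ B ∧ ∃ U : Set E, IsOpen U ∧ U.Nonempty ∧ U ⊆ b.1 ∩ b'.1 ∧ Set.EqOn b.2 b'.2 U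

/-- The square root `√|z| e^{i arg z/2}` (argument normalized to `[0,2π)`). -/
def csqrt (z : ℂ) : ℂ := (Real.sqrt (‖z‖) : ℂ) * Complex.exp (Complex.I * (argNN z) / 2)

/-! ## ℝ-graded spaces with algebraic completions and graded duals -/

/-- An ℝ-graded vector space, presented through its family of grade projections. -/
structure GradedSpace where
  F : Type
  [grp : AddCommGroup F]
  [mod : Module ℂ F]
  P : ℝ → Module.End ℂ F
  P_orth : ∀ r s x, P r (P s x) = if r = s then P s x else 0
  P_finite : ∀ x : F, {r : ℝ | P r x ≠ 0}.Finite
  P_total : ∀ x : F, (∑ᶠ r, P r x) = x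

attribute [instance] GradedSpace.grp GradedSpace.mod

namespace GradedSpace

variable (G : GradedSpace)

/-- The algebraic completion `F̄ = ∏_r F_(r)`; we record an element of the completion by
its family of graded components. -/
abbrev Fbar := ℝ → G.F

/-- The inclusion of `F` into its algebraic completion. -/
def incl (x : G.F) : G.Fbar := fun r => G.P r x

/-- The graded dual `F'`: linear functionals supported on finitely many graded pieces. -/
def Dual := {f : G.F →ₗ[ℂ] ℂ // {r : ℝ | f ∘ₗ G.P r ≠ 0}.Finite}

/-- The canonical pairing between the graded dual and the algebraic completion. -/
def dpair (f : G.Dual) (g : G.Fbar) : ℂ := ∑ᶠ r, f.1 (g r)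

/-- The total grading operator `d` (multiplication by `r` on the grade-`r` piece). -/
def dop (x : G.F) : G.F := ∑ᶠ r : ℝ, (r : ℂ) • G.P r x

/-- The operator `e^{a d}`. -/
def expd (a : ℝ) (x : G.F) : G.F := ∑ᶠ r, (Real.exp (a * r) : ℂ) • G.P r x

end GradedSpace
/-! ## Full field algebras (Definition 1.1 of Huang–Kong) -/

/-- A full field algebra: an ℝ-graded vector space together with correlation function
maps `m_n` and a vacuum, satisfying the axioms of Definition 1.1 of Huang–Kong
(multilinearity and smoothness, normalization of `m₁`, the vacuum property, absolute
convergence of substituted series, the permutation property, and the `e^{a d}`-grading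
property).  Absolute convergence of series in the completion is expressed through the
pairing with arbitrary elements of the graded dual. -/
structure FullFieldAlgebra where
  g : GradedSpace
  m : ∀ n : ℕ, (Fin n → g.F) → (Fin n → ℂ) → g.Fbar
  vac : g.F
  m_graded : ∀ n u z r, g.P r (m n u z r) = m n u z r
  m_add : ∀ n (u : Fin n → g.F) (i : Fin n) (x y : g.F) (z : Fin n → ℂ),
    m n (Function.update u i (x + y)) z
      = m n (Function.update u i x) z + m n (Function.update u i y) z
  m_smul : ∀ n (u : Fin n → g.F) (i : Fin n) (c : ℂ) (x : g.F) (z : Fin n → ℂ),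
    m n (Function.update u i (c • x)) z = c • m n (Function.update u i x) z
  m_smooth : ∀ n (u : Fin n → g.F) (f : g.Dual),
    ContDiffOn ℝ (⊤ : ℕ∞) (fun z : Fin n → ℂ => g.dpair f (m n u z))
      {z : Fin n → ℂ | Function.Injective z}
  m_one : ∀ u : g.F, m 1 (fun _ => u) (fun _ => 0) = g.incl u
  m_vac : ∀ n (u : Fin n → g.F) (z : Fin n → ℂ) (w : ℂ),
    m (n + 1) (Fin.snoc u vac) (Fin.snoc z w) = m n u z
  m_perm : ∀ n (σ : Equiv.Perm (Fin n)) (u : Fin n → g.F) (z : Fin n → ℂ),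
    m n (fun i => u (σ i)) (fun i => z (σ i)) = m n u z
  m_conv : ∀ (k : ℕ) (l : Fin k → ℕ) (u : ∀ i, Fin (l i) → g.F)
    (z0 : Fin k → ℂ) (z : ∀ i, Fin (l i) → ℂ)
    (e : (Σ i : Fin k, Fin (l i)) ≃ Fin (∑ i, l i)),
    (∀ i j, i ≠ j → ∀ (p : Fin (l i)) (q : Fin (l j)),
      ‖z i p‖ + ‖z j q‖ < ‖z0 i - z0 j‖) →
    ∀ f : g.Dual,
      Summable (fun r : Fin k → ℝ =>
        ‖g.dpair f (m k (fun i => m (l i) (u i) (z i) (r i)) z0)‖) ∧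
      (∑' r : Fin k → ℝ,
          g.dpair f (m k (fun i => m (l i) (u i) (z i) (r i)) z0))
        = g.dpair f (m (∑ i, l i)
            (fun j => u (e.symm j).1 (e.symm j).2)
            (fun j => z (e.symm j).1 (e.symm j).2 + z0 (e.symm j).1))
  m_grading : ∀ (a : ℝ) n (u : Fin n → g.F) (z : Fin n → ℂ) (r : ℝ),
    g.expd a (m n u z r)
      = m n (fun i => g.expd a (u i)) (fun i => Real.exp a • z i) r

namespace FullFieldAlgebra

variable (Φ : FullFieldAlgebra)

/-- The full vertex operator map `𝕐(u; z, z̄)v = m₂(u ⊗ v; z, z̄, 0, 0)`, with values in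
the algebraic completion. -/
def Y (u : Φ.g.F) (z : ℂ) (v : Φ.g.F) : Φ.g.Fbar := Φ.m 2 ![u, v] ![z, 0]

end FullFieldAlgebra

/-- Iterated products `𝕐(u₁; z₁)⋯𝕐(u_k; z_k)𝟏` with prescribed graded components at
every intermediate stage. -/
def FullFieldAlgebra.chain (Φ : FullFieldAlgebra) :
    ∀ k : ℕ, (Fin k → Φ.g.F) → (Fin k → ℂ) → (Fin k → ℝ) → Φ.g.F
  | 0, _, _, _ => Φ.vac
  | (k + 1), u, z, r =>
      Φ.Y (u 0) (z 0)
        (FullFieldAlgebra.chain Φ k (fun i => u i.succ) (fun i => z i.succ)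
          (fun i => r i.succ)) (r 0)

/-! ## ℝ×ℝ-graded full field algebras (Definition 1.5 of Huang–Kong) -/

/-- An ℝ×ℝ-graded full field algebra: a full field algebra with a compatible double
grading, operators `D^L, D^R`, the single-valuedness property, a strengthened
convergence property, and the `d`-bracket and `D`-derivative properties. -/
structure RxRFFA extends FullFieldAlgebra where
  PLR : ℝ → ℝ → Module.End ℂ g.F
  PLR_orth : ∀ p q p' q' x, PLR p q (PLR p' q' x) = if p = p' ∧ q = q' then PLR p' q' x else 0
  PLR_finite : ∀ x, {pq : ℝ × ℝ | PLR pq.1 pq.2 x ≠ 0}.Finite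
  PLR_total : ∀ (r : ℝ) (x : g.F), g.P r x = ∑ᶠ p : ℝ, PLR p (r - p) x
  dLop : Module.End ℂ g.F
  dRop : Module.End ℂ g.F
  dLop_eq : ∀ p q x, dLop (PLR p q x) = (p : ℂ) • PLR p q x
  dRop_eq : ∀ p q x, dRop (PLR p q x) = (q : ℂ) • PLR p q x
  DL : Module.End ℂ g.F
  DR : Module.End ℂ g.F
  single_valued : ∀ (p q : ℝ) (x : g.F),
    Complex.exp (((2 * Real.pi : ℝ) : ℂ) * Complex.I * ((p : ℂ) - (q : ℂ))) • PLR p q x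
      = PLR p q x
  m_conv2 : ∀ (k : ℕ) (l : Fin k → ℕ) (u : ∀ i, Fin (l i) → g.F)
    (z0 : Fin k → ℂ) (z : ∀ i, Fin (l i) → ℂ)
    (e : (Σ i : Fin k, Fin (l i)) ≃ Fin (∑ i, l i)),
    (∀ i j, i ≠ j → ∀ (p : Fin (l i)) (q : Fin (l j)),
      ‖z i p‖ + ‖z j q‖ < ‖z0 i - z0 j‖) →
    ∀ f : g.Dual,
      Summable (fun r : Fin k → ℝ × ℝ =>
        ‖g.dpair f (m k (fun i =>
            PLR (r i).1 (r i).2 (m (l i) (u i) (z i) ((r i).1 + (r i).2))) z0)‖) ∧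
      (∑' r : Fin k → ℝ × ℝ,
          g.dpair f (m k (fun i =>
            PLR (r i).1 (r i).2 (m (l i) (u i) (z i) ((r i).1 + (r i).2))) z0))
        = g.dpair f (m (∑ i, l i)
            (fun j => u (e.symm j).1 (e.symm j).2)
            (fun j => z (e.symm j).1 (e.symm j).2 + z0 (e.symm j).1))
  dL_bracket : ∀ (u v : g.F) (f : g.Dual) (z : ℂ), z ≠ 0 →
    g.dpair f (fun r => dLop (toFullFieldAlgebra.Y u z v r))
      - g.dpair f (toFullFieldAlgebra.Y u z (dLop v))
    = z * wdz (fun w => g.dpair f (toFullFieldAlgebra.Y u w v)) z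
      + g.dpair f (toFullFieldAlgebra.Y (dLop u) z v)
  dR_bracket : ∀ (u v : g.F) (f : g.Dual) (z : ℂ), z ≠ 0 →
    g.dpair f (fun r => dRop (toFullFieldAlgebra.Y u z v r))
      - g.dpair f (toFullFieldAlgebra.Y u z (dRop v))
    = (starRingEnd ℂ z) * wdzbar (fun w => g.dpair f (toFullFieldAlgebra.Y u w v)) z
      + g.dpair f (toFullFieldAlgebra.Y (dRop u) z v)
  DL_deriv : ∀ (u v : g.F) (f : g.Dual) (z : ℂ), z ≠ 0 →
    g.dpair f (toFullFieldAlgebra.Y (DL u) z v)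
      = wdz (fun w => g.dpair f (toFullFieldAlgebra.Y u w v)) z
  DL_comm : ∀ (u v : g.F) (f : g.Dual) (z : ℂ), z ≠ 0 →
    g.dpair f (fun r => DL (toFullFieldAlgebra.Y u z v r))
        - g.dpair f (toFullFieldAlgebra.Y u z (DL v))
      = g.dpair f (toFullFieldAlgebra.Y (DL u) z v)
  DR_deriv : ∀ (u v : g.F) (f : g.Dual) (z : ℂ), z ≠ 0 →
    g.dpair f (toFullFieldAlgebra.Y (DR u) z v)
      = wdzbar (fun w => g.dpair f (toFullFieldAlgebra.Y u w v)) z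
  DR_comm : ∀ (u v : g.F) (f : g.Dual) (z : ℂ), z ≠ 0 →
    g.dpair f (fun r => DR (toFullFieldAlgebra.Y u z v r))
        - g.dpair f (toFullFieldAlgebra.Y u z (DR v))
      = g.dpair f (toFullFieldAlgebra.Y (DR u) z v)

namespace RxRFFA

variable (Φ : RxRFFA)

/-- The coefficient `𝕐_{l,r}(u)v` of `x^{-l-1} x̄^{-r-1}` in the formal full vertex
operator `𝕐_f(u; x, x̄)v`, extracted from `𝕐(·; 1, 1)` by bigraded components. -/
def Ymode (u : Φ.g.F) (l r : ℝ) (v : Φ.g.F) : Φ.g.F :=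
  ∑ᶠ a : ℝ, ∑ᶠ b : ℝ, ∑ᶠ c : ℝ, ∑ᶠ d : ℝ,
    Φ.PLR (a + c - l - 1) (b + d - r - 1)
      (Φ.toFullFieldAlgebra.Y (Φ.PLR a b u) 1 (Φ.PLR c d v) ((a + c - l - 1) + (b + d - r - 1)))

/-- The coefficient `𝕐_{n-1}(u)v` of `x^{-n-1}` in the diagonal formal vertex operator
`𝕐_f(u; x, x)v` (sum of `𝕐_{l,r}` over `l + r + 1 = n`). -/
def diagMode (u : Φ.g.F) (n : ℝ) (v : Φ.g.F) : Φ.g.F :=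
  ∑ᶠ l : ℝ, Φ.Ymode u l (n - 1 - l) v

/-- A term of the double series expansion of
`⟨w', 𝕐_an(u; z₁, ζ₁) 𝕐_an(v; z₂, ζ₂) w⟩` (a product of analytic full vertex
operators). -/
def prodTerm (f : Φ.g.Dual) (u v w : Φ.g.F) (z1 ζ1 z2 ζ2 : ℂ)
    (p : (ℝ × ℝ) × ℝ × ℝ) : ℂ :=
  cpowNN z1 (-(p.1.1 : ℂ) - 1) * cpowNNbar ζ1 (-(p.1.2 : ℂ) - 1) *
  cpowNN z2 (-(p.2.1 : ℂ) - 1) * cpowNNbar ζ2 (-(p.2.2 : ℂ) - 1) *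
  f.1 (Φ.Ymode u p.1.1 p.1.2 (Φ.Ymode v p.2.1 p.2.2 w))

/-- A term of the double series expansion of
`⟨w', 𝕐_an(𝕐_an(u; z₁-z₂, ζ₁-ζ₂)v; z₂, ζ₂) w⟩` (an iterate of analytic full vertex
operators). -/
def iterTerm (f : Φ.g.Dual) (u v w : Φ.g.F) (z1 ζ1 z2 ζ2 : ℂ)
    (p : (ℝ × ℝ) × ℝ × ℝ) : ℂ :=
  cpowNN (z1 - z2) (-(p.1.1 : ℂ) - 1) * cpowNNbar (ζ1 - ζ2) (-(p.1.2 : ℂ) - 1) *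
  cpowNN z2 (-(p.2.1 : ℂ) - 1) * cpowNNbar ζ2 (-(p.2.2 : ℂ) - 1) *
  f.1 (Φ.Ymode (Φ.Ymode u p.1.1 p.1.2 v) p.2.1 p.2.2 w)

/-- Grading restriction: double weights bounded below and finite-dimensional doubly
homogeneous subspaces. -/
def GradingRestricted : Prop :=
  (∃ M : ℝ, ∀ p q, (p < M ∨ q < M) → Φ.PLR p q = 0) ∧
  ∀ p q, Module.Finite ℂ (LinearMap.range (Φ.PLR p q))

/-- The diagonal operator acting by `fL p * fR q` on the bigraded piece of bidegree
`(p, q)`; used for operators such as `z^{-2L^L(0)} z̄^{-2L^R(0)} e^{±πi L^{L,R}(0)}`. -/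
def diagExp (fL fR : ℝ → ℂ) (x : Φ.g.F) : Φ.g.F :=
  ∑ᶠ p : ℝ, ∑ᶠ q : ℝ, (fL p * fR q) • Φ.PLR p q x

end RxRFFA

/-- Iterated mode compositions `𝕐_{l₁,r₁}(u₁)⋯𝕐_{l_k,r_k}(u_k)𝟏`. -/
def RxRFFA.chainMode (Φ : RxRFFA) : ∀ k : ℕ, (Fin k → Φ.g.F) → (Fin k → ℝ × ℝ) → Φ.g.F
  | 0, _, _ => Φ.vac
  | (k + 1), u, R =>
      Φ.Ymode (u 0) (R 0).1 (R 0).2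
        (RxRFFA.chainMode Φ k (fun i => u i.succ) (fun i => R i.succ))

/-! ## Conformal full field algebras -/

/-- A conformal full field algebra of central charges `(c^L, c^R)`. -/
structure ConfFFA extends RxRFFA where
  cL : ℂ
  cR : ℂ
  ωL : g.F
  ωR : g.F
  grading_res : toRxRFFA.GradingRestricted
  ωL_modes : ∀ (l r : ℝ), (¬ (r = -1 ∧ ∃ n : ℤ, l = (n : ℝ) + 1)) →
    ∀ v, toRxRFFA.Ymode ωL l r v = 0
  ωR_modes : ∀ (l r : ℝ), (¬ (l = -1 ∧ ∃ n : ℤ, r = (n : ℝ) + 1)) →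
    ∀ v, toRxRFFA.Ymode ωR l r v = 0
  LL : ℤ → Module.End ℂ g.F
  LR : ℤ → Module.End ℂ g.F
  LL_eq : ∀ (n : ℤ) v, LL n v = toRxRFFA.Ymode ωL ((n : ℝ) + 1) (-1) v
  LR_eq : ∀ (n : ℤ) v, LR n v = toRxRFFA.Ymode ωR (-1) ((n : ℝ) + 1) v
  virL : ∀ (mm nn : ℤ) (v : g.F),
    LL mm (LL nn v) - LL nn (LL mm v)
      = ((mm - nn : ℤ) : ℂ) • LL (mm + nn) v
        + (if mm + nn = 0 then (cL / 12) * ((mm : ℂ) ^ 3 - (mm : ℂ)) else 0) • v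
  virR : ∀ (mm nn : ℤ) (v : g.F),
    LR mm (LR nn v) - LR nn (LR mm v)
      = ((mm - nn : ℤ) : ℂ) • LR (mm + nn) v
        + (if mm + nn = 0 then (cR / 12) * ((mm : ℂ) ^ 3 - (mm : ℂ)) else 0) • v
  virLR : ∀ (mm nn : ℤ) (v : g.F), LL mm (LR nn v) = LR nn (LL mm v)
  dL_L0 : ∀ v, dLop v = LL 0 v
  dR_L0 : ∀ v, dRop v = LR 0 v
  DL_L1 : ∀ v, DL v = LL (-1) v
  DR_L1 : ∀ v, DR v = LR (-1) v
/-! ## Vertex operator algebras (in mode form) -/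

/-- A vertex operator algebra, presented through the modes `u_n = (Y u) n` of its vertex
operators, with the grading, vacuum, creation, `L(-1)`-derivative, Virasoro and
Borcherds-identity axioms. -/
structure VOA where
  V : Type
  [grp : AddCommGroup V]
  [mod : Module ℂ V]
  P : ℤ → Module.End ℂ V
  P_orth : ∀ m n x, P m (P n x) = if m = n then P n x else 0
  P_finite : ∀ x : V, {n : ℤ | P n x ≠ 0}.Finite
  P_total : ∀ x : V, (∑ᶠ n, P n x) = x
  P_lower : ∃ N : ℤ, ∀ n < N, P n = 0
  P_findim : ∀ n, Module.Finite ℂ (LinearMap.range (P n))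
  Yop : V → ℤ → Module.End ℂ V
  Y_add : ∀ u u' n, Yop (u + u') n = Yop u n + Yop u' n
  Y_smul : ∀ (c : ℂ) u n, Yop (c • u) n = c • Yop u n
  one : V
  ω : V
  cc : ℂ
  trunc : ∀ u v, ∃ N : ℤ, ∀ n ≥ N, Yop u n v = 0
  vac_id : ∀ n, Yop one n = if n = -1 then 1 else 0
  creation_neg1 : ∀ u, Yop u (-1) one = u
  creation_pos : ∀ u n, 0 ≤ n → Yop u n one = 0
  L0_grading : ∀ (n : ℤ) x, Yop ω 1 (P n x) = (n : ℂ) • P n x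
  Lm1_deriv : ∀ u n, Yop (Yop ω 0 u) n = (-(n : ℂ)) • Yop u (n - 1)
  virasoro : ∀ (m n : ℤ) (v : V),
    Yop ω (m + 1) (Yop ω (n + 1) v) - Yop ω (n + 1) (Yop ω (m + 1) v)
      = ((m - n : ℤ) : ℂ) • Yop ω (m + n + 1) v
        + (if m + n = 0 then (cc / 12) * ((m : ℂ) ^ 3 - (m : ℂ)) else 0) • v
  borcherds : ∀ (u v w : V) (p q r : ℤ),
    (∑ᶠ i : ℕ, cchoose (p : ℂ) i • Yop (Yop u (r + i) v) (p + q - i) w)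
      = ∑ᶠ i : ℕ, ((-1 : ℂ) ^ i * cchoose (r : ℂ) i) •
          (Yop u (p + r - i) (Yop v (q + i) w)
            - (-1 : ℂ) ^ r • Yop v (q + r - i) (Yop u (p + i) w))

attribute [instance] VOA.grp VOA.mod

namespace VOA

variable (A : VOA)

/-- Simplicity of a vertex operator algebra: no nonzero proper ideals. -/
def IsSimple : Prop :=
  Nontrivial A.V ∧
    ∀ S : Submodule ℂ A.V, (∀ u n x, x ∈ S → A.Yop u n x ∈ S) → S = ⊥ ∨ S = ⊤

/-- The subspace `C₂(V)` spanned by the `u_{-2} v`. -/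
def C2 : Submodule ℂ A.V := Submodule.span ℂ {x | ∃ u v, x = A.Yop u (-2) v}

/-- `C₂`-cofiniteness. -/
def C2Cofinite : Prop := Module.Finite ℂ (A.V ⧸ A.C2)

end VOA

/-! ## Generalized (ℂ-graded), weak, and ordinary (ℝ-graded) modules -/

/-- A ℂ-graded generalized module for a vertex operator algebra: `L(0)` acts on each
graded piece with a single generalized eigenvalue. -/
structure GenModule (A : VOA) where
  W : Type
  [grp : AddCommGroup W]
  [mod : Module ℂ W]
  P : ℂ → Module.End ℂ W
  P_orth : ∀ m n x, P m (P n x) = if m = n then P n x else 0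
  P_finite : ∀ x : W, {n : ℂ | P n x ≠ 0}.Finite
  P_total : ∀ x : W, (∑ᶠ n, P n x) = x
  act : A.V → ℤ → Module.End ℂ W
  act_add : ∀ u u' n, act (u + u') n = act u n + act u' n
  act_smul : ∀ (c : ℂ) u n, act (c • u) n = c • act u n
  trunc : ∀ u w, ∃ N : ℤ, ∀ n ≥ N, act u n w = 0
  vac_id : ∀ n, act A.one n = if n = -1 then 1 else 0
  L0_gen : ∀ (n : ℂ) (x : W), ∃ k : ℕ,
    ((act A.ω 1 - n • (1 : Module.End ℂ W)) ^ k) (P n x) = 0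
  borcherds : ∀ (u v : A.V) (w : W) (p q r : ℤ),
    (∑ᶠ i : ℕ, cchoose (p : ℂ) i • act (A.Yop u (r + i) v) (p + q - i) w)
      = ∑ᶠ i : ℕ, ((-1 : ℂ) ^ i * cchoose (r : ℂ) i) •
          (act u (p + r - i) (act v (q + i) w)
            - (-1 : ℂ) ^ r • act v (q + r - i) (act u (p + i) w))

attribute [instance] GenModule.grp GenModule.mod

namespace GenModule

variable {A : VOA} (M : GenModule A)

/-- Submodules (subrepresentations) of a generalized module. -/
def IsSubrep (S : Submodule ℂ M.W) : Prop := ∀ u n x, x ∈ S → M.act u n x ∈ S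

/-- Irreducibility of a generalized module. -/
def IsIrred : Prop :=
  (∃ x : M.W, x ≠ 0) ∧ ∀ S : Submodule ℂ M.W, M.IsSubrep S → S = ⊥ ∨ S = ⊤

/-- A generalized module is ℝ-graded if all its weights are real. -/
def RealGraded : Prop := ∀ n : ℂ, M.P n ≠ 0 → n.im = 0

/-- Isomorphism of generalized modules. -/
def Iso (N : GenModule A) : Prop :=
  ∃ e : M.W ≃ₗ[ℂ] N.W, ∀ u n x, e (M.act u n x) = N.act u n (e x)

/-- A generalized module is equivalent to the adjoint module `V` itself. -/
def IsoAdjoint : Prop :=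
  ∃ e : M.W ≃ₗ[ℂ] A.V, ∀ u n x, e (M.act u n x) = A.Yop u n (e x)

/-- The subspace `C₁(W)` spanned by `u_{-1} w` for `u ∈ V₊`. -/
def C1 : Submodule ℂ M.W :=
  Submodule.span ℂ
    {y | ∃ (u : A.V) (w : M.W), (∃ n : ℤ, 0 < n ∧ A.P n u = u) ∧ y = M.act u (-1) w}

/-- `C₁`-cofiniteness of a generalized module. -/
def C1Cofinite : Prop := Module.Finite ℂ (M.W ⧸ M.C1)

end GenModule

/-- A weak module: only the action axioms, with no grading. -/
structure WeakModule (A : VOA) where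
  W : Type
  [grp : AddCommGroup W]
  [mod : Module ℂ W]
  act : A.V → ℤ → Module.End ℂ W
  act_add : ∀ u u' n, act (u + u') n = act u n + act u' n
  act_smul : ∀ (c : ℂ) u n, act (c • u) n = c • act u n
  trunc : ∀ u w, ∃ N : ℤ, ∀ n ≥ N, act u n w = 0
  vac_id : ∀ n, act A.one n = if n = -1 then 1 else 0
  borcherds : ∀ (u v : A.V) (w : W) (p q r : ℤ),
    (∑ᶠ i : ℕ, cchoose (p : ℂ) i • act (A.Yop u (r + i) v) (p + q - i) w)
      = ∑ᶠ i : ℕ, ((-1 : ℂ) ^ i * cchoose (r : ℂ) i) •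
          (act u (p + r - i) (act v (q + i) w)
            - (-1 : ℂ) ^ r • act v (q + r - i) (act u (p + i) w))

attribute [instance] WeakModule.grp WeakModule.mod

namespace WeakModule

variable {A : VOA} (M : WeakModule A)

/-- ℕ-gradability of a weak module. -/
def NGradable : Prop :=
  ∃ Q : ℕ → Module.End ℂ M.W,
    (∀ m n x, Q m (Q n x) = if m = n then Q n x else 0) ∧
    (∀ x : M.W, {n : ℕ | Q n x ≠ 0}.Finite) ∧
    (∀ x : M.W, (∑ᶠ n, Q n x) = x) ∧
    (∀ (mw : ℤ) (u : A.V), A.P mw u = u →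
      ∀ (n : ℤ) (k j : ℕ) (x : M.W), (j : ℤ) ≠ (k : ℤ) + mw - n - 1 →
        Q j (M.act u n (Q k x)) = 0)

/-- Subrepresentations of a weak module. -/
def IsSubrep (S : Submodule ℂ M.W) : Prop := ∀ u n x, x ∈ S → M.act u n x ∈ S

/-- Complete reducibility of a weak module. -/
def CompleteReducible : Prop :=
  ∃ (ι : Type) (S : ι → Submodule ℂ M.W),
    (∀ i, M.IsSubrep (S i)) ∧
    (∀ i, S i ≠ ⊥ ∧ ∀ T : Submodule ℂ M.W, M.IsSubrep T → T ≤ S i → T = ⊥ ∨ T = S i) ∧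
    (∀ i, Disjoint (S i) (⨆ (j) (_ : j ≠ i), S j)) ∧
    (⨆ i, S i) = ⊤

end WeakModule

/-- An ordinary (ℝ-graded, grading-restricted) module for a vertex operator algebra. -/
structure VModule (A : VOA) where
  W : Type
  [grp : AddCommGroup W]
  [mod : Module ℂ W]
  P : ℝ → Module.End ℂ W
  P_orth : ∀ m n x, P m (P n x) = if m = n then P n x else 0
  P_finite : ∀ x : W, {n : ℝ | P n x ≠ 0}.Finite
  P_total : ∀ x : W, (∑ᶠ n, P n x) = x
  P_lower : ∃ h : ℝ, ∀ r < h, P r = 0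
  P_findim : ∀ r, Module.Finite ℂ (LinearMap.range (P r))
  act : A.V → ℤ → Module.End ℂ W
  act_add : ∀ u u' n, act (u + u') n = act u n + act u' n
  act_smul : ∀ (c : ℂ) u n, act (c • u) n = c • act u n
  trunc : ∀ u w, ∃ N : ℤ, ∀ n ≥ N, act u n w = 0
  vac_id : ∀ n, act A.one n = if n = -1 then 1 else 0
  L0_grading : ∀ (r : ℝ) (x : W), act A.ω 1 (P r x) = (r : ℂ) • P r x
  borcherds : ∀ (u v : A.V) (w : W) (p q r : ℤ),
    (∑ᶠ i : ℕ, cchoose (p : ℂ) i • act (A.Yop u (r + i) v) (p + q - i) w)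
      = ∑ᶠ i : ℕ, ((-1 : ℂ) ^ i * cchoose (r : ℂ) i) •
          (act u (p + r - i) (act v (q + i) w)
            - (-1 : ℂ) ^ r • act v (q + r - i) (act u (p + i) w))

attribute [instance] VModule.grp VModule.mod

namespace VModule

variable {A : VOA} (M : VModule A)

/-- Subrepresentations of an ordinary module. -/
def IsSubrep (S : Submodule ℂ M.W) : Prop := ∀ u n x, x ∈ S → M.act u n x ∈ S

/-- Irreducibility of an ordinary module. -/
def IsIrred : Prop :=
  (∃ x : M.W, x ≠ 0) ∧ ∀ S : Submodule ℂ M.W, M.IsSubrep S → S = ⊥ ∨ S = ⊤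

/-- Isomorphism of ordinary modules. -/
def Iso (N : VModule A) : Prop :=
  ∃ e : M.W ≃ₗ[ℂ] N.W, ∀ u n x, e (M.act u n x) = N.act u n (e x)

/-- The graded dual of an ordinary module. -/
def Dual := {φ : M.W →ₗ[ℂ] ℂ // {r : ℝ | φ ∘ₗ M.P r ≠ 0}.Finite}

/-- The operator `e^{-L(1)}` (`w ↦ w̃` in the paper). -/
def expL1neg (w : M.W) : M.W :=
  ∑ᶠ j : ℕ, ((-1 : ℂ) ^ j / (j.factorial : ℂ)) • ((M.act A.ω 2) ^ j) w

/-- The operator `x^{L(0)}` for a real `x`, acting diagonally on the grading. -/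
def rL0 (x : ℝ) (w : M.W) : M.W := ∑ᶠ h : ℝ, ((Real.rpow x h : ℝ) : ℂ) • M.P h w

end VModule

namespace VOA

variable (A : VOA)

/-- Condition (i) on `V^L, V^R`: every ℂ-graded generalized module is a direct sum of
irreducible ones. -/
def CondI : Prop :=
  ∀ M : GenModule A, ∃ (ι : Type) (S : ι → Submodule ℂ M.W),
    (∀ i, M.IsSubrep (S i)) ∧
    (∀ i, S i ≠ ⊥ ∧ ∀ T : Submodule ℂ M.W, M.IsSubrep T → T ≤ S i → T = ⊥ ∨ T = S i) ∧
    (∀ i, Disjoint (S i) (⨆ (j) (_ : j ≠ i), S j)) ∧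
    (⨆ i, S i) = ⊤

/-- Condition (ii): finitely many inequivalent ℂ-graded irreducible modules, all
ℝ-graded. -/
def CondII : Prop :=
  ∃ (k : ℕ) (Ms : Fin k → GenModule A),
    (∀ i, (Ms i).IsIrred ∧ (Ms i).RealGraded) ∧
    ∀ M : GenModule A, M.IsIrred → ∃ i, M.Iso (Ms i)

/-- Condition (iii): every ℝ-graded irreducible module is `C₁`-cofinite. -/
def CondIII : Prop := ∀ M : GenModule A, M.IsIrred → M.RealGraded → M.C1Cofinite

/-- The three conditions (i)–(iii) of Section 2 of Huang–Kong. -/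
def Conds : Prop := A.CondI ∧ A.CondII ∧ A.CondIII

/-- Condition (i) of Section 3: positive energy, `V_(0) = ℂ𝟏`, and `W_(0) = 0` for
irreducible modules not equivalent to `V`. -/
def CondA : Prop :=
  (∀ n : ℤ, n < 0 → A.P n = 0) ∧
  (∀ x : A.V, A.P 0 x = x → ∃ c : ℂ, x = c • A.one) ∧
  (∀ M : GenModule A, M.IsIrred → ¬ M.IsoAdjoint → M.P 0 = 0)

/-- Condition (ii) of Section 3: every ℕ-gradable weak module is completely
reducible. -/
def CondB : Prop := ∀ M : WeakModule A, M.NGradable → M.CompleteReducible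

/-- The conditions of Section 3 of Huang–Kong on the vertex operator algebra `V`:
simplicity together with conditions (i)–(iii). -/
def CondsV : Prop := A.IsSimple ∧ A.CondA ∧ A.CondB ∧ A.C2Cofinite

end VOA
/-! ## Intertwining operators -/

/-- The ambient space of candidate intertwining operators of type `(W₃; W₁ W₂)`:
mode families `w₁ ↦ (n ↦ (w₂ ↦ 𝒴(w₁)_n w₂))`. -/
abbrev IOType (A : VOA) (W1 W2 W3 : VModule A) := W1.W → ℝ → W2.W → W3.W

/-- The defining properties of an intertwining operator of type `(W₃; W₁ W₂)`:
bilinearity, lower truncation, the `L(-1)`-derivative property, and the (Borcherds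
form of the) Jacobi identity. -/
def IsIntw (A : VOA) (W1 W2 W3 : VModule A) (f : IOType A W1 W2 W3) : Prop :=
  (∀ (x y : W1.W) (n : ℝ) (w : W2.W), f (x + y) n w = f x n w + f y n w) ∧
  (∀ (c : ℂ) (x : W1.W) (n : ℝ) (w : W2.W), f (c • x) n w = c • f x n w) ∧
  (∀ (x : W1.W) (n : ℝ) (w w' : W2.W), f x n (w + w') = f x n w + f x n w') ∧
  (∀ (c : ℂ) (x : W1.W) (n : ℝ) (w : W2.W), f x n (c • w) = c • f x n w) ∧
  (∀ (x : W1.W) (w : W2.W), ∃ N : ℝ, ∀ n ≥ N, f x n w = 0) ∧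
  (∀ (x : W1.W) (n : ℝ) (w : W2.W),
    f (W1.act A.ω 0 x) n w = (-(n : ℂ)) • f x (n - 1) w) ∧
  (∀ (u : A.V) (x : W1.W) (w : W2.W) (p r : ℤ) (q : ℝ),
    (∑ᶠ i : ℕ, cchoose (p : ℂ) i • f (W1.act u (r + i) x) ((p : ℝ) + q - (i : ℝ)) w)
      = ∑ᶠ i : ℕ, ((-1 : ℂ) ^ i * cchoose (r : ℂ) i) •
          (W3.act u (p + r - i) (f x (q + (i : ℝ)) w)
            - (-1 : ℂ) ^ r • f x (q + (r : ℝ) - (i : ℝ)) (W2.act u (p + i) w)))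

/-- The set of intertwining operators of type `(W₃; W₁ W₂)`. -/
def IntwSet (A : VOA) (W1 W2 W3 : VModule A) : Set (IOType A W1 W2 W3) :=
  {f | IsIntw A W1 W2 W3 f}

/-- The space of intertwining operators of type `(W₃; W₁ W₂)`. -/
def IntwSpace (A : VOA) (W1 W2 W3 : VModule A) : Submodule ℂ (IOType A W1 W2 W3) :=
  Submodule.span ℂ (IntwSet A W1 W2 W3)

/-- The fusion rule `N_{W₁ W₂}^{W₃}`. -/
def fusionRule (A : VOA) (W1 W2 W3 : VModule A) : ℕ :=
  Module.finrank ℂ (IntwSpace A W1 W2 W3)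

/-- The action `σ₁₂` (skew symmetry) on intertwining operators:
`σ₁₂(𝒴)(w₂, x)w₁ = e^{x L(-1)} 𝒴(w₁, e^{πi} x) w₂`, in mode form. -/
def sigma12 (A : VOA) (W1 W2 W3 : VModule A) (f : IOType A W1 W2 W3) :
    IOType A W2 W1 W3 :=
  fun w2 n w1 =>
    ∑ᶠ j : ℕ, (((j.factorial : ℂ))⁻¹ *
        Complex.exp ((Real.pi : ℂ) * Complex.I * (-(n + j) - 1))) •
      ((W3.act A.ω 0) ^ j) (f w1 (n + j) w2)

/-! ## The setup of irreducible modules, contragredient pairings and `S₃`-action -/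

/-- The data of the (finite) collection `𝒜` of equivalence classes of irreducible
`V`-modules, with chosen representatives, contragredient involution and pairings,
lowest weights, and the action `σ₂₃`. -/
structure IrrSetup (A : VOA) where
  𝒜 : Type
  [fin : Fintype 𝒜]
  [deceq : DecidableEq 𝒜]
  Wm : 𝒜 → VModule A
  e : 𝒜
  dual : 𝒜 → 𝒜
  dual_invol : ∀ a, dual (dual a) = a
  dual_e : dual e = e
  irr : ∀ a, (Wm a).IsIrred
  complete : ∀ M : VModule A, M.IsIrred → ∃ a, M.Iso (Wm a)
  distinct : ∀ a b, (Wm a).Iso (Wm b) → a = b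
  eqV : (Wm e).W ≃ₗ[ℂ] A.V
  eqV_act : ∀ u n x, eqV ((Wm e).act u n x) = A.Yop u n (eqV x)
  hwt : 𝒜 → ℝ
  hwt_support : ∀ a (r : ℝ), (Wm a).P r ≠ 0 → ∃ k : ℕ, r = hwt a + k
  pairW : ∀ a, (Wm (dual a)).W → (Wm a).W → ℂ
  pairW_bilin : ∀ a, IsBilinMap (pairW a)
  pairW_nondegl : ∀ a x, (∀ y, pairW a x y = 0) → x = 0
  pairW_nondegr : ∀ a y, (∀ x, pairW a x y = 0) → y = 0
  pairW_graded : ∀ a (r s : ℝ) x y, r ≠ s →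
    pairW a ((Wm (dual a)).P r x) ((Wm a).P s y) = 0
  pairW_adj : ∀ a (mw : ℤ) (u : A.V), A.P mw u = u → ∀ (n : ℤ) x y,
    pairW a ((Wm (dual a)).act u n x) y
      = ∑ᶠ j : ℕ, (((-1 : ℂ) ^ mw) / (j.factorial : ℂ)) *
          pairW a x ((Wm a).act (((A.Yop A.ω 2) ^ j) u) (2 * mw - n - 2 - j) y)
  s23 : ∀ a1 a2 a3, IOType A (Wm a1) (Wm a2) (Wm a3) →
    IOType A (Wm a1) (Wm (dual a3)) (Wm (dual a2))
  s23_intw : ∀ a1 a2 a3 f, IsIntw A (Wm a1) (Wm a2) (Wm a3) f →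
    IsIntw A (Wm a1) (Wm (dual a3)) (Wm (dual a2)) (s23 a1 a2 a3 f)
  s23_def : ∀ a1 a2 a3 (f : IOType A (Wm a1) (Wm a2) (Wm a3)) (h : ℝ) (w1 : (Wm a1).W),
    (Wm a1).P h w1 = w1 →
    ∀ (n : ℝ) (w3' : (Wm (dual a3)).W) (w2 : (Wm a2).W),
      pairW a2 (s23 a1 a2 a3 f w1 n w3') w2
        = Complex.exp ((Real.pi : ℂ) * Complex.I * ((hwt a1 : ℂ) - (h : ℂ))) *
            ∑ᶠ j : ℕ, ((j.factorial : ℂ))⁻¹ *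
              pairW a3 w3' (f ((((Wm a1).act A.ω 2) ^ j) w1)
                (2 * h - n - 2 - j) w2)

attribute [instance] IrrSetup.fin IrrSetup.deceq

namespace IrrSetup

variable {A : VOA} (S : IrrSetup A)

/-- Transport of vectors along an equality of labels. -/
def vcast {a b : S.𝒜} (h : a = b) (x : (S.Wm a).W) : (S.Wm b).W :=
  cast (congrArg (fun c => (S.Wm c).W) h) x

/-- Transport of candidate intertwining operators along equalities of labels. -/
def icast {a1 b1 a2 b2 a3 b3 : S.𝒜} (h1 : a1 = b1) (h2 : a2 = b2) (h3 : a3 = b3)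
    (f : IOType A (S.Wm a1) (S.Wm a2) (S.Wm a3)) :
    IOType A (S.Wm b1) (S.Wm b2) (S.Wm b3) :=
  fun w1 n w2 => S.vcast h3 (f (S.vcast h1.symm w1) n (S.vcast h2.symm w2))

/-- The canonical intertwining operator `𝒴_{ea;1}^a`, the vertex operator defining the
module structure on `W^a`. -/
def Yea (a : S.𝒜) : IOType A (S.Wm S.e) (S.Wm a) (S.Wm a) :=
  fun v n w => by
    classical exact
      if h : ∃ m : ℤ, (m : ℝ) = n then (S.Wm a).act (S.eqV v) h.choose w else 0

/-- The canonical intertwining operator `𝒴_{ae;1}^a = σ₁₂(𝒴_{ea;1}^a)`. -/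
def Yae (a : S.𝒜) : IOType A (S.Wm a) (S.Wm S.e) (S.Wm a) :=
  sigma12 A (S.Wm S.e) (S.Wm a) (S.Wm a) (S.Yea a)

/-- The canonical intertwining operator `𝒴_{aa';1}^e = σ₂₃(𝒴_{ae;1}^a)`. -/
def Yaad (a : S.𝒜) : IOType A (S.Wm a) (S.Wm (S.dual a)) (S.Wm S.e) :=
  S.icast rfl rfl S.dual_e (S.s23 a S.e a (S.Yae a))

/-- The matrix coefficient of the product
`⟨w₄', 𝒴₁(w₁, z₁) 𝒴₂(w₂, z₂) w₃⟩` at real points `z₁, z₂ > 0` (no branch ambiguity). -/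
def prodEval {a1 a2 a3 a4 a5 : S.𝒜}
    (f1 : IOType A (S.Wm a1) (S.Wm a5) (S.Wm a4))
    (f2 : IOType A (S.Wm a2) (S.Wm a3) (S.Wm a5)) (z1 z2 : ℝ)
    (w1 : (S.Wm a1).W) (w2 : (S.Wm a2).W) (w3 : (S.Wm a3).W)
    (w4' : (S.Wm (S.dual a4)).W) : ℂ :=
  ∑' mn : ℝ × ℝ,
    ((Real.rpow z1 (-mn.1 - 1) : ℝ) : ℂ) * ((Real.rpow z2 (-mn.2 - 1) : ℝ) : ℂ) *
      S.pairW a4 w4' (f1 w1 mn.1 (f2 w2 mn.2 w3))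

/-- The matrix coefficient of the iterate
`⟨w₄', 𝒴₃(𝒴₄(w₁, z₀) w₂, z₂) w₃⟩` at real points `z₀, z₂ > 0`. -/
def iterEval {a1 a2 a3 a4 a6 : S.𝒜}
    (f3 : IOType A (S.Wm a6) (S.Wm a3) (S.Wm a4))
    (f4 : IOType A (S.Wm a1) (S.Wm a2) (S.Wm a6)) (z0 z2 : ℝ)
    (w1 : (S.Wm a1).W) (w2 : (S.Wm a2).W) (w3 : (S.Wm a3).W)
    (w4' : (S.Wm (S.dual a4)).W) : ℂ :=
  ∑' mn : ℝ × ℝ,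
    ((Real.rpow z0 (-mn.1 - 1) : ℝ) : ℂ) * ((Real.rpow z2 (-mn.2 - 1) : ℝ) : ℂ) *
      S.pairW a4 w4' (f3 (f4 w1 mn.1 w2) mn.2 w3)

/-- The series
`⟨e^{L(1)} 𝒴₂((1-z₁-z₂)^{L(0)} w̃'₁, z₁) w̃'₂, e^{L(1)} 𝒴₁((1-z₁-z₂)^{L(0)} w̃₁, z₂) w̃₂⟩`
of Proposition 3.2 of Huang–Kong, evaluated on the real slice `x = 1 - z₁ - z₂ > 0`,
`z₂ > 0` (so `z₁ = 1 - z₂ - x`). -/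
def resExpr {a1 a2 a3 : S.𝒜}
    (Y1 : IOType A (S.Wm a1) (S.Wm a2) (S.Wm a3))
    (Y2 : IOType A (S.Wm (S.dual a1)) (S.Wm (S.dual a2)) (S.Wm (S.dual a3)))
    (x z2 : ℝ) (w1 : (S.Wm a1).W) (w2 : (S.Wm a2).W)
    (w1' : (S.Wm (S.dual a1)).W) (w2' : (S.Wm (S.dual a2)).W) : ℂ :=
  ∑' q : (ℝ × ℝ) × ℕ × ℕ,
    (((Real.rpow (1 - z2 - x) (-q.1.1 - 1) * Real.rpow z2 (-q.1.2 - 1)) : ℝ) : ℂ) /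
        ((q.2.1.factorial : ℂ) * (q.2.2.factorial : ℂ)) *
      S.pairW a3
        ((((S.Wm (S.dual a3)).act A.ω 2) ^ q.2.1)
          (Y2 ((S.Wm (S.dual a1)).rL0 x ((S.Wm (S.dual a1)).expL1neg w1')) q.1.1
            ((S.Wm (S.dual a2)).expL1neg w2')))
        ((((S.Wm a3).act A.ω 2) ^ q.2.2)
          (Y1 ((S.Wm a1).rL0 x ((S.Wm a1).expL1neg w1)) q.1.2
            ((S.Wm a2).expL1neg w2)))

/-- `pr` is the family of pairings `⟨·,·⟩_{𝒱_{a₁a₂}^{a₃}}` defined by the residue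
formula (2.? / (3.3)) of Huang–Kong: the expression `resExpr`, as a function of
`x = 1 - z₁ - z₂`, expands in real powers of `x`, and the coefficient of `x⁰`
(= the residue of `x⁻¹` times the expression) equals
`⟨w'₁, w₁⟩ ⟨w'₂, w₂⟩ ⟨𝒴₁, 𝒴₂⟩`. -/
def IsVPairing
    (pr : ∀ a1 a2 a3 : S.𝒜, IOType A (S.Wm a1) (S.Wm a2) (S.Wm a3) →
      IOType A (S.Wm (S.dual a1)) (S.Wm (S.dual a2)) (S.Wm (S.dual a3)) → ℂ) : Prop :=
  ∀ (a1 a2 a3 : S.𝒜) (Y1 : IOType A (S.Wm a1) (S.Wm a2) (S.Wm a3))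
    (Y2 : IOType A (S.Wm (S.dual a1)) (S.Wm (S.dual a2)) (S.Wm (S.dual a3))),
    Y1 ∈ IntwSet A (S.Wm a1) (S.Wm a2) (S.Wm a3) →
    Y2 ∈ IntwSet A (S.Wm (S.dual a1)) (S.Wm (S.dual a2)) (S.Wm (S.dual a3)) →
    ∀ w1 w2 w1' w2', ∃ c : ℝ → ℝ → ℂ,
      (∀ x z2 : ℝ, 0 < x → x < z2 → x + z2 < 1 →
        Summable (fun n : ℝ => ‖c n z2 * ((Real.rpow x n : ℝ) : ℂ)‖) ∧
        S.resExpr Y1 Y2 x z2 w1 w2 w1' w2'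
          = ∑' n : ℝ, c n z2 * ((Real.rpow x n : ℝ) : ℂ)) ∧
      (∀ z2 : ℝ, 0 < z2 → z2 < 1 →
        c 0 z2 = S.pairW a1 w1' w1 * S.pairW a2 w2' w2 * pr a1 a2 a3 Y1 Y2)

end IrrSetup
/-! ## Tensor product vertex operator algebras -/

/-- A vertex operator algebra realizing the tensor product `V^L ⊗ V^R`: a VOA `T`
together with a linear equivalence from `V^L ⊗ V^R` identifying vacua, conformal
elements, gradings and vertex operators. -/
structure TensorVOA (A B : VOA) where
  T : VOA
  ψ : TensorProduct ℂ A.V B.V ≃ₗ[ℂ] T.V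
  ψ_one : ψ (A.one ⊗ₜ[ℂ] B.one) = T.one
  ψ_ω : ψ (A.ω ⊗ₜ[ℂ] B.one + A.one ⊗ₜ[ℂ] B.ω) = T.ω
  ψ_P : ∀ (p q : ℤ) (u : A.V) (v : B.V) (n : ℤ),
    T.P n (ψ (A.P p u ⊗ₜ[ℂ] B.P q v))
      = if n = p + q then ψ (A.P p u ⊗ₜ[ℂ] B.P q v) else 0
  ψ_Y : ∀ (u : A.V) (v : B.V) (w : A.V) (w' : B.V) (n : ℤ),
    T.Yop (ψ (u ⊗ₜ[ℂ] v)) n (ψ (w ⊗ₜ[ℂ] w'))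
      = ψ (∑ᶠ i : ℤ, A.Yop u i w ⊗ₜ[ℂ] B.Yop v (n - 1 - i) w')

/-! ## Full field algebras over `V^L ⊗ V^R` -/

/-- A (conformal) full field algebra over `V^L ⊗ V^R`: a grading-restricted ℝ×ℝ-graded
full field algebra equipped with an injective homomorphism `ρ` from the full field
algebra `V^L ⊗ V^R`, such that `𝔡^L = L^L(0)`, `𝔡^R = L^R(0)`, `D^L = L^L(-1)` and
`D^R = L^R(-1)`, where `L^{L}(n)` (resp. `L^R(n)`) are the modes of the formal full
vertex operator of `ρ(ω^L ⊗ 𝟏^R)` (resp. `ρ(𝟏^L ⊗ ω^R)`). -/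
structure FFAover (A B : VOA) extends RxRFFA where
  grading_res : toRxRFFA.GradingRestricted
  ρ : TensorProduct ℂ A.V B.V →ₗ[ℂ] g.F
  ρ_inj : Function.Injective ρ
  ρ_vac : ρ (A.one ⊗ₜ[ℂ] B.one) = vac
  ρ_grading : ∀ (p q : ℤ) (u : A.V) (v : B.V) (p' q' : ℝ),
    PLR p' q' (ρ (A.P p u ⊗ₜ[ℂ] B.P q v))
      = if p' = (p : ℝ) ∧ q' = (q : ℝ) then ρ (A.P p u ⊗ₜ[ℂ] B.P q v) else 0
  ρ_Y : ∀ (u : A.V) (v : B.V) (w : A.V) (w' : B.V) (z : ℂ), z ≠ 0 → ∀ r : ℝ,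
    toFullFieldAlgebra.Y (ρ (u ⊗ₜ[ℂ] v)) z (ρ (w ⊗ₜ[ℂ] w')) r
      = ρ (∑ᶠ n : ℤ, ∑ᶠ m : ℤ, ∑ᶠ p : ℤ, ∑ᶠ q : ℤ,
          (if ((p : ℝ) + (q : ℝ) = r) then (1 : ℂ) else 0) •
            (z ^ (-n - 1) * (starRingEnd ℂ z) ^ (-m - 1)) •
              (A.P p (A.Yop u n w) ⊗ₜ[ℂ] B.P q (B.Yop v m w')))
  dL_L0 : ∀ x, dLop x = toRxRFFA.Ymode (ρ (A.ω ⊗ₜ[ℂ] B.one)) 1 (-1) x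
  dR_L0 : ∀ x, dRop x = toRxRFFA.Ymode (ρ (A.one ⊗ₜ[ℂ] B.ω)) (-1) 1 x
  DL_L1 : ∀ x, DL x = toRxRFFA.Ymode (ρ (A.ω ⊗ₜ[ℂ] B.one)) 0 (-1) x
  DR_L1 : ∀ x, DR x = toRxRFFA.Ymode (ρ (A.one ⊗ₜ[ℂ] B.ω)) (-1) 0 x

namespace FFAover

variable {A B : VOA} (Φ : FFAover A B)

/-- The Virasoro operators `L^L(n)` of a full field algebra over `V^L ⊗ V^R`. -/
def LL (n : ℤ) (x : Φ.g.F) : Φ.g.F :=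
  Φ.Ymode (Φ.ρ (A.ω ⊗ₜ[ℂ] B.one)) ((n : ℝ) + 1) (-1) x

/-- The Virasoro operators `L^R(n)` of a full field algebra over `V^L ⊗ V^R`. -/
def LR (n : ℤ) (x : Φ.g.F) : Φ.g.F :=
  Φ.Ymode (Φ.ρ (A.one ⊗ₜ[ℂ] B.ω)) (-1) ((n : ℝ) + 1) x

end FFAover

/-! ## Bigradings and analytic splittings on modules for `V^L ⊗ V^R` -/

/-- The bidegree-`(l, r)` mode `𝕐_{l,r}` of an intertwining operator `f` of type
`(F; F F)` on a bigraded module, extracted from the mode `l + r + 1` by bigraded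
components. -/
def bimode {A : VOA} (M : VModule A) (Q : ℝ → ℝ → Module.End ℂ M.W)
    (f : IOType A M M M) (u : M.W) (l r : ℝ) (v : M.W) : M.W :=
  ∑ᶠ a : ℝ, ∑ᶠ b : ℝ, ∑ᶠ c : ℝ, ∑ᶠ d : ℝ,
    Q (a + c - l - 1) (b + d - r - 1) (f (Q a b u) (l + r + 1) (Q c d v))

/-- `Q` is the bigrading of a module for `V^L ⊗ V^R` by the eigenvalues of
`L^L(0)` and `L^R(0)`. -/
def GoodBigrading {A B : VOA} (T : TensorVOA A B) (M : VModule T.T)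
    (Q : ℝ → ℝ → Module.End ℂ M.W) : Prop :=
  (∀ p q p' q' x, Q p q (Q p' q' x) = if p = p' ∧ q = q' then Q p' q' x else 0) ∧
  (∀ x : M.W, {pq : ℝ × ℝ | Q pq.1 pq.2 x ≠ 0}.Finite) ∧
  (∀ (r : ℝ) (x : M.W), M.P r x = ∑ᶠ p : ℝ, Q p (r - p) x) ∧
  (∀ (p q : ℝ) (x : M.W),
    M.act (T.ψ (A.ω ⊗ₜ[ℂ] B.one)) 1 (Q p q x) = (p : ℂ) • Q p q x) ∧
  (∀ (p q : ℝ) (x : M.W),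
    M.act (T.ψ (A.one ⊗ₜ[ℂ] B.ω)) 1 (Q p q x) = (q : ℂ) • Q p q x)

/-- A term of the expansion of `⟨w', 𝕐_an(u; z₁, ζ₁) 𝕐_an(v; z₂, ζ₂) w⟩` for the
analytic splitting of an intertwining operator on a bigraded module. -/
def anProdTerm {A : VOA} (M : VModule A) (Q : ℝ → ℝ → Module.End ℂ M.W)
    (f : IOType A M M M) (w' : M.Dual) (u v w : M.W) (z1 ζ1 z2 ζ2 : ℂ)
    (p : (ℝ × ℝ) × ℝ × ℝ) : ℂ :=
  cpowNN z1 (-(p.1.1 : ℂ) - 1) * cpowNNbar ζ1 (-(p.1.2 : ℂ) - 1) *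
  cpowNN z2 (-(p.2.1 : ℂ) - 1) * cpowNNbar ζ2 (-(p.2.2 : ℂ) - 1) *
  w'.1 (bimode M Q f u p.1.1 p.1.2 (bimode M Q f v p.2.1 p.2.2 w))

/-- A term of the expansion of `⟨w', 𝕐_an(𝕐_an(u; z₁-z₂, ζ₁-ζ₂)v; z₂, ζ₂) w⟩`. -/
def anIterTerm {A : VOA} (M : VModule A) (Q : ℝ → ℝ → Module.End ℂ M.W)
    (f : IOType A M M M) (w' : M.Dual) (u v w : M.W) (z1 ζ1 z2 ζ2 : ℂ)
    (p : (ℝ × ℝ) × ℝ × ℝ) : ℂ :=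
  cpowNN (z1 - z2) (-(p.1.1 : ℂ) - 1) * cpowNNbar (ζ1 - ζ2) (-(p.1.2 : ℂ) - 1) *
  cpowNN z2 (-(p.2.1 : ℂ) - 1) * cpowNNbar ζ2 (-(p.2.2 : ℂ) - 1) *
  w'.1 (bimode M Q f (bimode M Q f u p.1.1 p.1.2 v) p.2.1 p.2.2 w)

/-- The five conditions of Theorem 2.? (`r-conf-alg-2-prop`) of Huang–Kong on a module
`F` for `V^L ⊗ V^R`, an intertwining operator `𝒴` of type `(F; F F)` and an injective
linear map `ρ : V^L ⊗ V^R → F`: the identity property, the creation property,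
associativity of the analytic splitting, single-valuedness, and skew symmetry. -/
def FiveConds {A B : VOA} (T : TensorVOA A B) (M : VModule T.T)
    (Q : ℝ → ℝ → Module.End ℂ M.W) (f : IOType T.T M M M)
    (ρ₀ : TensorProduct ℂ A.V B.V →ₗ[ℂ] M.W) : Prop :=
  -- (1) identity property
  (∀ (n : ℝ) (w : M.W),
    f (ρ₀ (A.one ⊗ₜ[ℂ] B.one)) n w = if n = -1 then w else 0) ∧
  -- (2) creation property
  (∀ u : M.W, f u (-1) (ρ₀ (A.one ⊗ₜ[ℂ] B.one)) = u ∧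
    ∀ n : ℝ, -1 < n → f u n (ρ₀ (A.one ⊗ₜ[ℂ] B.one)) = 0) ∧
  -- (3) associativity of the analytic splitting in |z₁|>|z₂|>0, |ζ₁|>|ζ₂|>0
  (∀ (u v w : M.W) (w' : M.Dual) (z1 ζ1 z2 ζ2 : ℂ),
    ‖z1‖ > ‖z2‖ → ‖z2‖ > 0 →
    ‖ζ1‖ > ‖ζ2‖ → ‖ζ2‖ > 0 →
      Summable (fun p : (ℝ × ℝ) × ℝ × ℝ =>
        ‖anProdTerm M Q f w' u v w z1 ζ1 z2 ζ2 p‖) ∧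
      Summable (fun p : (ℝ × ℝ) × ℝ × ℝ =>
        ‖anIterTerm M Q f w' u v w z1 ζ1 z2 ζ2 p‖) ∧
      (∑' p : (ℝ × ℝ) × ℝ × ℝ, anProdTerm M Q f w' u v w z1 ζ1 z2 ζ2 p)
        = ∑' p : (ℝ × ℝ) × ℝ × ℝ, anIterTerm M Q f w' u v w z1 ζ1 z2 ζ2 p) ∧
  -- (4) single-valuedness
  (∀ (p q : ℝ) (x : M.W),
    Complex.exp (((2 * Real.pi : ℝ) : ℂ) * Complex.I * ((p : ℂ) - (q : ℂ))) • Q p q x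
      = Q p q x) ∧
  -- (5) skew symmetry: 𝕐^𝒴(u; 1, 1)v = e^{L^L(-1)+L^R(-1)} 𝕐^𝒴(v; e^{πi}, e^{-πi})u
  (∀ (u v : M.W) (w' : M.Dual),
    Summable (fun n : ℝ => ‖w'.1 (f u n v)‖) ∧
    Summable (fun q : (ℝ × ℝ) × ℕ × ℕ =>
      ‖(Complex.exp ((Real.pi : ℂ) * Complex.I * (-(q.1.1 : ℂ) - 1)) *
          Complex.exp (-(Real.pi : ℂ) * Complex.I * (-(q.1.2 : ℂ) - 1)) /
          ((q.2.1.factorial : ℂ) * (q.2.2.factorial : ℂ))) *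
        w'.1 ((M.act (T.ψ (A.ω ⊗ₜ[ℂ] B.one)) 0 ^ q.2.1)
          ((M.act (T.ψ (A.one ⊗ₜ[ℂ] B.ω)) 0 ^ q.2.2)
            (bimode M Q f v q.1.1 q.1.2 u)))‖) ∧
    (∑' n : ℝ, w'.1 (f u n v))
      = ∑' q : (ℝ × ℝ) × ℕ × ℕ,
          (Complex.exp ((Real.pi : ℂ) * Complex.I * (-(q.1.1 : ℂ) - 1)) *
            Complex.exp (-(Real.pi : ℂ) * Complex.I * (-(q.1.2 : ℂ) - 1)) /
            ((q.2.1.factorial : ℂ) * (q.2.2.factorial : ℂ))) *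
          w'.1 ((M.act (T.ψ (A.ω ⊗ₜ[ℂ] B.one)) 0 ^ q.2.1)
            ((M.act (T.ψ (A.one ⊗ₜ[ℂ] B.ω)) 0 ^ q.2.2)
              (bimode M Q f v q.1.1 q.1.2 u))))
/-! ## Locally finite operators -/

section LocallyFinite

open Polynomial Module.End

variable {W : Type*} [AddCommGroup W] [Module ℂ W]

/-- Every vector is annihilated by a nonzero polynomial in `f` whose roots lie in `Z`. -/
def LocFin (Z : Set ℂ) (f : Module.End ℂ W) : Prop :=
  ∀ x, ∃ p : ℂ[X], p ≠ 0 ∧ (∀ a, p.IsRoot a → a ∈ Z) ∧ aeval f p x = 0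

theorem aeval_X_sub_C_apply (f : Module.End ℂ W) (a : ℂ) (x : W) :
    aeval f (X - C a) x = f x - a • x := by
  simp [Module.algebraMap_end_eq_smul_id]

theorem aeval_X_sub_C_eq (f : Module.End ℂ W) (a : ℂ) :
    aeval f (X - C a) = f - a • (1 : Module.End ℂ W) := by
  ext x; simp [Module.algebraMap_end_eq_smul_id]

theorem mem_maxGen_iff (f : Module.End ℂ W) (a : ℂ) (x : W) :
    x ∈ maxGenEigenspace f a ↔ ∃ k : ℕ, aeval f ((X - C a) ^ k) x = 0 := by
  rw [mem_maxGenEigenspace]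
  simp only [map_pow, aeval_X_sub_C_eq]

theorem eq_zero_of_isCoprime_aeval {f : Module.End ℂ W} {p q : ℂ[X]} (h : IsCoprime p q) {x : W}
    (hp : aeval f p x = 0) (hq : aeval f q x = 0) : x = 0 := by
  obtain ⟨a, b, hab⟩ := h
  have := congrArg (fun r => aeval f r x) hab
  simpa [hp, hq] using this.symm

theorem isCoprime_X_sub_C_pow {p : ℂ[X]} {a : ℂ} (h : ¬ p.IsRoot a) (k : ℕ) :
    IsCoprime ((X - C a) ^ k) p := by
  apply IsCoprime.pow_left
  rw [(irreducible_X_sub_C a).coprime_iff_not_dvd]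
  rwa [dvd_iff_isRoot]

theorem LocFin.mem_of_maxGen {Z : Set ℂ} {f : Module.End ℂ W} (h : LocFin Z f) {a : ℂ} {x : W}
    (hx : x ∈ maxGenEigenspace f a) (h0 : x ≠ 0) : a ∈ Z := by
  obtain ⟨p, -, hr, hp⟩ := h x
  by_contra ha
  obtain ⟨k, hk⟩ := (mem_maxGen_iff f a x).1 hx
  exact h0 (eq_zero_of_isCoprime_aeval (isCoprime_X_sub_C_pow (fun h => ha (hr a h)) k) hk hp)

theorem aeval_mem_maxGen (f : Module.End ℂ W) (a : ℂ) (p : ℂ[X]) {x : W}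
    (hx : x ∈ maxGenEigenspace f a) : aeval f p x ∈ maxGenEigenspace f a := by
  rw [mem_maxGen_iff] at hx ⊢
  obtain ⟨k, hk⟩ := hx
  refine ⟨k, ?_⟩
  rw [← Module.End.mul_apply, ← map_mul, mul_comm, map_mul, Module.End.mul_apply, hk, map_zero]

theorem mem_iSup_maxGen_of_sub {f : Module.End ℂ W} {Z : Set ℂ} {a : ℂ} (ha : a ∈ Z) {x : W}
    (hx : f x - a • x ∈ ⨆ b ∈ Z, maxGenEigenspace f b) :
    x ∈ ⨆ b ∈ Z, maxGenEigenspace f b := by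
  have le : ∀ b ∈ Z, maxGenEigenspace f b ≤ ⨆ b ∈ Z, maxGenEigenspace f b :=
    fun b hb => le_biSup (f := fun b => maxGenEigenspace f b) hb
  have key : ∀ y ∈ ⨆ b ∈ Z, maxGenEigenspace f b, ∃ z ∈ ⨆ b ∈ Z, maxGenEigenspace f b,
      y - (f z - a • z) ∈ maxGenEigenspace f a := by
    intro y hy
    rw [iSup_subtype'] at hy
    induction hy using Submodule.iSup_induction' with
    | mem b y hy =>
      by_cases hb : (b : ℂ) = a
      · exact ⟨0, Submodule.zero_mem _, by simpa [← hb] using hy⟩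
      · obtain ⟨k, hk⟩ := (mem_maxGen_iff f b y).1 hy
        have : IsCoprime ((X - C (b : ℂ)) ^ k) (X - C a) :=
          isCoprime_X_sub_C_pow (by simpa [sub_eq_zero] using hb) k
        obtain ⟨c, d, hcd⟩ := this
        refine ⟨aeval f d y, le b b.2 (aeval_mem_maxGen f b d hy), ?_⟩
        have h1 := congrArg (fun r => aeval f r y) hcd
        rw [← aeval_X_sub_C_apply, ← Module.End.mul_apply, ← map_mul]
        simp only [map_add, LinearMap.add_apply, map_mul, Module.End.mul_apply, hk, map_zero,
          zero_add, map_one, Module.End.one_apply] at h1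
        rw [mul_comm, map_mul, Module.End.mul_apply, h1, sub_self]
        exact Submodule.zero_mem _
    | zero => exact ⟨0, Submodule.zero_mem _, by simp⟩
    | add y y' _ _ h h' =>
      obtain ⟨z, hz, h⟩ := h
      obtain ⟨z', hz', h'⟩ := h'
      refine ⟨z + z', Submodule.add_mem _ hz hz', ?_⟩
      convert Submodule.add_mem _ h h' using 1
      simp only [map_add, smul_add]; abel
  obtain ⟨z, hz, h⟩ := key _ hx
  have : x - z ∈ maxGenEigenspace f a := by
    rw [mem_maxGen_iff] at h ⊢
    obtain ⟨k, hk⟩ := h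
    refine ⟨k + 1, ?_⟩
    rw [pow_succ, map_mul, Module.End.mul_apply, aeval_X_sub_C_apply, ← hk]
    congr 1
    simp only [map_sub, smul_sub]; abel
  have := Submodule.add_mem _ (le a ha this) hz
  simpa using this

theorem LocFin.iSup_eq_top {Z : Set ℂ} {f : Module.End ℂ W} (h : LocFin Z f) :
    ⨆ b ∈ Z, maxGenEigenspace f b = ⊤ := by
  rw [eq_top_iff]
  rintro x -
  obtain ⟨p, h0, hr, hp⟩ := h x
  have hs := IsAlgClosed.splits p
  rw [hs.eq_prod_roots] at hp
  have hp' : aeval f (p.roots.map fun a => X - C a).prod x = 0 := by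
    rw [map_mul, Module.End.mul_apply, aeval_C] at hp
    simpa [Module.algebraMap_end_eq_smul_id, h0] using hp
  have hr' : ∀ a ∈ p.roots, a ∈ Z := fun a ha => hr a (isRoot_of_mem_roots ha)
  clear hp hs h0 hr
  generalize p.roots = s at hp' hr'
  induction s using Multiset.induction_on generalizing x with
  | empty => simp at hp'; simp [hp']
  | cons a s ih =>
    apply mem_iSup_maxGen_of_sub (hr' a (by simp))
    apply ih
    · rw [Multiset.map_cons, Multiset.prod_cons, mul_comm, map_mul, Module.End.mul_apply,
        aeval_X_sub_C_apply] at hp'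
      exact hp'
    · exact fun b hb => hr' b (by simp [hb])

theorem locFin_of_iSup {Z : Set ℂ} {f : Module.End ℂ W}
    (h : ⨆ b ∈ Z, maxGenEigenspace f b = ⊤) : LocFin Z f := by
  intro x
  have hx : x ∈ ⨆ b ∈ Z, maxGenEigenspace f b := h ▸ Submodule.mem_top
  rw [iSup_subtype'] at hx
  induction hx using Submodule.iSup_induction' with
  | mem b y hy =>
    obtain ⟨k, hk⟩ := (mem_maxGen_iff f b y).1 hy
    refine ⟨_, pow_ne_zero k (X_sub_C_ne_zero (b : ℂ)), fun a ha => ?_, hk⟩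
    have : a - b = 0 := by
      simp only [IsRoot, eval_pow, eval_sub, eval_X, eval_C] at ha
      exact eq_zero_of_pow_eq_zero ha
    rw [sub_eq_zero.1 this]; exact b.2
  | zero => exact ⟨1, one_ne_zero, by simp, by simp⟩
  | add y y' _ _ h h' =>
    obtain ⟨p, h0, hr, hp⟩ := h
    obtain ⟨p', h0', hr', hp'⟩ := h'
    refine ⟨p * p', mul_ne_zero h0 h0', fun a ha => ?_, ?_⟩
    · rcases root_mul.1 ha with h | h
      exacts [hr a h, hr' a h]
    · rw [map_add]
      nth_rewrite 1 [mul_comm]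
      simp only [map_mul, Module.End.mul_apply, hp, hp', map_zero, add_zero]

theorem LocFin.mono {Z Z' : Set ℂ} {f : Module.End ℂ W} (h : LocFin Z f) (hZ : Z ⊆ Z') :
    LocFin Z' f := fun x => by
  obtain ⟨p, h0, hr, hp⟩ := h x
  exact ⟨p, h0, fun a ha => hZ (hr a ha), hp⟩

theorem aeval_intertwine {W' : Type*} [AddCommGroup W'] [Module ℂ W'] {f : Module.End ℂ W}
    {g : Module.End ℂ W'} (e : W →ₗ[ℂ] W') (he : ∀ x, e (f x) = g (e x)) (p : ℂ[X]) (x : W) :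
    e (aeval f p x) = aeval g p (e x) := by
  induction p using Polynomial.induction_on' generalizing x with
  | add p q hp hq => simp [hp, hq]
  | monomial n a =>
    simp only [aeval_monomial, Module.End.mul_apply, Module.algebraMap_end_apply, map_smul]
    congr 1
    induction n generalizing x with
    | zero => simp
    | succ n ih => rw [pow_succ, Module.End.mul_apply, ih, he, pow_succ, Module.End.mul_apply]

theorem LocFin.of_injective {W' : Type*} [AddCommGroup W'] [Module ℂ W'] {Z : Set ℂ}
    {f : Module.End ℂ W} {g : Module.End ℂ W'} (h : LocFin Z g) (e : W →ₗ[ℂ] W')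
    (he : ∀ x, e (f x) = g (e x)) (hi : Function.Injective e) : LocFin Z f := fun x => by
  obtain ⟨p, h0, hr, hp⟩ := h (e x)
  refine ⟨p, h0, hr, hi ?_⟩
  rw [aeval_intertwine e he, hp, map_zero]

/-- Data of the projections onto generalized eigenspaces. -/
structure IsGenProj (f : Module.End ℂ W) (P : ℂ → Module.End ℂ W) : Prop where
  orth : ∀ m n x, P m (P n x) = if m = n then P n x else 0
  finite : ∀ x : W, {n : ℂ | P n x ≠ 0}.Finite
  total : ∀ x : W, (∑ᶠ n, P n x) = x
  gen : ∀ (n : ℂ) (x : W), ∃ k : ℕ, ((f - n • (1 : Module.End ℂ W)) ^ k) (P n x) = 0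

theorem LocFin.exists_proj {Z : Set ℂ} {f : Module.End ℂ W} (h : LocFin Z f) :
    ∃ P : ℂ → Module.End ℂ W, IsGenProj f P := by
  classical
  have htop : ⨆ b, maxGenEigenspace f b = ⊤ := by
    have := (h.mono (Set.subset_univ Z)).iSup_eq_top
    simpa using this
  have hInt : DirectSum.IsInternal (fun b => maxGenEigenspace f b) :=
    DirectSum.isInternal_submodule_of_iSupIndep_of_iSup_eq_top
      (independent_maxGenEigenspace f) htop
  let dec : DirectSum.Decomposition (fun b => maxGenEigenspace f b) := hInt.chooseDecomposition
  let P : ℂ → Module.End ℂ W := fun b =>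
    (maxGenEigenspace f b).subtype ∘ₗ DirectSum.component ℂ ℂ _ b ∘ₗ
      (DirectSum.decomposeLinearEquiv (fun b => maxGenEigenspace f b)).toLinearMap
  have hP : ∀ b x, P b x = (DirectSum.decompose (fun b => maxGenEigenspace f b) x b : W) :=
    fun b x => rfl
  have hfin : ∀ x : W, {n : ℂ | P n x ≠ 0}.Finite := fun x => by
    refine (DFinsupp.support (DirectSum.decompose (fun b => maxGenEigenspace f b) x)).finite_toSet.subset ?_
    intro n hn
    simpa [hP] using hn
  refine ⟨P, fun m n x => ?_, hfin, fun x => ?_, fun n x => ?_⟩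
  · rw [hP, hP, DirectSum.decompose_coe, DirectSum.coe_of_apply]
    by_cases hmn : m = n
    · subst hmn; simp
    · rw [if_neg (Ne.symm hmn), if_neg hmn]; rfl
  · conv_rhs => rw [← DirectSum.sum_support_decompose (fun b => maxGenEigenspace f b) x]
    rw [finsum_eq_sum_of_support_subset]
    · rfl
    · intro n hn
      simpa [hP] using hn
  · rw [← mem_maxGenEigenspace]
    exact (DirectSum.decompose (fun b => maxGenEigenspace f b) x n).2

variable {f : Module.End ℂ W} {P : ℂ → Module.End ℂ W}

theorem IsGenProj.mem (h : IsGenProj f P) (n : ℂ) (x : W) : P n x ∈ maxGenEigenspace f n :=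
  (mem_maxGenEigenspace f n _).2 (h.gen n x)

theorem IsGenProj.mem_iSup (h : IsGenProj f P) (x : W) (n : ℂ) :
    x - P n x ∈ ⨆ (m) (_ : m ≠ n), maxGenEigenspace f m := by
  classical
  have hx := h.total x
  rw [finsum_eq_sum_of_support_subset (s := insert n (h.finite x).toFinset)] at hx
  · rw [← Finset.add_sum_erase _ _ (Finset.mem_insert_self n _)] at hx
    rw [← eq_sub_of_add_eq' hx]
    refine Submodule.sum_mem _ fun m hm => ?_
    exact Submodule.mem_iSup_of_mem m
      (Submodule.mem_iSup_of_mem (Finset.ne_of_mem_erase hm) (h.mem m x))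
  · intro m hm
    simp only [Finset.coe_insert, Set.Finite.coe_toFinset]
    exact Or.inr hm

theorem IsGenProj.eq_self (h : IsGenProj f P) {n : ℂ} {x : W} (hx : x ∈ maxGenEigenspace f n) :
    P n x = x := by
  have h1 := h.mem_iSup x n
  have h2 := Submodule.sub_mem _ hx (h.mem n x)
  have := Submodule.disjoint_def.1 (independent_maxGenEigenspace f n) _ h2 h1
  exact (sub_eq_zero.1 this).symm

theorem IsGenProj.locFin (h : IsGenProj f P) {Z : Set ℂ} (hZ : ∀ n, P n ≠ 0 → n ∈ Z) :
    LocFin Z f := by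
  apply locFin_of_iSup
  rw [eq_top_iff]
  rintro x -
  rw [← h.total x]
  refine finsum_induction (· ∈ ⨆ b ∈ Z, maxGenEigenspace f b) (Submodule.zero_mem _)
    (fun _ _ => Submodule.add_mem _) fun n => ?_
  by_cases hn : P n = 0
  · simp [hn]
  · exact Submodule.mem_iSup_of_mem n (Submodule.mem_iSup_of_mem (hZ n hn) (h.mem n x))

theorem IsGenProj.mem_of_ne_zero (h : IsGenProj f P) {Z : Set ℂ} (hf : LocFin Z f) {n : ℂ}
    (hn : P n ≠ 0) : n ∈ Z := by
  obtain ⟨x, hx⟩ := DFunLike.ne_iff.1 hn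
  exact hf.mem_of_maxGen (h.mem n x) hx

end LocallyFinite

/-! ## Countable dimension -/

section Countable

open Polynomial

variable {W : Type*} [AddCommGroup W] [Module ℂ W]

theorem exists_aeval_eq_zero_of_surjective {s : Set W} (hs : s.Countable)
    (hspan : Submodule.span ℂ s = ⊤) (f : Module.End ℂ W) {D : Set ℂ} (hD : ¬ D.Countable)
    (hf : ∀ a ∈ D, ∀ x, ∃ y, f y - a • y = x) (x : W) :
    ∃ p : ℂ[X], p ≠ 0 ∧ aeval f p x = 0 := by
  classical
  choose v hv using fun a : D => hf a a.2 x
  have hdep : ¬ LinearIndependent ℂ v := by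
    intro hli
    apply hD
    have h1 := hli.cardinal_lift_le_rank
    have h2 : Module.rank ℂ W ≤ Cardinal.aleph0 := by
      rw [← rank_top, ← hspan]
      exact (rank_span_le s).trans hs.le_aleph0
    rw [← Set.countable_coe_iff, ← Cardinal.mk_le_aleph0_iff]
    have := h1.trans (Cardinal.lift_le.2 h2)
    simpa using this
  obtain ⟨t, g, hsum, i0, hi0, hg⟩ := not_linearIndependent_iff.1 hdep
  refine ⟨∑ i ∈ t, C (g i) * ∏ j ∈ t.erase i, (X - C (j : ℂ)), fun h0 => ?_, ?_⟩
  · have := congrArg (eval (i0 : ℂ)) h0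
    rw [eval_finsetSum, Finset.sum_eq_single_of_mem i0 hi0] at this
    · simp only [eval_mul, eval_C, eval_zero, mul_eq_zero, hg, false_or, eval_prod,
        Finset.prod_eq_zero_iff] at this
      obtain ⟨j, hj, hj0⟩ := this
      simp only [eval_sub, eval_X, eval_C, sub_eq_zero] at hj0
      exact Finset.ne_of_mem_erase hj (Subtype.ext hj0.symm)
    · intro j hj hne
      simp only [eval_mul, eval_C, eval_prod, mul_eq_zero, Finset.prod_eq_zero_iff]
      exact Or.inr ⟨i0, Finset.mem_erase.2 ⟨hne.symm, hi0⟩, by simp⟩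
  · have key : ∀ i ∈ t, aeval f (∏ j ∈ t.erase i, (X - C (j : ℂ))) x
        = aeval f (∏ j ∈ t, (X - C (j : ℂ))) (v i) := fun i hi => by
      rw [← Finset.prod_erase_mul _ _ hi, map_mul, Module.End.mul_apply, aeval_X_sub_C_apply, hv]
    rw [map_sum, LinearMap.sum_apply]
    calc _ = ∑ i ∈ t, aeval f (∏ j ∈ t, (X - C (j : ℂ))) (g i • v i) := by
          refine Finset.sum_congr rfl fun i hi => ?_
          rw [map_mul, Module.End.mul_apply, key i hi, aeval_C, Module.algebraMap_end_apply,
            map_smul]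
      _ = 0 := by rw [← map_sum, hsum, map_zero]

variable {R : Type*} [Ring R] [Algebra ℂ R] (ρ : R →ₐ[ℂ] Module.End ℂ W)

/-- Schur's lemma in countable dimension, in terms of annihilators of vectors. -/
theorem eq_smul_of_annihilator_le {s : Set W} (hs : s.Countable)
    (hspan : Submodule.span ℂ s = ⊤)
    (hirr : ∀ S : Submodule ℂ W, (∀ a, ∀ x ∈ S, ρ a x ∈ S) → S = ⊥ ∨ S = ⊤)
    {w w' : W} (hw : w ≠ 0) (h : ∀ a, ρ a w = 0 → ρ a w' = 0) : ∃ c : ℂ, w' = c • w := by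
  let g : R →ₗ[ℂ] W := (LinearMap.applyₗ w).comp ρ.toLinearMap
  have hg : ∀ a, g a = ρ a w := fun a => rfl
  have hgs : Function.Surjective g := by
    rw [← LinearMap.range_eq_top]
    refine (hirr (LinearMap.range g) ?_).resolve_left ?_
    · rintro a _ ⟨b, rfl⟩
      exact ⟨a * b, by simp [hg]⟩
    · intro h0
      apply hw
      have : g 1 ∈ LinearMap.range g := ⟨1, rfl⟩
      rw [h0, hg, map_one] at this
      simpa using this
  obtain ⟨sec, hsec⟩ := g.exists_rightInverse_of_surjective (LinearMap.range_eq_top.2 hgs)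
  have hsec' : ∀ x, ρ (sec x) w = x := fun x => LinearMap.congr_fun hsec x
  let f : Module.End ℂ W :=
    { toFun := fun x => ρ (sec x) w'
      map_add' := fun x y => by simp
      map_smul' := fun c x => by simp }
  have hf : ∀ a, f (ρ a w) = ρ a w' := fun a => by
    have := h (sec (ρ a w) - a) (by rw [map_sub, LinearMap.sub_apply, hsec', sub_self])
    rw [map_sub, LinearMap.sub_apply, sub_eq_zero] at this
    exact this
  have hcomm : ∀ a x, f (ρ a x) = ρ a (f x) := fun a x => by
    have e : ρ a (ρ (sec x) w) = ρ (a * sec x) w := by simp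
    rw [hsec'] at e
    rw [e, hf, map_mul]
    rfl
  by_contra hne
  push Not at hne
  have hne' : ∀ c : ℂ, ∃ x, f x - c • x ≠ 0 := fun c => ⟨w, by
    have := hf 1
    simp only [map_one, Module.End.one_apply] at this
    rw [this]; exact sub_ne_zero.2 (hne c)⟩
  have hsur : ∀ c : ℂ, ∀ x, ∃ y, f y - c • y = x := fun c => by
    have : LinearMap.range (f - c • (1 : Module.End ℂ W)) = ⊤ := by
      refine (hirr _ ?_).resolve_left ?_
      · rintro a _ ⟨b, rfl⟩
        exact ⟨ρ a b, by simp [hcomm]⟩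
      · intro h0
        obtain ⟨x, hx⟩ := hne' c
        rw [LinearMap.range_eq_bot] at h0
        exact hx (by simpa using LinearMap.congr_fun h0 x)
    intro x
    obtain ⟨y, hy⟩ := LinearMap.range_eq_top.1 this x
    exact ⟨y, by simpa using hy⟩
  have hinj : ∀ (c : ℂ) x, f x - c • x = 0 → x = 0 := fun c x hx => by
    have : LinearMap.ker (f - c • (1 : Module.End ℂ W)) = ⊥ := by
      refine (hirr _ ?_).resolve_right ?_
      · intro a x hx
        rw [LinearMap.mem_ker] at hx ⊢
        have := congrArg (ρ a) hx
        simpa [hcomm] using this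
      · intro h0
        obtain ⟨x, hx⟩ := hne' c
        apply hx
        have : x ∈ LinearMap.ker (f - c • (1 : Module.End ℂ W)) := h0 ▸ Submodule.mem_top
        simpa using this
    have hx' : x ∈ LinearMap.ker (f - c • (1 : Module.End ℂ W)) := by simpa using hx
    rw [this] at hx'
    simpa using hx'
  have hE : ⨆ b ∈ (Set.univ : Set ℂ), Module.End.maxGenEigenspace f b = ⊥ := by
    simp only [Set.mem_univ, iSup_pos, iSup_eq_bot]
    intro b
    rw [eq_bot_iff]
    intro x hx
    obtain ⟨k, hk⟩ := (mem_maxGen_iff f b x).1 hx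
    induction k generalizing x with
    | zero => simpa using hk
    | succ k ih =>
      rw [pow_succ', map_mul, Module.End.mul_apply, aeval_X_sub_C_apply] at hk
      have h1 := hinj _ _ hk
      exact ih hx h1
  have hloc : LocFin Set.univ f := fun x => by
    obtain ⟨q, hq0, hq⟩ := exists_aeval_eq_zero_of_surjective hs hspan f (D := Set.univ)
      not_countable_complex
      (fun c _ => hsur c) x
    exact ⟨q, hq0, fun _ _ => Set.mem_univ _, hq⟩
  rw [hloc.iSup_eq_top] at hE
  exact hw (by simpa using (hE ▸ Submodule.mem_top : w ∈ (⊥ : Submodule ℂ W)))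

end Countable

/-! ## Weak actions -/

/-- Binomial coefficients with argument `0`. -/
theorem cchoose_zero_left (k : ℕ) : cchoose 0 k = if k = 0 then 1 else 0 := by
  unfold cchoose
  split_ifs with h
  · simp [h]
  · rw [Finset.prod_eq_zero (Finset.mem_range.2 (Nat.pos_of_ne_zero h)) (by simp), zero_div]

theorem cchoose_one_left (k : ℕ) : cchoose 1 k = if k ≤ 1 then 1 else 0 := by
  unfold cchoose
  split_ifs with h
  · interval_cases k <;> simp
  · rw [Finset.prod_eq_zero (i := 1) (Finset.mem_range.2 (by omega)) (by simp), zero_div]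

theorem cchoose_succ (a : ℂ) (k : ℕ) : cchoose a (k + 1) = cchoose a k * (a - k) / (k + 1) := by
  unfold cchoose
  rw [Finset.prod_range_succ, Nat.factorial_succ]
  have : (k.factorial : ℂ) ≠ 0 := by exact_mod_cast k.factorial_ne_zero
  have : (k : ℂ) + 1 ≠ 0 := by exact_mod_cast k.succ_ne_zero
  push_cast
  field_simp

theorem cchoose_neg_one (k : ℕ) : (-1 : ℂ) ^ k * cchoose (-1) k = 1 := by
  induction k with
  | zero => simp [cchoose]
  | succ k ih =>
    have : (k : ℂ) + 1 ≠ 0 := by exact_mod_cast k.succ_ne_zero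
    rw [cchoose_succ]
    calc _ = ((-1 : ℂ) ^ k * cchoose (-1) k) * ((k + 1) / (k + 1)) := by ring
      _ = 1 := by rw [ih, div_self this, one_mul]

theorem cchoose_neg_two (k : ℕ) : (-1 : ℂ) ^ k * cchoose (-2) k = k + 1 := by
  induction k with
  | zero => simp [cchoose]
  | succ k ih =>
    have : (k : ℂ) + 1 ≠ 0 := by exact_mod_cast k.succ_ne_zero
    rw [cchoose_succ]
    calc _ = ((-1 : ℂ) ^ k * cchoose (-2) k) * ((k + 2) / (k + 1)) := by ring
      _ = _ := by rw [ih]; push_cast; field_simp; ring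

/-- The axioms of a weak module, for an unbundled action on a vector space. -/
structure IsWeak (A : VOA) {W : Type*} [AddCommGroup W] [Module ℂ W]
    (act : A.V → ℤ → Module.End ℂ W) : Prop where
  act_add : ∀ u u' n, act (u + u') n = act u n + act u' n
  act_smul : ∀ (c : ℂ) u n, act (c • u) n = c • act u n
  trunc : ∀ u w, ∃ N : ℤ, ∀ n ≥ N, act u n w = 0
  vac_id : ∀ n, act A.one n = if n = -1 then 1 else 0
  borcherds : ∀ (u v : A.V) (w : W) (p q r : ℤ),
    (∑ᶠ i : ℕ, cchoose (p : ℂ) i • act (A.Yop u (r + i) v) (p + q - i) w)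
      = ∑ᶠ i : ℕ, ((-1 : ℂ) ^ i * cchoose (r : ℂ) i) •
          (act u (p + r - i) (act v (q + i) w)
            - (-1 : ℂ) ^ r • act v (q + r - i) (act u (p + i) w))

/-- Subspaces stable under an action. -/
def InvAct {V W : Type*} [AddCommGroup W] [Module ℂ W] (act : V → ℤ → Module.End ℂ W)
    (S : Submodule ℂ W) : Prop := ∀ u n x, x ∈ S → act u n x ∈ S

/-- Irreducibility of an action. -/
def IrrAct {V W : Type*} [AddCommGroup W] [Module ℂ W] (act : V → ℤ → Module.End ℂ W) : Prop :=
  (∃ x : W, x ≠ 0) ∧ ∀ S : Submodule ℂ W, InvAct act S → S = ⊥ ∨ S = ⊤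

/-- Irreducible stable subspaces. -/
def SimpleSub {V W : Type*} [AddCommGroup W] [Module ℂ W] (act : V → ℤ → Module.End ℂ W)
    (S : Submodule ℂ W) : Prop :=
  InvAct act S ∧ S ≠ ⊥ ∧ ∀ T : Submodule ℂ W, InvAct act T → T ≤ S → T = ⊥ ∨ T = S

/-- The action on a stable subspace. -/
def resAct {V W : Type*} [AddCommGroup W] [Module ℂ W] (act : V → ℤ → Module.End ℂ W)
    {S : Submodule ℂ W} (hS : InvAct act S) : V → ℤ → Module.End ℂ S :=
  fun u n => (act u n).restrict (hS u n)

theorem SimpleSub.irr {V W : Type*} [AddCommGroup W] [Module ℂ W]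
    {act : V → ℤ → Module.End ℂ W} {S : Submodule ℂ W} (h : SimpleSub act S) :
    IrrAct (resAct act h.1) := by
  refine ⟨?_, fun T hT => ?_⟩
  · obtain ⟨x, hx, h0⟩ := (Submodule.ne_bot_iff S).1 h.2.1
    exact ⟨⟨x, hx⟩, fun h => h0 (congrArg Subtype.val h)⟩
  · have hT' : InvAct act (T.map S.subtype) := by
      rintro u n _ ⟨x, hx, rfl⟩
      exact ⟨resAct act h.1 u n x, hT u n x hx, rfl⟩
    rcases h.2.2 (T.map S.subtype) hT' (Submodule.map_subtype_le S T) with h | h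
    · left
      exact Submodule.map_injective_of_injective S.injective_subtype (by rw [h, Submodule.map_bot])
    · right
      apply Submodule.map_injective_of_injective S.injective_subtype
      rw [h, Submodule.map_subtype_top]

theorem finite_nat_of_trunc {M : Type*} [Zero M] {F : ℤ → M} (h : ∃ N : ℤ, ∀ n ≥ N, F n = 0)
    (r : ℤ) : {i : ℕ | F (r + i) ≠ 0}.Finite := by
  obtain ⟨N, hN⟩ := h
  refine (Set.finite_le_nat (N - r).toNat).subset fun i hi => ?_
  by_contra hlt
  simp only [Set.mem_ofPred_eq, not_le] at hlt
  exact hi (hN _ (by omega))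

section Weak

variable {A : VOA} {W : Type*} [AddCommGroup W] [Module ℂ W] {act : A.V → ℤ → Module.End ℂ W}

theorem GenModule.isWeak (M : GenModule A) : IsWeak A M.act :=
  ⟨M.act_add, M.act_smul, M.trunc, M.vac_id, M.borcherds⟩

theorem VModule.isWeak (M : VModule A) : IsWeak A M.act :=
  ⟨M.act_add, M.act_smul, M.trunc, M.vac_id, M.borcherds⟩

theorem act_zero_of_add (hadd : ∀ u u' n, act (u + u') n = act u n + act u' n) (n : ℤ) :
    act 0 n = 0 := by
  have := hadd 0 0 n
  rw [add_zero] at this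
  exact left_eq_add.1 this

theorem borcherds_left_finite (hadd : ∀ u u' n, act (u + u') n = act u n + act u' n)
    (u v : A.V) (w : W) (p q r : ℤ) :
    (Function.support fun i : ℕ =>
      cchoose (p : ℂ) i • act (A.Yop u (r + i) v) (p + q - i) w).Finite :=
  (finite_nat_of_trunc (A.trunc u v) r).subset fun i hi h => hi (by
    simp only [h, act_zero_of_add hadd]; simp)

theorem borcherds_right_finite (htr : ∀ u w, ∃ N : ℤ, ∀ n ≥ N, act u n w = 0)
    (u v : A.V) (w : W) (p q r : ℤ) :
    (Function.support fun i : ℕ => ((-1 : ℂ) ^ i * cchoose (r : ℂ) i) •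
          (act u (p + r - i) (act v (q + i) w)
            - (-1 : ℂ) ^ r • act v (q + r - i) (act u (p + i) w))).Finite :=
  ((finite_nat_of_trunc (htr v w) q).union (finite_nat_of_trunc (htr u w) p)).subset
    fun i hi => by
      by_contra h
      simp only [Set.mem_union, Set.mem_ofPred_eq, not_or, not_not] at h
      exact hi (by simp only [h.1, h.2]; simp)

theorem IsWeak.act_zero (h : IsWeak A act) (n : ℤ) : act 0 n = 0 := act_zero_of_add h.act_add n

theorem IsWeak.of_injective {W' : Type*} [AddCommGroup W'] [Module ℂ W']
    {act' : A.V → ℤ → Module.End ℂ W'} (h : IsWeak A act') (e : W →ₗ[ℂ] W')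
    (he : Function.Injective e) (hact : ∀ u n x, e (act u n x) = act' u n (e x)) :
    IsWeak A act where
  act_add u u' n := by ext x; apply he; simp [hact, h.act_add]
  act_smul c u n := by ext x; apply he; simp [hact, h.act_smul]
  trunc u w := by
    obtain ⟨N, hN⟩ := h.trunc u (e w)
    exact ⟨N, fun n hn => he (by rw [hact, hN n hn, map_zero])⟩
  vac_id n := by
    ext x; apply he; rw [hact, h.vac_id]; split_ifs <;> simp
  borcherds u v w p q r := by
    apply he
    have := h.borcherds u v (e w) p q r
    simp only [← hact] at this
    have h1 : ∀ g : ℕ → W, e (∑ᶠ i, g i) = ∑ᶠ i, e (g i) :=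
      fun g => AddMonoidHom.map_finsum_of_injective e.toAddMonoidHom he g
    rw [h1, h1]
    simpa only [map_smul, map_sub] using this

theorem IsWeak.res (h : IsWeak A act) {S : Submodule ℂ W} (hS : InvAct act S) :
    IsWeak A (resAct act hS) :=
  h.of_injective S.subtype S.injective_subtype fun _ _ _ => rfl

theorem IsWeak.of_surjective {W' : Type*} [AddCommGroup W'] [Module ℂ W']
    {act' : A.V → ℤ → Module.End ℂ W'} (h : IsWeak A act) (e : W →ₗ[ℂ] W')
    (he : Function.Surjective e) (hact : ∀ u n x, e (act u n x) = act' u n (e x)) :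
    IsWeak A act' where
  act_add u u' n := by
    ext y; obtain ⟨x, rfl⟩ := he y
    simp [← hact, h.act_add]
  act_smul c u n := by
    ext y; obtain ⟨x, rfl⟩ := he y
    simp [← hact, h.act_smul]
  trunc u y := by
    obtain ⟨x, rfl⟩ := he y
    obtain ⟨N, hN⟩ := h.trunc u x
    exact ⟨N, fun n hn => by rw [← hact, hN n hn, map_zero]⟩
  vac_id n := by
    ext y; obtain ⟨x, rfl⟩ := he y
    rw [← hact, h.vac_id]; split_ifs <;> simp
  borcherds u v y p q r := by
    obtain ⟨w, rfl⟩ := he y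
    have := congrArg e (h.borcherds u v w p q r)
    have h1 : ∀ g : ℕ → W, (Function.support g).Finite → e (∑ᶠ i, g i) = ∑ᶠ i, e (g i) :=
      fun g hg => e.toAddMonoidHom.map_finsum hg
    rw [h1 _ (borcherds_left_finite h.act_add u v w p q r),
      h1 _ (borcherds_right_finite h.trunc u v w p q r)] at this
    simpa only [hact, map_smul, map_sub] using this

theorem IsWeak.comm_formula (h : IsWeak A act) (u v : A.V) (w : W) (p q : ℤ) :
    act u p (act v q w) - act v q (act u p w)
      = ∑ᶠ i : ℕ, cchoose (p : ℂ) i • act (A.Yop u i v) (p + q - i) w := by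
  have := h.borcherds u v w p q 0
  rw [finsum_eq_single (a := 0) (f := fun i : ℕ => ((-1 : ℂ) ^ i * cchoose ((0 : ℤ) : ℂ) i) • _)] at this
  · simp only [zero_add] at this
    rw [this]
    simp [cchoose_zero_left]
  · intro i hi
    simp [cchoose_zero_left, hi]

theorem VOA.Lm1_eq (u : A.V) : A.Yop A.ω 0 u = A.Yop u (-2) A.one := by
  have := LinearMap.congr_fun (A.Lm1_deriv u (-1)) A.one
  rw [A.creation_neg1] at this
  rw [this]; norm_num

theorem IsWeak.deriv (h : IsWeak A act) (u : A.V) (m : ℤ) (w : W) :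
    act (A.Yop A.ω 0 u) m w = (-(m : ℂ)) • act u (m - 1) w := by
  rw [VOA.Lm1_eq]
  have := h.borcherds u A.one w 0 m (-2)
  rw [finsum_eq_single (a := 0)] at this
  · have hl : cchoose ((0 : ℤ) : ℂ) 0 = 1 := by simp [cchoose]
    simp only [hl, one_smul, Nat.cast_zero, add_zero, sub_zero, zero_add] at this
    rw [this]
    have hc : ∀ i : ℕ, (-1 : ℂ) ^ i * cchoose ((-2 : ℤ) : ℂ) i = i + 1 := fun i => by
      push_cast; exact cchoose_neg_two i
    simp only [hc, h.vac_id]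
    rcases lt_trichotomy m 0 with hm | hm | hm
    · rw [finsum_eq_single (a := (-1 - m).toNat)]
      · have h1 : (((-1 - m).toNat : ℕ) : ℤ) = -1 - m := Int.toNat_of_nonneg (by omega)
        have h2 : (((-1 - m).toNat : ℕ) : ℂ) = -1 - m := by exact_mod_cast congrArg (Int.cast (R := ℂ)) h1
        rw [h1, h2, if_pos (by omega), if_neg (by omega)]
        simp only [Module.End.one_apply, LinearMap.zero_apply, smul_zero, sub_zero]
        congr 1
        · ring
        · congr 2; ring
      · intro i hi
        rw [if_neg (by omega), if_neg (by omega)]; simp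
    · subst hm
      rw [finsum_eq_zero_of_forall_eq_zero]
      · simp
      · intro i; rw [if_neg (by omega), if_neg (by omega)]; simp
    · rw [finsum_eq_single (a := (m - 1).toNat)]
      · have h1 : (((m - 1).toNat : ℕ) : ℤ) = m - 1 := Int.toNat_of_nonneg (by omega)
        have h2 : (((m - 1).toNat : ℕ) : ℂ) = m - 1 := by exact_mod_cast congrArg (Int.cast (R := ℂ)) h1
        rw [h1, h2, if_neg (by omega), if_pos (by omega)]
        simp
      · intro i hi
        rw [if_neg (by omega), if_neg (by omega)]; simp
  · intro i hi
    simp [cchoose_zero_left, hi]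

/-- The commutator of `L(0)` with a mode of an `L(0)`-eigenvector. -/
theorem IsWeak.comm_L0 (h : IsWeak A act) {u : A.V} {c : ℂ} (hu : A.Yop A.ω 1 u = c • u) (n : ℤ)
    (w : W) : act A.ω 1 (act u n w) = act u n (act A.ω 1 w) + (c - n - 1) • act u n w := by
  rw [← sub_eq_iff_eq_add', h.comm_formula, finsum_eq_sum_of_support_subset (s := {0, 1})]
  · rw [Finset.sum_pair (by norm_num)]
    have e : ∀ k ≤ 1, cchoose ((1 : ℤ) : ℂ) k = 1 := fun k hk => by
      rw [Int.cast_one, cchoose_one_left, if_pos hk]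
    rw [e 0 (by norm_num), e 1 le_rfl, one_smul, one_smul, Nat.cast_zero, Nat.cast_one, h.deriv,
      hu, h.act_smul, LinearMap.smul_apply]
    have e1 : 1 + n - 0 - 1 = n := by ring
    have e2 : 1 + n - 1 = n := by ring
    rw [e1, e2, ← add_smul]
    congr 1; push_cast; ring
  · intro i hi
    simp only [Function.mem_support] at hi
    by_contra hne
    apply hi
    rw [Int.cast_one, cchoose_one_left, if_neg, zero_smul]
    simp only [Finset.coe_insert, Finset.coe_singleton, Set.mem_insert_iff,
      Set.mem_singleton_iff] at hne
    omega

end Weak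

/-! ## Locally finite weak actions -/

/-- Local finiteness can be checked on a family of stable subspaces which span. -/
theorem LocFin.of_iSup {W : Type*} [AddCommGroup W] [Module ℂ W] {Z : Set ℂ}
    {f : Module.End ℂ W} {ι : Sort*} {S : ι → Submodule ℂ W} (hS : ⨆ i, S i = ⊤)
    (hinv : ∀ i, ∀ x ∈ S i, f x ∈ S i) (h : ∀ i, LocFin Z (f.restrict (hinv i))) :
    LocFin Z f := by
  intro x
  have hx : x ∈ ⨆ i, S i := hS ▸ Submodule.mem_top
  induction hx using Submodule.iSup_induction' with
  | mem i x hx =>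
    obtain ⟨p, h0, hr, hp⟩ := h i ⟨x, hx⟩
    refine ⟨p, h0, hr, ?_⟩
    have := aeval_intertwine (f := f.restrict (hinv i)) (g := f) (S i).subtype (fun _ => rfl) p
      ⟨x, hx⟩
    rw [hp, map_zero] at this
    exact this.symm
  | zero => exact ⟨1, one_ne_zero, by simp [Polynomial.IsRoot], map_zero _⟩
  | add x y _ _ hx hy =>
    obtain ⟨p, h0, hr, hp⟩ := hx
    obtain ⟨q, h0', hr', hq⟩ := hy
    refine ⟨p * q, mul_ne_zero h0 h0', fun a ha => ?_, ?_⟩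
    · rcases (Polynomial.root_mul.1 ha) with h | h
      · exact hr a h
      · exact hr' a h
    · rw [map_add, map_mul, Module.End.mul_apply (Polynomial.aeval f p) _ y, hq, map_zero, add_zero,
        ← map_mul, mul_comm, map_mul, Module.End.mul_apply, hp, map_zero]

section Gen

variable {A : VOA} {W : Type} [AddCommGroup W] [Module ℂ W] {act : A.V → ℤ → Module.End ℂ W}

/-- A weak module on which `L(0)` is locally finite is a generalized module. -/
def mkGen (h : IsWeak A act) {Z : Set ℂ} (hf : LocFin Z (act A.ω 1)) : GenModule A where
  W := W
  P := hf.exists_proj.choose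
  P_orth := hf.exists_proj.choose_spec.orth
  P_finite := hf.exists_proj.choose_spec.finite
  P_total := hf.exists_proj.choose_spec.total
  act := act
  act_add := h.act_add
  act_smul := h.act_smul
  trunc := h.trunc
  vac_id := h.vac_id
  L0_gen := hf.exists_proj.choose_spec.gen
  borcherds := h.borcherds

theorem GenModule.isGenProj (M : GenModule A) : IsGenProj (M.act A.ω 1) M.P :=
  ⟨M.P_orth, M.P_finite, M.P_total, M.L0_gen⟩

theorem IrrAct.exists_iso (hirr : IrrAct act) {k : ℕ} {Ms : Fin k → GenModule A}
    (hM : ∀ M : GenModule A, M.IsIrred → ∃ i, M.Iso (Ms i)) (h : IsWeak A act)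
    (hf : LocFin Set.univ (act A.ω 1)) :
    ∃ (i : Fin k) (e : W ≃ₗ[ℂ] (Ms i).W), ∀ u n x, e (act u n x) = (Ms i).act u n (e x) :=
  hM (mkGen h hf) hirr

theorem IsWeak.real_of_irr (hII : A.CondII) (h : IsWeak A act)
    (hf : LocFin Set.univ (act A.ω 1)) (hirr : IrrAct act) :
    LocFin {z : ℂ | z.im = 0} (act A.ω 1) := by
  obtain ⟨k, Ms, h1, h2⟩ := hII
  obtain ⟨i, e, he⟩ := hirr.exists_iso h2 h hf
  exact ((Ms i).isGenProj.locFin (h1 i).2).of_injective e.toLinearMap (he _ _) e.injective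

theorem IsWeak.iSup_simple (hI : A.CondI) (h : IsWeak A act)
    (hf : LocFin Set.univ (act A.ω 1)) : sSup {S | SimpleSub act S} = ⊤ := by
  obtain ⟨ι, S, h1, h2, -, h3⟩ := hI (mkGen h hf)
  rw [eq_top_iff]
  refine (le_of_eq h3.symm).trans (iSup_le fun i => le_sSup ?_)
  exact ⟨h1 i, (h2 i).1, (h2 i).2⟩

/-- Locally finite weak modules have real weights. -/
theorem IsWeak.real_of_locFin (hI : A.CondI) (hII : A.CondII) (h : IsWeak A act)
    (hf : LocFin Set.univ (act A.ω 1)) : LocFin {z : ℂ | z.im = 0} (act A.ω 1) := by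
  have htop := h.iSup_simple hI hf
  rw [sSup_eq_iSup'] at htop
  refine LocFin.of_iSup htop (fun S x hx => S.2.1 A.ω 1 x hx) fun S => ?_
  exact (h.res S.2.1).real_of_irr hII
    (hf.of_injective S.1.subtype (fun _ => rfl) S.1.injective_subtype) S.2.irr

end Gen

/-! ## Gradings of vertex operator algebras -/

/-- An eigenvector of the grading operator lies in the corresponding graded piece. -/
theorem proj_eq_self {W ι : Type*} [AddCommGroup W] [Module ℂ W] {P : ι → Module.End ℂ W}
    [DecidableEq ι]
    (orth : ∀ m n x, P m (P n x) = if m = n then P n x else 0)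
    (finite : ∀ x : W, {n | P n x ≠ 0}.Finite) (total : ∀ x : W, (∑ᶠ n, P n x) = x)
    {c : ι → ℂ} (hc : Function.Injective c) {f : Module.End ℂ W}
    (hf : ∀ n x, f (P n x) = c n • P n x) {n : ι} {u : W} (hu : f u = c n • u) : P n u = u := by
  have hsum : u = ∑ k ∈ (finite u).toFinset, P k u := by
    conv_lhs => rw [← total u]
    exact finsum_eq_sum_of_support_subset _ (by intro n hn; simpa using hn)
  have hm : ∀ m, P m (f u) = c m • P m u := fun m => by
    conv_lhs => rw [hsum]
    simp only [map_sum, hf, map_smul, orth]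
    rw [Finset.sum_eq_single m]
    · rw [if_pos rfl]
    · intro k _ hk; rw [if_neg hk.symm, smul_zero]
    · intro h
      have : P m u = 0 := by simpa using h
      simp [this]
  conv_rhs => rw [← total u]
  rw [finsum_eq_single _ n]
  intro m hmn
  have h1 := hm m
  rw [hu, map_smul] at h1
  have h2 : (c n - c m) • P m u = 0 := by rw [sub_smul, h1, sub_self]
  exact (smul_eq_zero.1 h2).resolve_left (sub_ne_zero.2 fun h => hmn (hc h).symm)

namespace VOA

variable (A : VOA)

theorem P_idem (n : ℤ) (x : A.V) : A.P n (A.P n x) = A.P n x := by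
  rw [A.P_orth, if_pos rfl]

/-- Induction on homogeneous vectors. -/
theorem homog_induction {p : A.V → Prop} (hadd : ∀ u v, p u → p v → p (u + v))
    (h0 : p 0) (h : ∀ n u, A.P n u = u → p u) (u : A.V) : p u := by
  rw [← A.P_total u, finsum_eq_sum_of_support_subset (s := (A.P_finite u).toFinset)
    _ (by intro n hn; simpa using hn)]
  exact Finset.sum_induction _ p hadd h0 fun n _ => h n _ (A.P_idem n u)

theorem L0_homog {n : ℤ} {u : A.V} (h : A.P n u = u) : A.Yop A.ω 1 u = (n : ℂ) • u := by
  rw [← h]; exact A.L0_grading n u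

theorem P_eq_self {n : ℤ} {u : A.V} (h : A.Yop A.ω 1 u = (n : ℂ) • u) : A.P n u = u :=
  proj_eq_self A.P_orth A.P_finite A.P_total (c := fun n : ℤ => (n : ℂ)) Int.cast_injective
    A.L0_grading h

theorem P_one : A.P 0 A.one = A.one :=
  A.P_eq_self (by rw [A.creation_pos _ _ (by norm_num)]; simp)

theorem P_ω : A.P 2 A.ω = A.ω := by
  apply A.P_eq_self
  have := A.virasoro 0 (-2) A.one
  norm_num at this
  rw [A.creation_neg1, A.creation_pos _ 1 (by norm_num), map_zero, sub_zero] at this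
  rw [this]; norm_num

/-- A countable spanning set of homogeneous vectors. -/
theorem exists_countable_span : ∃ s : Set A.V, s.Countable ∧ Submodule.span ℂ s = ⊤ := by
  have hf : ∀ n, ∃ s : Finset A.V, Submodule.span ℂ (s : Set A.V) = LinearMap.range (A.P n) :=
    fun n => (Module.Finite.iff_fg.1 (A.P_findim n))
  choose s hs using hf
  refine ⟨⋃ n, (s n : Set A.V), Set.countable_iUnion fun n => (s n).countable_toSet, ?_⟩
  rw [eq_top_iff]
  rintro x -
  refine A.homog_induction (p := fun x => x ∈ _) (fun _ _ => Submodule.add_mem _)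
    (Submodule.zero_mem _) (fun n u hu => ?_) x
  refine Submodule.span_mono (Set.subset_iUnion _ n) ?_
  rw [hs]
  exact ⟨u, hu⟩

end VOA
/-! ## Weights of weak modules are real -/

theorem VOA.isWeak (A : VOA) : IsWeak A A.Yop :=
  ⟨A.Y_add, A.Y_smul, A.trunc, A.vac_id, A.borcherds⟩

theorem VOA.Yop_homog (A : VOA) {a b : ℤ} {u v : A.V} (hu : A.P a u = u) (hv : A.P b v = v)
    (n : ℤ) : A.P (a + b - n - 1) (A.Yop u n v) = A.Yop u n v := by
  apply A.P_eq_self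
  rw [A.isWeak.comm_L0 (A.L0_homog hu), A.L0_homog hv, map_smul, ← add_smul]
  congr 1; push_cast; ring

section BorcherdsAdd

variable {A : VOA} {W : Type*} [AddCommGroup W] [Module ℂ W]

/-- The Borcherds identity for a triple of vectors. -/
def Borch (act : A.V → ℤ → Module.End ℂ W) (u v : A.V) (w : W) : Prop :=
  ∀ p q r : ℤ,
    (∑ᶠ i : ℕ, cchoose (p : ℂ) i • act (A.Yop u (r + i) v) (p + q - i) w)
      = ∑ᶠ i : ℕ, ((-1 : ℂ) ^ i * cchoose (r : ℂ) i) •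
          (act u (p + r - i) (act v (q + i) w)
            - (-1 : ℂ) ^ r • act v (q + r - i) (act u (p + i) w))

variable {act : A.V → ℤ → Module.End ℂ W}

theorem Borch.add_left
    (hadd : ∀ u u' n, act (u + u') n = act u n + act u' n)
    (htr : ∀ u w, ∃ N : ℤ, ∀ n ≥ N, act u n w = 0)
    {u u' v : A.V} {w : W} (h : Borch act u v w) (h' : Borch act u' v w) :
    Borch act (u + u') v w := fun p q r => by
  have e := congrArg₂ (· + ·) (h p q r) (h' p q r)
  rw [← finsum_add_distrib (borcherds_left_finite hadd u v w p q r)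
      (borcherds_left_finite hadd u' v w p q r),
    ← finsum_add_distrib (borcherds_right_finite htr u v w p q r)
      (borcherds_right_finite htr u' v w p q r)] at e
  convert e using 3 with i i
  · rw [A.Y_add, LinearMap.add_apply, hadd, LinearMap.add_apply, smul_add]
  · simp only [hadd, LinearMap.add_apply, map_add, smul_add, smul_sub]; abel

theorem Borch.add_mid
    (hadd : ∀ u u' n, act (u + u') n = act u n + act u' n)
    (htr : ∀ u w, ∃ N : ℤ, ∀ n ≥ N, act u n w = 0)
    {u v v' : A.V} {w : W} (h : Borch act u v w) (h' : Borch act u v' w) :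
    Borch act u (v + v') w := fun p q r => by
  have e := congrArg₂ (· + ·) (h p q r) (h' p q r)
  rw [← finsum_add_distrib (borcherds_left_finite hadd u v w p q r)
      (borcherds_left_finite hadd u v' w p q r),
    ← finsum_add_distrib (borcherds_right_finite htr u v w p q r)
      (borcherds_right_finite htr u v' w p q r)] at e
  convert e using 3 with i i
  · rw [map_add, hadd, LinearMap.add_apply, smul_add]
  · simp only [hadd, LinearMap.add_apply, map_add, smul_add, smul_sub]; abel

theorem Borch.add_right
    (hadd : ∀ u u' n, act (u + u') n = act u n + act u' n)
    (htr : ∀ u w, ∃ N : ℤ, ∀ n ≥ N, act u n w = 0)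
    {u v : A.V} {w w' : W} (h : Borch act u v w) (h' : Borch act u v w') :
    Borch act u v (w + w') := fun p q r => by
  have e := congrArg₂ (· + ·) (h p q r) (h' p q r)
  rw [← finsum_add_distrib (borcherds_left_finite hadd u v w p q r)
      (borcherds_left_finite hadd u v w' p q r),
    ← finsum_add_distrib (borcherds_right_finite htr u v w p q r)
      (borcherds_right_finite htr u v w' p q r)] at e
  convert e using 3 with i i
  · rw [map_add, smul_add]
  · simp only [map_add, smul_add, smul_sub]; abel

theorem Borch.zero_left
    (hadd : ∀ u u' n, act (u + u') n = act u n + act u' n)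
    (v : A.V) (w : W) : Borch act 0 v w := fun p q r => by
  have := act_zero_of_add hadd
  have h0 := act_zero_of_add (act := A.Yop) A.Y_add
  simp [this, h0]

theorem Borch.zero_mid
    (hadd : ∀ u u' n, act (u + u') n = act u n + act u' n)
    (u : A.V) (w : W) : Borch act u 0 w := fun p q r => by
  have := act_zero_of_add hadd
  simp [this]

theorem Borch.zero_right (u v : A.V) : Borch act u v 0 := fun p q r => by simp

end BorcherdsAdd

section Loop

variable {A : VOA} {W : Type} [AddCommGroup W] [Module ℂ W] (act : A.V → ℤ → Module.End ℂ W)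

/-- The action on `W ⊗ ℂ[t, t⁻¹]` in which `t` records the degree shift of the modes. -/
def loopAct (u : A.V) (n : ℤ) : Module.End ℂ (ℤ →₀ W) :=
  Finsupp.lsum ℂ fun k => ∑ m ∈ (A.P_finite u).toFinset,
    Finsupp.lsingle (k + m - n - 1) ∘ₗ act (A.P m u) n

variable {act}

theorem loopAct_single (h : IsWeak A act) {u : A.V} {s : Finset ℤ} (hs : {m | A.P m u ≠ 0} ⊆ s)
    (n k : ℤ) (x : W) : loopAct act u n (Finsupp.single k x) =
      ∑ m ∈ s, Finsupp.single (k + m - n - 1) (act (A.P m u) n x) := by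
  rw [loopAct, Finsupp.lsum_single, LinearMap.sum_apply]
  refine Finset.sum_subset (fun m hm => hs (by simpa using hm)) fun m _ hm => ?_
  have : A.P m u = 0 := by simpa using hm
  simp [this, h.act_zero]

theorem loopAct_homog (h : IsWeak A act) {u : A.V} {a : ℤ} (hu : A.P a u = u)
    (n k : ℤ) (x : W) : loopAct act u n (Finsupp.single k x) =
      Finsupp.single (k + a - n - 1) (act u n x) := by
  rw [loopAct_single h (s := {a}), Finset.sum_singleton, hu]
  intro m hm
  by_contra hne
  apply hm
  rw [← hu, A.P_orth, if_neg (by simpa using hne)]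

theorem loopAct_add (h : IsWeak A act) (u u' : A.V) (n : ℤ) :
    loopAct act (u + u') n = loopAct act u n + loopAct act u' n := by
  ext k x : 2
  simp only [LinearMap.comp_apply, Finsupp.lsingle_apply, LinearMap.add_apply]
  set s := (A.P_finite u).toFinset ∪ (A.P_finite u').toFinset
  have h1 : {m | A.P m u ≠ 0} ⊆ s := fun m hm => by
    simp only [s, Finset.coe_union]; left; simpa using hm
  have h2 : {m | A.P m u' ≠ 0} ⊆ s := fun m hm => by
    simp only [s, Finset.coe_union]; right; simpa using hm
  have h3 : {m | A.P m (u + u') ≠ 0} ⊆ s := fun m hm => by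
    by_contra hne
    apply hm
    have e1 : A.P m u = 0 := by by_contra h'; exact hne (h1 h')
    have e2 : A.P m u' = 0 := by by_contra h'; exact hne (h2 h')
    rw [map_add, e1, e2, add_zero]
  rw [loopAct_single h h1, loopAct_single h h2, loopAct_single h h3, ← Finset.sum_add_distrib]
  refine Finset.sum_congr rfl fun m _ => ?_
  rw [map_add, h.act_add, LinearMap.add_apply, Finsupp.single_add]

theorem loopAct_weak (h : IsWeak A act) : IsWeak A (loopAct act) := by
  have hadd := loopAct_add h
  have htr : ∀ u w, ∃ N : ℤ, ∀ n ≥ N, loopAct act u n w = 0 := fun u w => by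
    induction u using A.homog_induction with
    | hadd u v hu hv =>
      obtain ⟨N, hN⟩ := hu
      obtain ⟨N', hN'⟩ := hv
      exact ⟨max N N', fun n hn => by
        rw [hadd, LinearMap.add_apply, hN n (le_trans (le_max_left _ _) hn),
          hN' n (le_trans (le_max_right _ _) hn), add_zero]⟩
    | h0 => exact ⟨0, fun n _ => by rw [act_zero_of_add hadd, LinearMap.zero_apply]⟩
    | h a u hu =>
      induction w using Finsupp.induction_linear with
      | zero => exact ⟨0, fun n _ => map_zero _⟩
      | add w w' hw hw' =>
        obtain ⟨N, hN⟩ := hw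
        obtain ⟨N', hN'⟩ := hw'
        exact ⟨max N N', fun n hn => by
          rw [map_add, hN n (le_trans (le_max_left _ _) hn),
            hN' n (le_trans (le_max_right _ _) hn), add_zero]⟩
      | single k x =>
        obtain ⟨N, hN⟩ := h.trunc u x
        exact ⟨N, fun n hn => by rw [loopAct_homog h hu, hN n hn, Finsupp.single_zero]⟩
  refine ⟨hadd, fun c u n => ?_, htr, fun n => ?_, fun u v w => ?_⟩
  · induction u using A.homog_induction with
    | hadd u v hu hv => rw [smul_add, hadd, hadd, hu, hv, smul_add]
    | h0 => simp [act_zero_of_add hadd]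
    | h a u hu =>
      ext k x : 2
      simp only [LinearMap.comp_apply, Finsupp.lsingle_apply, LinearMap.smul_apply]
      rw [loopAct_homog h hu, loopAct_homog h (a := a) (by rw [map_smul, hu]), h.act_smul,
        LinearMap.smul_apply, Finsupp.smul_single]
  · ext k x : 2
    simp only [LinearMap.comp_apply, Finsupp.lsingle_apply]
    rw [loopAct_homog h A.P_one, h.vac_id]
    split_ifs with hn
    · subst hn; simp
    · simp
  · change Borch (loopAct act) u v w
    induction u using A.homog_induction with
    | hadd u u' hu hu' => exact hu.add_left hadd htr hu'
    | h0 => exact Borch.zero_left hadd _ _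
    | h a u hu =>
    induction v using A.homog_induction with
    | hadd v v' hv hv' => exact hv.add_mid hadd htr hv'
    | h0 => exact Borch.zero_mid hadd _ _
    | h b v hv =>
    induction w using Finsupp.induction_linear with
    | zero => exact Borch.zero_right _ _
    | add w w' hw hw' => exact hw.add_right hadd htr hw'
    | single k x =>
      intro p q r
      have e1 : ∀ g : ℕ → W, Finsupp.single (k + a + b - r - p - q - 2) (∑ᶠ i, g i)
          = ∑ᶠ i, Finsupp.single (k + a + b - r - p - q - 2) (g i) := fun g =>
        AddMonoidHom.map_finsum_of_injective (Finsupp.singleAddHom _)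
          (Finsupp.single_injective _) g
      have e := congrArg (Finsupp.single (k + a + b - r - p - q - 2)) (h.borcherds u v x p q r)
      rw [e1, e1] at e
      refine (finsum_congr fun i => ?_).trans (e.trans (finsum_congr fun i => ?_))
      · rw [loopAct_homog h (A.Yop_homog hu hv _), Finsupp.smul_single]
        congr 1; ring
      · rw [loopAct_homog h hv, loopAct_homog h hu, loopAct_homog h hu, loopAct_homog h hv]
        rw [← Finsupp.smul_single, Finsupp.single_sub, ← Finsupp.smul_single]
        congr 3
        · ring
        · congr 1; ring

/-- The defect of `L(0)` from acting on `W ⊗ t^k` as `k + l`. -/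
def loopDefect (act : A.V → ℤ → Module.End ℂ W) (l : ℂ) : Module.End ℂ (ℤ →₀ W) :=
  Finsupp.lsum ℂ fun k => Finsupp.lsingle k ∘ₗ (act A.ω 1 - ((k : ℂ) + l) • (1 : Module.End ℂ W))

theorem loopDefect_single (l : ℂ) (k : ℤ) (x : W) :
    loopDefect act l (Finsupp.single k x) =
      Finsupp.single k (act A.ω 1 x - ((k : ℂ) + l) • x) := by
  simp [loopDefect]

theorem loopDefect_comm (h : IsWeak A act) (l : ℂ) (u : A.V) (n : ℤ) (x : ℤ →₀ W) :
    loopAct act u n (loopDefect act l x) = loopDefect act l (loopAct act u n x) := by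
  induction u using A.homog_induction with
  | hadd u v hu hv => rw [loopAct_add h, LinearMap.add_apply, LinearMap.add_apply, hu, hv, map_add]
  | h0 => simp [act_zero_of_add (loopAct_add h)]
  | h a u hu =>
  induction x using Finsupp.induction_linear with
  | zero => simp
  | add w w' hw hw' => simp only [map_add, hw, hw']
  | single k x =>
    rw [loopDefect_single, loopAct_homog h hu, loopAct_homog h hu, loopDefect_single]
    congr 1
    rw [h.comm_L0 (A.L0_homog hu), map_sub, map_smul]
    push_cast
    module

theorem loopDefect_apply (l : ℂ) (y : ℤ →₀ W) (k : ℤ) :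
    loopDefect act l y k = act A.ω 1 (y k) - ((k : ℂ) + l) • y k := by
  induction y using Finsupp.induction_linear with
  | zero => simp
  | add w w' hw hw' => simp only [map_add, Finsupp.add_apply, hw, hw', smul_add]; abel
  | single j x =>
    rw [loopDefect_single]
    by_cases hjk : j = k
    · subst hjk; simp
    · simp [Finsupp.single_eq_of_ne' hjk]

theorem IsWeak.surjective_of_not_real (hI : A.CondI) (hII : A.CondII) (h : IsWeak A act)
    {l : ℂ} (hl : l.im ≠ 0) (x : W) : ∃ y, act A.ω 1 y - l • y = x := by
  set N := LinearMap.range (loopDefect act l)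
  have hN : ∀ u n, N ≤ N.comap (loopAct act u n) := by
    rintro u n _ ⟨y, rfl⟩
    exact ⟨loopAct act u n y, (loopDefect_comm h l u n y).symm⟩
  let actQ : A.V → ℤ → Module.End ℂ ((ℤ →₀ W) ⧸ N) := fun u n => N.mapQ N (loopAct act u n) (hN u n)
  have hQ : IsWeak A actQ := (loopAct_weak h).of_surjective N.mkQ N.mkQ_surjective fun _ _ _ => rfl
  have hev : ∀ k x, actQ A.ω 1 (N.mkQ (Finsupp.single k x))
      = ((k : ℂ) + l) • N.mkQ (Finsupp.single k x) := fun k x => by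
    change N.mkQ (loopAct act A.ω 1 (Finsupp.single k x)) = _
    rw [loopAct_homog h A.P_ω, ← map_smul, ← sub_eq_zero, ← map_sub]
    have : Finsupp.single (k + 2 - 1 - 1) (act A.ω 1 x) - ((k : ℂ) + l) • Finsupp.single k x
        = loopDefect act l (Finsupp.single k x) := by
      rw [loopDefect_single, Finsupp.single_sub, Finsupp.smul_single]
      congr 2; ring
    rw [this]
    exact (Submodule.Quotient.mk_eq_zero N).2 ⟨_, rfl⟩
  have hmax : ∀ (k : ℤ) x, N.mkQ (Finsupp.single k x) ∈
      Module.End.maxGenEigenspace (actQ A.ω 1) ((k : ℂ) + l) := fun k x => by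
    rw [Module.End.mem_maxGenEigenspace]
    refine ⟨1, ?_⟩
    rw [pow_one, LinearMap.sub_apply, hev]; simp
  have hloc : LocFin Set.univ (actQ A.ω 1) := by
    apply locFin_of_iSup
    rw [eq_top_iff]
    rintro y -
    obtain ⟨y, rfl⟩ := N.mkQ_surjective y
    induction y using Finsupp.induction_linear with
    | zero => rw [map_zero]; exact Submodule.zero_mem _
    | add w w' hw hw' => rw [map_add]; exact Submodule.add_mem _ hw hw'
    | single k x =>
      exact Submodule.mem_iSup_of_mem _ (Submodule.mem_iSup_of_mem (Set.mem_univ _) (hmax k x))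
  have hreal := hQ.real_of_locFin hI hII hloc
  have h0 : N.mkQ (Finsupp.single 0 x) = 0 := by
    by_contra hne
    have := hreal.mem_of_maxGen (hmax 0 x) hne
    simp at this
    exact hl this
  obtain ⟨y, hy⟩ := (Submodule.Quotient.mk_eq_zero N).1 h0
  refine ⟨y 0, ?_⟩
  have := loopDefect_apply (act := act) l y 0
  rw [hy] at this
  simpa using this.symm

end Loop
/-! ## Complete reducibility of weak modules -/

section Cyclic

variable {A : VOA}

theorem IsWeak.act_mem_of_span {W : Type*} [AddCommGroup W] [Module ℂ W]
    {act : A.V → ℤ → Module.End ℂ W} (h : IsWeak A act) {s : Set A.V}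
    (hs : Submodule.span ℂ s = ⊤) {N : Submodule ℂ W} {n : ℤ} {x : W}
    (hN : ∀ u ∈ s, act u n x ∈ N) (u : A.V) : act u n x ∈ N := by
  have hu : u ∈ Submodule.span ℂ s := hs ▸ Submodule.mem_top
  induction hu using Submodule.span_induction with
  | mem u hu => exact hN u hu
  | zero => rw [h.act_zero]; exact Submodule.zero_mem _
  | add u v _ _ hu hv => rw [h.act_add]; exact Submodule.add_mem _ hu hv
  | smul c u _ hu => rw [h.act_smul]; exact Submodule.smul_mem _ c hu

/-- Every vector of a weak module lies in a stable subspace of countable dimension. -/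
theorem IsWeak.exists_countable_stable {W : Type*} [AddCommGroup W] [Module ℂ W]
    {act : A.V → ℤ → Module.End ℂ W} (h : IsWeak A act) (x : W) :
    ∃ s : Set W, s.Countable ∧ x ∈ Submodule.span ℂ s ∧ InvAct act (Submodule.span ℂ s) := by
  obtain ⟨t, ht, htop⟩ := A.exists_countable_span
  have : Countable t := ht
  let word : List (t × ℤ) → W := fun l => l.foldr (fun a y => act a.1 a.2 y) x
  refine ⟨Set.range word, Set.countable_range _, Submodule.subset_span ⟨[], rfl⟩,
    fun u n y hy => ?_⟩
  induction hy using Submodule.span_induction with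
  | mem y hy =>
    obtain ⟨l, rfl⟩ := hy
    exact h.act_mem_of_span htop
      (fun u hu => Submodule.subset_span
        (Set.mem_range.2 ⟨(((⟨u, hu⟩ : t), n) :: l : List (t × ℤ)), rfl⟩)) u
  | zero => rw [map_zero]; exact Submodule.zero_mem _
  | add y z _ _ hy hz => rw [map_add]; exact Submodule.add_mem _ hy hz
  | smul c y _ hy => rw [map_smul]; exact Submodule.smul_mem _ c hy

theorem IsWeak.exists_countable_span {W : Type*} [AddCommGroup W] [Module ℂ W]
    {act : A.V → ℤ → Module.End ℂ W} (h : IsWeak A act) (hirr : IrrAct act) :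
    ∃ s : Set W, s.Countable ∧ Submodule.span ℂ s = ⊤ := by
  obtain ⟨x, hx⟩ := hirr.1
  obtain ⟨s, hs, hxs, hinv⟩ := h.exists_countable_stable x
  refine ⟨s, hs, (hirr.2 _ hinv).resolve_left fun h0 => hx ?_⟩
  rw [h0] at hxs
  simpa using hxs

theorem not_countable_nonreal : ¬ {z : ℂ | z.im ≠ 0}.Countable := by
  intro h
  have h1 : Function.Injective fun x : ℝ => (x : ℂ) + I := fun x y hxy => by
    simpa using hxy
  have := h.preimage h1
  refine Cardinal.not_countable_real (this.mono fun x _ => ?_)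
  simp

variable {W : Type} [AddCommGroup W] [Module ℂ W] {act : A.V → ℤ → Module.End ℂ W}

/-- `L(0)` is locally finite with real eigenvalues on every weak module. -/
theorem IsWeak.locFin (hA : A.Conds) (h : IsWeak A act) :
    LocFin {z : ℂ | z.im = 0} (act A.ω 1) := by
  refine h.real_of_locFin hA.1 hA.2.1 fun x => ?_
  obtain ⟨s, hs, hxs, hinv⟩ := h.exists_countable_stable x
  have hc : ((↑) ⁻¹' s : Set (Submodule.span ℂ s)).Countable :=
    hs.preimage Subtype.val_injective
  obtain ⟨p, h0, hp⟩ := exists_aeval_eq_zero_of_surjective hc Submodule.span_span_coe_preimage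
    (resAct act hinv A.ω 1) not_countable_nonreal
    (fun a ha y => (h.res hinv).surjective_of_not_real hA.1 hA.2.1 ha y) ⟨x, hxs⟩
  refine ⟨p, h0, fun _ _ => Set.mem_univ _, ?_⟩
  have := aeval_intertwine (f := resAct act hinv A.ω 1) (g := act A.ω 1)
    (Submodule.span ℂ s).subtype (fun _ => rfl) p ⟨x, hxs⟩
  rw [hp, map_zero] at this
  exact this.symm

/-- Every weak module is a sum of irreducible ones. -/
theorem IsWeak.sSup_simple (hA : A.Conds) (h : IsWeak A act) :
    sSup {S | SimpleSub act S} = ⊤ :=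
  h.iSup_simple hA.1 ((h.locFin hA).mono (Set.subset_univ _))

end Cyclic

/-! ## The two commuting actions on a module for the tensor product -/

section Tensor

namespace TensorVOA

variable {A B : VOA} (T : TensorVOA A B)

theorem Y_left (u w : A.V) (n : ℤ) (v : B.V) :
    T.T.Yop (T.ψ (u ⊗ₜ[ℂ] B.one)) n (T.ψ (w ⊗ₜ[ℂ] v)) = T.ψ (A.Yop u n w ⊗ₜ[ℂ] v) := by
  rw [T.ψ_Y, finsum_eq_single _ n]
  · rw [B.vac_id, if_pos (by ring)]; rfl
  · intro i hi
    rw [B.vac_id, if_neg (by omega), LinearMap.zero_apply, TensorProduct.tmul_zero]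

theorem Y_right (w : A.V) (n : ℤ) (u v : B.V) :
    T.T.Yop (T.ψ (A.one ⊗ₜ[ℂ] u)) n (T.ψ (w ⊗ₜ[ℂ] v)) = T.ψ (w ⊗ₜ[ℂ] B.Yop u n v) := by
  rw [T.ψ_Y, finsum_eq_single _ (-1)]
  · rw [A.vac_id, if_pos rfl]; congr 3; congr 1; ring_nf
  · intro i hi
    rw [A.vac_id, if_neg hi, LinearMap.zero_apply, TensorProduct.zero_tmul]

variable {W : Type*} [AddCommGroup W] [Module ℂ W] (act : T.T.V → ℤ → Module.End ℂ W)

/-- The action of the left factor. -/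
def actL (u : A.V) (n : ℤ) : Module.End ℂ W := act (T.ψ (u ⊗ₜ[ℂ] B.one)) n

/-- The action of the right factor. -/
def actR (v : B.V) (n : ℤ) : Module.End ℂ W := act (T.ψ (A.one ⊗ₜ[ℂ] v)) n

variable {act}

theorem actL_weak (h : IsWeak T.T act) : IsWeak A (T.actL act) where
  act_add u u' n := by simp only [actL, TensorProduct.add_tmul, map_add, h.act_add]
  act_smul c u n := by
    simp only [actL, ← TensorProduct.smul_tmul', map_smul, h.act_smul]
  trunc u w := h.trunc _ w
  vac_id n := by simp only [actL, T.ψ_one, h.vac_id]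
  borcherds u v w p q r := by
    have := h.borcherds (T.ψ (u ⊗ₜ[ℂ] B.one)) (T.ψ (v ⊗ₜ[ℂ] B.one)) w p q r
    simp only [Y_left] at this
    exact this

theorem actR_weak (h : IsWeak T.T act) : IsWeak B (T.actR act) where
  act_add u u' n := by simp only [actR, TensorProduct.tmul_add, map_add, h.act_add]
  act_smul c u n := by
    simp only [actR, TensorProduct.tmul_smul, map_smul, h.act_smul]
  trunc u w := h.trunc _ w
  vac_id n := by simp only [actR, T.ψ_one, h.vac_id]
  borcherds u v w p q r := by
    have := h.borcherds (T.ψ (A.one ⊗ₜ[ℂ] u)) (T.ψ (A.one ⊗ₜ[ℂ] v)) w p q r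
    simp only [Y_right] at this
    exact this

theorem act_comm (h : IsWeak T.T act) (u : A.V) (v : B.V) (m n : ℤ) (x : W) :
    T.actL act u m (T.actR act v n x) = T.actR act v n (T.actL act u m x) := by
  rw [← sub_eq_zero]
  simp only [actL, actR]
  rw [h.comm_formula, finsum_eq_zero_of_forall_eq_zero]
  intro i
  rw [Y_left, A.creation_pos _ _ (by positivity), TensorProduct.zero_tmul, map_zero, h.act_zero]
  simp

theorem finite_support_act (h : IsWeak T.T act) (u : A.V) (v : B.V) (n : ℤ) (x : W) :
    (Function.support fun j : ℤ => T.actL act u j (T.actR act v (n - 1 - j) x)).Finite := by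
  obtain ⟨N, hN⟩ := (T.actL_weak h).trunc u x
  obtain ⟨N', hN'⟩ := (T.actR_weak h).trunc v x
  refine (Set.finite_Icc (n - N') N).subset fun j hj => ?_
  by_contra hne
  apply hj
  simp only [Set.mem_Icc, not_and_or, not_le] at hne
  rcases hne with hlt | hlt
  · change T.actL act u j (T.actR act v (n - 1 - j) x) = 0
    rw [hN' _ (by omega), map_zero]
  · change T.actL act u j (T.actR act v (n - 1 - j) x) = 0
    rw [T.act_comm h, hN _ (by omega), map_zero]

/-- The modes of `u ⊗ v` in terms of the actions of the two factors. -/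
theorem act_tmul (h : IsWeak T.T act) (u : A.V) (v : B.V) (n : ℤ) (x : W) :
    act (T.ψ (u ⊗ₜ[ℂ] v)) n x =
      ∑ᶠ j : ℤ, T.actL act u j (T.actR act v (n - 1 - j) x) := by
  have hfin := T.finite_support_act h u v n x
  set F : ℤ → W := fun j => T.actL act u j (T.actR act v (n - 1 - j) x) with hF
  have hb := h.borcherds (T.ψ (u ⊗ₜ[ℂ] B.one)) (T.ψ (A.one ⊗ₜ[ℂ] v)) x 0 n (-1)
  rw [finsum_eq_single _ (0 : ℕ)] at hb
  · have e0 : cchoose ((0 : ℤ) : ℂ) 0 = 1 := by simp [cchoose]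
    simp only [e0, one_smul, Nat.cast_zero, add_zero, sub_zero, zero_add, Y_left,
      A.creation_neg1] at hb
    rw [hb]
    have hc : ∀ i : ℕ, (-1 : ℂ) ^ i * cchoose ((-1 : ℤ) : ℂ) i = 1 := fun i => by
      push_cast; exact cchoose_neg_one i
    have e1 : ∀ i : ℕ, ((-1 : ℂ) ^ i * cchoose ((-1 : ℤ) : ℂ) i) •
          (act (T.ψ (u ⊗ₜ[ℂ] B.one)) (-1 - i) (act (T.ψ (A.one ⊗ₜ[ℂ] v)) (n + i) x)
            - (-1 : ℂ) ^ (-1 : ℤ) • act (T.ψ (A.one ⊗ₜ[ℂ] v)) (n + -1 - i)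
              (act (T.ψ (u ⊗ₜ[ℂ] B.one)) i x)) = F (Int.negSucc i) + F i := fun i => by
      rw [hc, one_smul]
      have e2 : (-1 : ℂ) ^ (-1 : ℤ) = -1 := by norm_num
      rw [e2, neg_smul, one_smul, sub_neg_eq_add, hF]
      congr 1
      · simp only [actL, actR, Int.negSucc_eq]
        congr 2
        · ring
        · congr 1; ring_nf
      · rw [show n + -1 - (i : ℤ) = n - 1 - i by ring]
        exact (T.act_comm h u v i (n - 1 - i) x).symm
    have hneg : Function.Injective Int.negSucc := fun _ _ e => Int.negSucc.inj e
    have hU : Set.range Int.negSucc ∪ Set.range (fun i : ℕ => (i : ℤ)) = Set.univ :=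
      Set.eq_univ_of_forall fun j => by
        cases j with
        | ofNat i => exact Or.inr ⟨i, rfl⟩
        | negSucc i => exact Or.inl ⟨i, rfl⟩
    rw [finsum_congr e1, finsum_add_distrib (hfin.preimage (hneg.injOn))
      (hfin.preimage (Nat.cast_injective.injOn)), ← finsum_mem_range hneg,
      ← finsum_mem_range (f := F) (g := fun i : ℕ => (i : ℤ)) Nat.cast_injective,
      ← finsum_mem_union' _ (hfin.subset Set.inter_subset_right)
        (hfin.subset Set.inter_subset_right), ← finsum_mem_univ F, hU]
    · rw [Set.disjoint_left]
      rintro _ ⟨i, rfl⟩ ⟨j, hj⟩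
      simp at hj
  · intro i hi
    simp [cchoose_zero_left, hi]

theorem inv_iff (h : IsWeak T.T act) (S : Submodule ℂ W) :
    InvAct act S ↔ InvAct (T.actL act) S ∧ InvAct (T.actR act) S := by
  refine ⟨fun hS => ⟨fun _ _ _ hx => hS _ _ _ hx, fun _ _ _ hx => hS _ _ _ hx⟩,
    fun hS u n x hx => ?_⟩
  obtain ⟨t, rfl⟩ := T.ψ.surjective u
  induction t using TensorProduct.induction_on with
  | zero => rw [map_zero, h.act_zero]; exact Submodule.zero_mem _
  | add a b ha hb => rw [map_add, h.act_add]; exact Submodule.add_mem _ ha hb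
  | tmul u v =>
    rw [T.act_tmul h]
    exact finsum_induction (· ∈ S) (Submodule.zero_mem _) (fun _ _ => Submodule.add_mem _)
      fun j => hS.1 _ _ _ (hS.2 _ _ _ hx)

theorem L0_eq (h : IsWeak T.T act) :
    act T.T.ω 1 = T.actL act A.ω 1 + T.actR act B.ω 1 := by
  rw [← T.ψ_ω, map_add, h.act_add]; rfl

end TensorVOA

end Tensor

/-! ## Words in the modes -/

section Words

variable {V W : Type*} [AddCommGroup W] [Module ℂ W] {act : V → ℤ → Module.End ℂ W}

/-- The representation of the free algebra on the modes. -/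
def wordRep (act : V → ℤ → Module.End ℂ W) : FreeAlgebra ℂ (V × ℤ) →ₐ[ℂ] Module.End ℂ W :=
  FreeAlgebra.lift ℂ fun p => act p.1 p.2

theorem wordRep_ι (p : V × ℤ) : wordRep act (FreeAlgebra.ι ℂ p) = act p.1 p.2 :=
  FreeAlgebra.lift_ι_apply _ _

theorem InvAct.wordRep_mem {S : Submodule ℂ W} (hS : InvAct act S) (a : FreeAlgebra ℂ (V × ℤ)) :
    ∀ x ∈ S, wordRep act a x ∈ S := by
  induction a using FreeAlgebra.induction with
  | grade0 r =>
    intro x hx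
    rw [AlgHom.commutes, Module.algebraMap_end_apply]
    exact S.smul_mem r hx
  | grade1 p => intro x hx; rw [wordRep_ι]; exact hS _ _ _ hx
  | mul a b ha hb => intro x hx; rw [map_mul]; exact ha _ (hb _ hx)
  | add a b ha hb => intro x hx; rw [map_add]; exact S.add_mem (ha _ hx) (hb _ hx)

theorem invAct_of_wordRep {S : Submodule ℂ W} (hS : ∀ a, ∀ x ∈ S, wordRep act a x ∈ S) :
    InvAct act S := fun u n x hx => by
  have := hS (FreeAlgebra.ι ℂ (u, n)) x hx
  rwa [wordRep_ι] at this

theorem wordRep_intertwine {W' : Type*} [AddCommGroup W'] [Module ℂ W']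
    {act' : V → ℤ → Module.End ℂ W'} (e : W →ₗ[ℂ] W')
    (he : ∀ u n x, e (act u n x) = act' u n (e x)) (a : FreeAlgebra ℂ (V × ℤ)) :
    ∀ x, e (wordRep act a x) = wordRep act' a (e x) := by
  induction a using FreeAlgebra.induction with
  | grade0 r => intro x; simp [AlgHom.commutes, Module.algebraMap_end_apply]
  | grade1 p => intro x; rw [wordRep_ι, wordRep_ι]; exact he _ _ _
  | mul a b ha hb => intro x; rw [map_mul, map_mul]; exact (ha _).trans (by rw [hb]; rfl)
  | add a b ha hb =>
    intro x
    rw [map_add, map_add, LinearMap.add_apply, LinearMap.add_apply, map_add, ha, hb]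

theorem IrrAct.eq_smul (hirr : IrrAct act) {s : Set W} (hs : s.Countable)
    (hspan : Submodule.span ℂ s = ⊤) {w w' : W} (hw : w ≠ 0)
    (h : ∀ a, wordRep act a w = 0 → wordRep act a w' = 0) : ∃ c : ℂ, w' = c • w :=
  eq_smul_of_annihilator_le (wordRep act) hs hspan
    (fun S hS => hirr.2 S (invAct_of_wordRep hS)) hw h

theorem IrrAct.exists_section (hirr : IrrAct act) {w : W} (hw : w ≠ 0) :
    ∃ σ : W →ₗ[ℂ] FreeAlgebra ℂ (V × ℤ), ∀ x, wordRep act (σ x) w = x := by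
  let g : FreeAlgebra ℂ (V × ℤ) →ₗ[ℂ] W := (LinearMap.applyₗ w).comp (wordRep act).toLinearMap
  have hg : LinearMap.range g = ⊤ := by
    refine (hirr.2 (LinearMap.range g) (invAct_of_wordRep ?_)).resolve_left fun h0 => ?_
    · rintro a _ ⟨b, rfl⟩
      exact ⟨a * b, by simp [g]⟩
    · apply hw
      have : g 1 ∈ LinearMap.range g := ⟨1, rfl⟩
      rw [h0] at this
      simpa [g] using this
  obtain ⟨σ, hσ⟩ := g.exists_rightInverse_of_surjective hg
  exact ⟨σ, fun x => LinearMap.congr_fun hσ x⟩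

end Words

/-! ## Tensor products of irreducible actions -/

section TensorIrr

variable {V V' W Y : Type*} [AddCommGroup W] [Module ℂ W] [AddCommGroup Y] [Module ℂ Y]
  {act : V → ℤ → Module.End ℂ W} {act' : V' → ℤ → Module.End ℂ Y}

theorem rTensor_wordRep_mem {K : Submodule ℂ (W ⊗[ℂ] Y)}
    (hK : ∀ u n, ∀ x ∈ K, (act u n).rTensor Y x ∈ K) (a : FreeAlgebra ℂ (V × ℤ)) :
    ∀ x ∈ K, (wordRep act a).rTensor Y x ∈ K := by
  have e : (wordRep act a).rTensor Y = wordRep (fun u n => (act u n).rTensor Y) a :=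
    TensorProduct.ext' fun w y =>
      wordRep_intertwine ((TensorProduct.mk ℂ W Y).flip y) (fun _ _ _ => rfl) a w
  rw [e]
  exact InvAct.wordRep_mem (act := fun u n => (act u n).rTensor Y) hK a

theorem exists_pure_tensor (hirr : IrrAct act) {s : Set W} (hs : s.Countable)
    (hspan : Submodule.span ℂ s = ⊤) {K : Submodule ℂ (W ⊗[ℂ] Y)} (h0 : K ≠ ⊥)
    (hK : ∀ u n, ∀ x ∈ K, (act u n).rTensor Y x ∈ K) :
    ∃ (w : W) (y : Y), w ≠ 0 ∧ y ≠ 0 ∧ w ⊗ₜ[ℂ] y ∈ K := by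
  classical
  let b := Module.Basis.ofVectorSpace ℂ Y
  let E := TensorProduct.equivFinsuppOfBasisRight (M := W) b
  have hE : ∀ (f : Module.End ℂ W) (x : W ⊗[ℂ] Y) i, E (f.rTensor Y x) i = f (E x i) := by
    intro f x i
    induction x using TensorProduct.induction_on with
    | zero => simp
    | add x y hx hy => simp only [map_add, Finsupp.add_apply, hx, hy]
    | tmul w y => simp [E]
  obtain ⟨x0, hx0, hne⟩ := (Submodule.ne_bot_iff K).1 h0
  have hex : ∃ n, ∃ x ∈ K, x ≠ 0 ∧ (E x).support.card = n := ⟨_, x0, hx0, hne, rfl⟩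
  obtain ⟨x, hx, hxne, hcard⟩ := Nat.find_spec hex
  have hmin : ∀ y ∈ K, (E y).support.card < (E x).support.card → y = 0 := by
    intro y hy hlt
    by_contra hy0
    exact Nat.find_min hex (hcard ▸ hlt) ⟨y, hy, hy0, rfl⟩
  have hEx : E x ≠ 0 := fun h => hxne (E.map_eq_zero_iff.1 h)
  obtain ⟨i0, hi0⟩ := Finsupp.support_nonempty_iff.2 hEx
  have hw : E x i0 ≠ 0 := Finsupp.mem_support_iff.1 hi0
  have hc : ∀ i, ∃ c : ℂ, E x i = c • E x i0 := fun i => by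
    refine hirr.eq_smul hs hspan hw fun a ha => ?_
    have hz : (wordRep act a).rTensor Y x = 0 := by
      refine hmin _ (rTensor_wordRep_mem hK a x hx) (Finset.card_lt_card ?_)
      rw [Finset.ssubset_iff_of_subset]
      · exact ⟨i0, hi0, by rw [Finsupp.notMem_support_iff, hE, ha]⟩
      · intro i hi
        rw [Finsupp.mem_support_iff, hE] at hi
        rw [Finsupp.mem_support_iff]
        intro h; rw [h, map_zero] at hi; exact hi rfl
    rw [← hE, hz, map_zero, Finsupp.zero_apply]
  choose c hc using hc
  have hxe : x = E x i0 ⊗ₜ[ℂ] (∑ i ∈ (E x).support, c i • b i) := by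
    apply E.injective
    ext i
    rw [TensorProduct.tmul_sum, map_sum, Finsupp.finsetSum_apply]
    simp only [E, TensorProduct.equivFinsuppOfBasisRight_apply_tmul_apply, map_smul,
      Module.Basis.repr_self, Finsupp.smul_apply]
    rw [Finset.sum_eq_single i]
    · simpa using hc i
    · intro j _ hj
      rw [Finsupp.single_eq_of_ne hj.symm]
      simp
    · intro hi
      have hci := hc i
      rw [Finsupp.notMem_support_iff.1 hi] at hci
      rw [(smul_eq_zero.1 hci.symm).resolve_right hw, zero_smul, zero_smul]
  refine ⟨E x i0, _, hw, fun hy => hxne ?_, hxe ▸ hx⟩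
  rw [hxe, hy, TensorProduct.tmul_zero]

/-- A nonzero subspace of the tensor product of two irreducible actions which is stable under
both of them is everything. -/
theorem eq_top_of_stable (hirr : IrrAct act) (hirr' : IrrAct act') {s : Set W} (hs : s.Countable)
    (hspan : Submodule.span ℂ s = ⊤) {K : Submodule ℂ (W ⊗[ℂ] Y)} (h0 : K ≠ ⊥)
    (hK : ∀ u n, ∀ x ∈ K, (act u n).rTensor Y x ∈ K)
    (hK' : ∀ v n, ∀ x ∈ K, (act' v n).lTensor W x ∈ K) : K = ⊤ := by
  obtain ⟨w, y, hw, hy, hwy⟩ := exists_pure_tensor hirr hs hspan h0 hK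
  have h1 : K.comap ((TensorProduct.mk ℂ W Y).flip y) = ⊤ :=
    (hirr.2 _ fun u n x hx => hK u n _ hx).resolve_left fun h => hw <| by
      have : w ∈ K.comap ((TensorProduct.mk ℂ W Y).flip y) := hwy
      rw [h] at this
      simpa using this
  have h2 : ∀ w', K.comap (TensorProduct.mk ℂ W Y w') = ⊤ := fun w' =>
    (hirr'.2 _ fun u n x hx => hK' u n _ hx).resolve_left fun h => hy <| by
      have : y ∈ K.comap (TensorProduct.mk ℂ W Y w') := by
        change w' ∈ K.comap ((TensorProduct.mk ℂ W Y).flip y)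
        rw [h1]; trivial
      rw [h] at this
      simpa using this
  rw [eq_top_iff]
  intro x _
  induction x using TensorProduct.induction_on with
  | zero => exact K.zero_mem
  | add x y hx hy => exact K.add_mem (hx trivial) (hy trivial)
  | tmul w' y' =>
    have : y' ∈ K.comap (TensorProduct.mk ℂ W Y w') := by rw [h2]; trivial
    exact this

variable {M : Type*} [AddCommGroup M] [Module ℂ M]
  {aL : V → ℤ → Module.End ℂ M} {aR : V' → ℤ → Module.End ℂ M}

/-- A map from a tensor product which is equivariant in both factors. -/
structure IsTens (act : V → ℤ → Module.End ℂ W) (act' : V' → ℤ → Module.End ℂ Y)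
    (aL : V → ℤ → Module.End ℂ M) (aR : V' → ℤ → Module.End ℂ M)
    (τ : W ⊗[ℂ] Y →ₗ[ℂ] M) : Prop where
  left : ∀ u n w y, τ (act u n w ⊗ₜ[ℂ] y) = aL u n (τ (w ⊗ₜ[ℂ] y))
  right : ∀ v n w y, τ (w ⊗ₜ[ℂ] act' v n y) = aR v n (τ (w ⊗ₜ[ℂ] y))

namespace IsTens

variable {τ : W ⊗[ℂ] Y →ₗ[ℂ] M}

theorem rTensor (h : IsTens act act' aL aR τ) (u : V) (n : ℤ) (x : W ⊗[ℂ] Y) :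
    τ ((act u n).rTensor Y x) = aL u n (τ x) := by
  induction x using TensorProduct.induction_on with
  | zero => simp
  | add x y hx hy => simp only [map_add, hx, hy]
  | tmul w y => exact h.left u n w y

theorem lTensor (h : IsTens act act' aL aR τ) (v : V') (n : ℤ) (x : W ⊗[ℂ] Y) :
    τ ((act' v n).lTensor W x) = aR v n (τ x) := by
  induction x using TensorProduct.induction_on with
  | zero => simp
  | add x y hx hy => simp only [map_add, hx, hy]
  | tmul w y => exact h.right v n w y

theorem comap_eq (h : IsTens act act' aL aR τ) (hirr : IrrAct act) (hirr' : IrrAct act') {s : Set W} (hs : s.Countable)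
    (hspan : Submodule.span ℂ s = ⊤) {S : Submodule ℂ M} (hL : InvAct aL S) (hR : InvAct aR S) :
    S.comap τ = ⊥ ∨ S.comap τ = ⊤ := by
  refine or_iff_not_imp_left.2 fun h0 => eq_top_of_stable hirr hirr' hs hspan h0 ?_ ?_
  · intro u n x hx
    rw [Submodule.mem_comap, h.rTensor]; exact hL _ _ _ hx
  · intro u n x hx
    rw [Submodule.mem_comap, h.lTensor]; exact hR _ _ _ hx

theorem injective (h : IsTens act act' aL aR τ) (hirr : IrrAct act) (hirr' : IrrAct act') {s : Set W} (hs : s.Countable)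
    (hspan : Submodule.span ℂ s = ⊤) (h0 : τ ≠ 0) : Function.Injective τ := by
  rw [← LinearMap.ker_eq_bot, ← Submodule.comap_bot]
  refine (h.comap_eq hirr hirr' hs hspan (S := ⊥) ?_ ?_).resolve_right fun ht => h0 ?_
  · intro u n x hx; simp_all
  · intro u n x hx; simp_all
  · rwa [Submodule.comap_bot, LinearMap.ker_eq_top] at ht

end IsTens

/-- The multiplicity space of a cyclic vector of an irreducible action. -/
def multSpace (act : V → ℤ → Module.End ℂ W) (aL : V → ℤ → Module.End ℂ M) (w : W) :
    Submodule ℂ M where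
  carrier := {m | ∀ a, wordRep act a w = 0 → wordRep aL a m = 0}
  zero_mem' a _ := map_zero _
  add_mem' hx hy a ha := by rw [map_add, hx a ha, hy a ha, add_zero]
  smul_mem' c x hx a ha := by rw [map_smul, hx a ha, smul_zero]

theorem wordRep_comm (hcomm : ∀ u n v m x, aL u n (aR v m x) = aR v m (aL u n x))
    (a : FreeAlgebra ℂ (V × ℤ)) (v : V') (m : ℤ) (x : M) :
    wordRep aL a (aR v m x) = aR v m (wordRep aL a x) :=
  (wordRep_intertwine (aR v m) (fun u n x => (hcomm u n v m x).symm) a x).symm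

theorem multSpace_inv (hcomm : ∀ u n v m x, aL u n (aR v m x) = aR v m (aL u n x)) (w : W) :
    InvAct aR (multSpace act aL w) := fun v m x hx a ha => by
  rw [wordRep_comm hcomm, hx a ha, map_zero]

/-- Evaluation of the multiplicity space. -/
theorem exists_isTens (hcomm : ∀ u n v m x, aL u n (aR v m x) = aR v m (aL u n x))
    (hirr : IrrAct act) {w : W} (hw : w ≠ 0) (e : Y →ₗ[ℂ] M)
    (he : ∀ v n y, e (act' v n y) = aR v n (e y)) (hmem : ∀ y, e y ∈ multSpace act aL w) :
    ∃ τ : W ⊗[ℂ] Y →ₗ[ℂ] M, IsTens act act' aL aR τ ∧ ∀ y, τ (w ⊗ₜ[ℂ] y) = e y := by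
  obtain ⟨σ, hσ⟩ := hirr.exists_section hw
  have hdep : ∀ a b y, wordRep act a w = wordRep act b w →
      wordRep aL a (e y) = wordRep aL b (e y) := fun a b y hab => by
    have := hmem y (a - b) (by rw [map_sub, LinearMap.sub_apply, hab, sub_self])
    rwa [map_sub, LinearMap.sub_apply, sub_eq_zero] at this
  let F : W →ₗ[ℂ] Y →ₗ[ℂ] M := (LinearMap.lcomp ℂ M e) ∘ₗ (wordRep aL).toLinearMap ∘ₗ σ
  have hF : ∀ x y, F x y = wordRep aL (σ x) (e y) := fun _ _ => rfl
  refine ⟨TensorProduct.lift F, ⟨fun u n x y => ?_, fun v n x y => ?_⟩, fun y => ?_⟩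
  · rw [TensorProduct.lift.tmul, TensorProduct.lift.tmul, hF, hF,
      hdep _ (FreeAlgebra.ι ℂ (u, n) * σ x) y, map_mul, wordRep_ι]
    · rfl
    · rw [hσ, map_mul, wordRep_ι, Module.End.mul_apply, hσ]
  · rw [TensorProduct.lift.tmul, TensorProduct.lift.tmul, hF, hF, he, wordRep_comm hcomm]
  · rw [TensorProduct.lift.tmul, hF, hdep _ 1 y (by rw [hσ, map_one]; rfl), map_one]; rfl

end TensorIrr

/-! ## Sums of commuting locally finite operators -/

section LocFinAdd

open Polynomial Module.End

variable {W : Type*} [AddCommGroup W] [Module ℂ W] {f g : Module.End ℂ W}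

theorem maxGen_inf_le_add (h : Commute f g) (a b : ℂ) :
    maxGenEigenspace f a ⊓ maxGenEigenspace g b ≤ maxGenEigenspace (f + g) (a + b) := by
  simpa [maxGenEigenspace] using genEigenspace_inf_le_add f g a b ⊤ ⊤ h

theorem LocFin.add_real (hf : LocFin {z | z.im = 0} f) (hg : LocFin {z | z.im = 0} g)
    (h : Commute f g) : LocFin {z | z.im = 0} (f + g) := by
  have htop := hf.iSup_eq_top
  rw [iSup_subtype'] at htop
  have hinvf : ∀ a, ∀ x ∈ maxGenEigenspace f a, f x ∈ maxGenEigenspace f a := fun a x hx =>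
    mapsTo_maxGenEigenspace_of_comm (Commute.refl f) a hx
  have hinvg : ∀ a, ∀ x ∈ maxGenEigenspace f a, g x ∈ maxGenEigenspace f a := fun a x hx =>
    mapsTo_maxGenEigenspace_of_comm h a hx
  refine LocFin.of_iSup htop (fun a x hx => Submodule.add_mem _ (hinvf a x hx) (hinvg a x hx))
    fun a => ?_
  set S := maxGenEigenspace f a
  have hgS : LocFin {z | z.im = 0} (g.restrict (hinvg a)) :=
    hg.of_injective S.subtype (fun _ => rfl) S.injective_subtype
  have hfS : maxGenEigenspace (f.restrict (hinvf a)) (a : ℂ) = ⊤ := by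
    rw [eq_top_iff]
    intro x _
    obtain ⟨k, hk⟩ := (mem_maxGen_iff f a x).1 x.2
    rw [mem_maxGen_iff]
    refine ⟨k, S.injective_subtype ?_⟩
    rw [aeval_intertwine S.subtype (g := f) (fun _ => rfl), map_zero]
    exact hk
  apply locFin_of_iSup
  rw [eq_top_iff, ← hgS.iSup_eq_top]
  refine iSup₂_le fun b hb => ?_
  have hc : Commute (f.restrict (hinvf a)) (g.restrict (hinvg a)) := by
    ext x
    exact LinearMap.congr_fun h.eq x
  have hab : ((a : ℂ) + b) ∈ {z : ℂ | z.im = 0} := by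
    have h1 : (a : ℂ).im = 0 := a.2
    have h2 : b.im = 0 := hb
    change ((a : ℂ) + b).im = 0
    rw [Complex.add_im, h1, h2, add_zero]
  calc maxGenEigenspace (g.restrict (hinvg a)) b
      = maxGenEigenspace (f.restrict (hinvf a)) a ⊓ maxGenEigenspace (g.restrict (hinvg a)) b := by
        rw [hfS, top_inf_eq]
    _ ≤ _ := maxGen_inf_le_add hc _ _
    _ ≤ _ := le_biSup (f := fun c => maxGenEigenspace
        (f.restrict (hinvf a) + g.restrict (hinvg a)) c) hab

end LocFinAdd

/-! ## Independent families of irreducible subspaces -/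

section Independent

variable {V W : Type*} [AddCommGroup W] [Module ℂ W] {act : V → ℤ → Module.End ℂ W}

theorem InvAct.sSup_mem {s : Set (Submodule ℂ W)} (hs : ∀ S ∈ s, InvAct act S) :
    InvAct act (sSup s) := fun u n x hx => by
  have : sSup s ≤ (sSup s).comap (act u n) :=
    sSup_le fun S hS x hx => (le_sSup hS : S ≤ _) (hs S hS u n x hx)
  exact this hx

theorem exists_independent {𝒮 : Set (Submodule ℂ W)} (hS : ∀ S ∈ 𝒮, SimpleSub act S)
    (htop : sSup 𝒮 = ⊤) : ∃ s ⊆ 𝒮, sSupIndep s ∧ sSup s = ⊤ := by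
  obtain ⟨s, hs⟩ := zorn_subset {s : Set (Submodule ℂ W) | sSupIndep s ∧ s ⊆ 𝒮}
    fun c hc1 hc2 => ⟨⋃₀ c, ⟨iSupIndep_sUnion_of_directed hc2.directedOn fun s hs => (hc1 hs).1,
      Set.sUnion_subset fun s hs => (hc1 hs).2⟩, fun _ => Set.subset_sUnion_of_mem⟩
  obtain ⟨hind, hsub⟩ := hs.prop
  refine ⟨s, hsub, hind, ?_⟩
  rw [eq_top_iff, ← htop]
  refine sSup_le fun a ha => ?_
  rw [← inf_eq_left]
  refine ((hS a ha).2.2 _ ?_ inf_le_left).resolve_left fun con => (hS a ha).2.1 ?_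
  · intro u n x hx
    exact ⟨(hS a ha).1 u n x hx.1, InvAct.sSup_mem (fun S h => (hS S (hsub h)).1) u n x hx.2⟩
  rw [← disjoint_iff] at con
  suffices h : a ∈ s from disjoint_self.1 (con.mono_right (le_sSup h))
  refine hs.le_of_ge (y := insert a s) ⟨fun x hx => ?_, Set.insert_subset ha hsub⟩
    (Set.subset_insert a s) (Set.mem_insert a s)
  obtain rfl | xa := eq_or_ne x a
  · exact con.mono_right (sSup_le_sSup (by simp))
  · have hxs := (Set.mem_insert_iff.1 hx).resolve_left xa
    rw [Set.insert_sdiff_of_notMem _ (by simpa using xa.symm), sSup_insert, sup_comm]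
    apply (hind hxs).disjoint_sup_right_of_disjoint_sup_left
    refine (con.mono_right ?_).symm
    rw [← sSup_insert, Set.insert_sdiff_singleton, Set.insert_eq_of_mem hxs]

end Independent

/-! ## Modules for the tensor product -/

section TensorModules

/-- A finite list of all irreducible modules. -/
def IrrList (A : VOA) {k : ℕ} (Ms : Fin k → GenModule A) : Prop :=
  (∀ i, (Ms i).IsIrred ∧ (Ms i).RealGraded) ∧ ∀ M : GenModule A, M.IsIrred → ∃ i, M.Iso (Ms i)

theorem GenModule.exists_countable_span {A : VOA} {M : GenModule A} (h : M.IsIrred) :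
    ∃ s : Set M.W, s.Countable ∧ Submodule.span ℂ s = ⊤ :=
  M.isWeak.exists_countable_span h

namespace TensorVOA

variable {A B : VOA} (T : TensorVOA A B) {W : Type} [AddCommGroup W] [Module ℂ W]
  {act : T.T.V → ℤ → Module.End ℂ W}

theorem equivariant {W' : Type*} [AddCommGroup W'] [Module ℂ W']
    {act' : T.T.V → ℤ → Module.End ℂ W'} (h : IsWeak T.T act) (h' : IsWeak T.T act')
    (e : W →ₗ[ℂ] W') (hL : ∀ u n x, e (T.actL act u n x) = T.actL act' u n (e x))
    (hR : ∀ u n x, e (T.actR act u n x) = T.actR act' u n (e x)) (u : T.T.V) (n : ℤ) (x : W) :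
    e (act u n x) = act' u n (e x) := by
  obtain ⟨t, rfl⟩ := T.ψ.surjective u
  induction t using TensorProduct.induction_on with
  | zero => rw [map_zero, h.act_zero, h'.act_zero]; simp
  | add a b ha hb =>
    rw [map_add, h.act_add, h'.act_add, LinearMap.add_apply, map_add, ha, hb]; rfl
  | tmul u v =>
    rw [T.act_tmul h, T.act_tmul h', map_finsum e (T.finite_support_act h u v n x)]
    exact finsum_congr fun j => by rw [hL, hR]

theorem locFin (hA : A.Conds) (hB : B.Conds) (h : IsWeak T.T act) :
    LocFin {z | z.im = 0} (act T.T.ω 1) := by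
  rw [T.L0_eq h]
  refine ((T.actL_weak h).locFin hA).add_real ((T.actR_weak h).locFin hB) ?_
  ext x
  exact T.act_comm h _ _ _ _ x

theorem simpleSub_range (h : IsWeak T.T act) {MA : GenModule A} {MB : GenModule B}
    (hMA : MA.IsIrred) (hMB : MB.IsIrred) {τ : MA.W ⊗[ℂ] MB.W →ₗ[ℂ] W}
    (hτ : IsTens MA.act MB.act (T.actL act) (T.actR act) τ) (h0 : τ ≠ 0) :
    SimpleSub act (LinearMap.range τ) := by
  obtain ⟨s, hs, hspan⟩ := GenModule.exists_countable_span hMA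
  refine ⟨(T.inv_iff h _).2 ⟨?_, ?_⟩, by rwa [Ne, LinearMap.range_eq_bot], fun S hS hle => ?_⟩
  · rintro u n _ ⟨x, rfl⟩
    exact ⟨_, hτ.rTensor u n x⟩
  · rintro u n _ ⟨x, rfl⟩
    exact ⟨_, hτ.lTensor u n x⟩
  · obtain ⟨h1, h2⟩ := (T.inv_iff h S).1 hS
    have hS' : (S.comap τ).map τ = S := by rw [Submodule.map_comap_eq, inf_eq_right.2 hle]
    rcases hτ.comap_eq hMA hMB hs hspan h1 h2 with h3 | h3
    · left; rw [← hS', h3, Submodule.map_bot]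
    · right; rw [← hS', h3, Submodule.map_top]

/-- Every weak module for the tensor product is a sum of images of tensor products of irreducible
modules for the factors. -/
theorem sSup_range (hA : A.Conds) (hB : B.Conds) {k l : ℕ} {MA : Fin k → GenModule A}
    {MB : Fin l → GenModule B} (hMA : IrrList A MA) (hMB : IrrList B MB) (h : IsWeak T.T act) :
    sSup {S : Submodule ℂ W | ∃ i j, ∃ τ : (MA i).W ⊗[ℂ] (MB j).W →ₗ[ℂ] W,
      IsTens (MA i).act (MB j).act (T.actL act) (T.actR act) τ ∧ τ ≠ 0 ∧
        LinearMap.range τ = S} = ⊤ := by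
  have hL := T.actL_weak h
  have hR := T.actR_weak h
  have hmem : ∀ i j, ∀ τ : (MA i).W ⊗[ℂ] (MB j).W →ₗ[ℂ] W,
      IsTens (MA i).act (MB j).act (T.actL act) (T.actR act) τ → τ ≠ 0 →
        LinearMap.range τ ≤ sSup {S : Submodule ℂ W | ∃ i j,
          ∃ τ : (MA i).W ⊗[ℂ] (MB j).W →ₗ[ℂ] W,
            IsTens (MA i).act (MB j).act (T.actL act) (T.actR act) τ ∧ τ ≠ 0 ∧
              LinearMap.range τ = S} :=
    fun i j τ h1 h2 => le_sSup ⟨i, j, τ, h1, h2, rfl⟩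
  generalize sSup {S : Submodule ℂ W | ∃ i j, ∃ τ : (MA i).W ⊗[ℂ] (MB j).W →ₗ[ℂ] W,
      IsTens (MA i).act (MB j).act (T.actL act) (T.actR act) τ ∧ τ ≠ 0 ∧
        LinearMap.range τ = S} = Q at hmem ⊢
  rw [eq_top_iff, ← hL.sSup_simple hA]
  refine sSup_le fun S hS x hx => ?_
  obtain rfl | hx0 := eq_or_ne x 0
  · exact Submodule.zero_mem _
  obtain ⟨i, e, he⟩ := hS.irr.exists_iso hMA.2 (hL.res hS.1)
    (((hL.res hS.1).locFin hA).mono (Set.subset_univ _))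
  have hw : e ⟨x, hx⟩ ≠ 0 := fun h0 => hx0 (congrArg Subtype.val (e.map_eq_zero_iff.1 h0))
  set H := multSpace (MA i).act (T.actL act) (e ⟨x, hx⟩) with hH
  have hxH : x ∈ H := fun a ha => by
    have h1 : wordRep (resAct (T.actL act) hS.1) a ⟨x, hx⟩ = 0 :=
      e.map_eq_zero_iff.1 ((wordRep_intertwine e.toLinearMap he a _).trans ha)
    have h2 := wordRep_intertwine (act := resAct (T.actL act) hS.1) (act' := T.actL act) S.subtype
      (fun _ _ _ => rfl) a ⟨x, hx⟩
    rw [h1, map_zero] at h2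
    exact h2.symm
  have hHinv : InvAct (T.actR act) H :=
    multSpace_inv (fun u n v m x => T.act_comm h u v n m x) _
  have hHR := hR.res hHinv
  suffices hle : H ≤ Q from hle hxH
  have htop := hHR.sSup_simple hB
  rw [← Submodule.map_subtype_top H, ← htop, Submodule.map_le_iff_le_comap]
  refine sSup_le fun Y hY y hy => ?_
  obtain ⟨j, e', he'⟩ := hY.irr.exists_iso hMB.2 (hHR.res hY.1)
    (((hHR.res hY.1).locFin hB).mono (Set.subset_univ _))
  obtain ⟨τ, hτ, hτ'⟩ := exists_isTens (act' := (MB j).act) (aR := T.actR act)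
    (fun u n v m x => T.act_comm h u v n m x) (hMA.1 i).1 hw
    (H.subtype ∘ₗ Y.subtype ∘ₗ e'.symm.toLinearMap) (fun v n z => by
      have := he' v n (e'.symm z)
      rw [e'.apply_symm_apply, ← e'.eq_symm_apply] at this
      change ((e'.symm ((MB j).act v n z) : Y) : W) = _
      rw [← this]; rfl) (fun z => (e'.symm z).1.2)
  have hyτ : τ (e ⟨x, hx⟩ ⊗ₜ[ℂ] e' ⟨y, hy⟩) = y := by
    rw [hτ']; simp
  obtain ⟨y1, hy1⟩ := hY.irr.1
  refine hmem i j τ hτ (fun h0 => hy1 ?_) ⟨_, hyτ⟩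
  have := hτ' (e' y1)
  rw [h0] at this
  simpa using this.symm

end TensorVOA

end TensorModules

/-! ## The three conditions for the tensor product -/

section TensorConds

namespace TensorVOA

variable {A B : VOA} (T : TensorVOA A B)

theorem exists_equiv_of_irr (hA : A.Conds) (hB : B.Conds) {k l : ℕ} {MA : Fin k → GenModule A}
    {MB : Fin l → GenModule B} (hMA : IrrList A MA) (hMB : IrrList B MB)
    {W : Type} [AddCommGroup W] [Module ℂ W] {act : T.T.V → ℤ → Module.End ℂ W}
    (h : IsWeak T.T act) (hirr : IrrAct act) :
    ∃ i j, ∃ e : (MA i).W ⊗[ℂ] (MB j).W ≃ₗ[ℂ] W,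
      IsTens (MA i).act (MB j).act (T.actL act) (T.actR act) e.toLinearMap := by
  have htop := T.sSup_range hA hB hMA hMB h
  obtain ⟨S, i, j, τ, hτ, h0, -⟩ : {S : Submodule ℂ W | ∃ i j,
      ∃ τ : (MA i).W ⊗[ℂ] (MB j).W →ₗ[ℂ] W,
        IsTens (MA i).act (MB j).act (T.actL act) (T.actR act) τ ∧ τ ≠ 0 ∧
          LinearMap.range τ = S}.Nonempty := by
    rw [Set.nonempty_iff_ne_empty]
    intro he
    rw [he, sSup_empty] at htop
    obtain ⟨x, hx⟩ := hirr.1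
    have : x ∈ (⊥ : Submodule ℂ W) := htop ▸ Submodule.mem_top
    exact hx (by simpa using this)
  have hS := T.simpleSub_range h (hMA.1 i).1 (hMB.1 j).1 hτ h0
  obtain ⟨s, hs, hspan⟩ := GenModule.exists_countable_span (hMA.1 i).1
  refine ⟨i, j, LinearEquiv.ofBijective τ ⟨hτ.injective (hMA.1 i).1 (hMB.1 j).1 hs hspan h0,
    LinearMap.range_eq_top.1 ((hirr.2 _ hS.1).resolve_left hS.2.1)⟩, ?_⟩
  exact hτ

theorem condI (hA : A.Conds) (hB : B.Conds) : T.T.CondI := by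
  obtain ⟨k, MA, hMA⟩ := hA.2.1
  obtain ⟨l, MB, hMB⟩ := hB.2.1
  intro M
  obtain ⟨s, hs, hind, htop⟩ := exists_independent (act := M.act)
    (fun S hS => by
      obtain ⟨i, j, τ, hτ, h0, rfl⟩ := hS
      exact T.simpleSub_range M.isWeak (hMA.1 i).1 (hMB.1 j).1 hτ h0)
    (T.sSup_range hA hB hMA hMB M.isWeak)
  have hsimple : ∀ S ∈ s, SimpleSub M.act S := fun S hS => by
    obtain ⟨i, j, τ, hτ, h0, rfl⟩ := hs hS
    exact T.simpleSub_range M.isWeak (hMA.1 i).1 (hMB.1 j).1 hτ h0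
  refine ⟨s, Subtype.val, fun S => (hsimple S S.2).1, fun S => (hsimple S S.2).2, ?_, ?_⟩
  · exact sSupIndep_iff s |>.1 hind
  · rwa [← sSup_eq_iSup']

theorem condII (hA : A.Conds) (hB : B.Conds) : T.T.CondII := by
  classical
  obtain ⟨k, MA, hMA⟩ := hA.2.1
  obtain ⟨l, MB, hMB⟩ := hB.2.1
  let Q : Fin k × Fin l → GenModule T.T → Prop := fun p N => N.IsIrred ∧
    ∃ e : (MA p.1).W ⊗[ℂ] (MB p.2).W ≃ₗ[ℂ] N.W,
      IsTens (MA p.1).act (MB p.2).act (T.actL N.act) (T.actR N.act) e.toLinearMap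
  let R := {p // ∃ N, Q p N}
  choose N hN using fun p : R => p.2
  let f := Fintype.equivFin R
  refine ⟨Fintype.card R, fun i => N (f.symm i), fun i => ⟨(hN _).1, fun n hn => ?_⟩,
    fun M hM => ?_⟩
  · exact (N (f.symm i)).isGenProj.mem_of_ne_zero (T.locFin hA hB (N (f.symm i)).isWeak) hn
  · obtain ⟨i, j, e, he⟩ := T.exists_equiv_of_irr hA hB hMA hMB M.isWeak hM
    let p : R := ⟨(i, j), M, hM, e, he⟩
    obtain ⟨-, e', he'⟩ := hN p
    refine ⟨f p, ?_⟩
    change M.Iso (N (f.symm (f p)))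
    rw [f.symm_apply_apply]
    refine ⟨e.symm.trans e', T.equivariant M.isWeak (N p).isWeak
      (e.symm.trans e').toLinearMap (fun u n x => ?_) fun u n x => ?_⟩
    · obtain ⟨y, rfl⟩ := e.surjective x
      have := he.rTensor u n y
      simp only [LinearEquiv.coe_coe] at this
      have h' := he'.rTensor u n y
      simp only [LinearEquiv.coe_coe] at h'
      simp only [LinearEquiv.coe_coe, LinearEquiv.trans_apply]
      rw [← this, e.symm_apply_apply, e.symm_apply_apply, h']
    · obtain ⟨y, rfl⟩ := e.surjective x
      have := he.lTensor u n y
      simp only [LinearEquiv.coe_coe] at this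
      have h' := he'.lTensor u n y
      simp only [LinearEquiv.coe_coe] at h'
      simp only [LinearEquiv.coe_coe, LinearEquiv.trans_apply]
      rw [← this, e.symm_apply_apply, e.symm_apply_apply, h']

theorem P_left {n : ℤ} {u : A.V} (hu : A.P n u = u) :
    T.T.P n (T.ψ (u ⊗ₜ[ℂ] B.one)) = T.ψ (u ⊗ₜ[ℂ] B.one) := by
  have := T.ψ_P n 0 u B.one n
  rwa [hu, B.P_one, if_pos (by ring)] at this

theorem P_right {n : ℤ} {v : B.V} (hv : B.P n v = v) :
    T.T.P n (T.ψ (A.one ⊗ₜ[ℂ] v)) = T.ψ (A.one ⊗ₜ[ℂ] v) := by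
  have := T.ψ_P 0 n A.one v n
  rwa [hv, A.P_one, if_pos (by ring)] at this

theorem exists_finite_sup {W : Type*} [AddCommGroup W] [Module ℂ W] {C : Submodule ℂ W}
    (h : Module.Finite ℂ (W ⧸ C)) : ∃ F : Submodule ℂ W, Module.Finite ℂ F ∧ C ⊔ F = ⊤ := by
  obtain ⟨F, hF⟩ := C.exists_isCompl
  exact ⟨F, Module.Finite.equiv (Submodule.quotientEquivOfIsCompl C F hF), hF.sup_eq_top⟩

theorem condIII (hA : A.Conds) (hB : B.Conds) : T.T.CondIII := by
  intro M hM _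
  obtain ⟨k, MA, hMA⟩ := hA.2.1
  obtain ⟨l, MB, hMB⟩ := hB.2.1
  obtain ⟨i, j, e, he⟩ := T.exists_equiv_of_irr hA hB hMA hMB M.isWeak hM
  obtain ⟨F, hF, hFtop⟩ := exists_finite_sup (hA.2.2 _ (hMA.1 i).1 (hMA.1 i).2)
  obtain ⟨G, hG, hGtop⟩ := exists_finite_sup (hB.2.2 _ (hMB.1 j).1 (hMB.1 j).2)
  have hl : ∀ w ∈ (MA i).C1, ∀ y, e (w ⊗ₜ y) ∈ M.C1 := fun w hw y => by
    have hle : (MA i).C1 ≤ M.C1.comap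
        (e.toLinearMap ∘ₗ (TensorProduct.mk ℂ (MA i).W (MB j).W).flip y) := by
      refine Submodule.span_le.2 ?_
      rintro _ ⟨u, x, ⟨n, hn, hu⟩, rfl⟩
      exact Submodule.subset_span ⟨_, e (x ⊗ₜ y), ⟨n, hn, T.P_left hu⟩, he.left u (-1) x y⟩
    exact hle hw
  have hr : ∀ y ∈ (MB j).C1, ∀ w, e (w ⊗ₜ y) ∈ M.C1 := fun y hy w => by
    have hle : (MB j).C1 ≤ M.C1.comap
        (e.toLinearMap ∘ₗ TensorProduct.mk ℂ (MA i).W (MB j).W w) := by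
      refine Submodule.span_le.2 ?_
      rintro _ ⟨v, x, ⟨n, hn, hv⟩, rfl⟩
      exact Submodule.subset_span ⟨_, e (w ⊗ₜ x), ⟨n, hn, T.P_right hv⟩, he.right v (-1) w x⟩
    exact hle hy
  refine Module.Finite.of_surjective
    (M.C1.mkQ ∘ₗ e.toLinearMap ∘ₗ TensorProduct.map F.subtype G.subtype) ?_
  rw [← LinearMap.range_eq_top, eq_top_iff]
  intro q _
  obtain ⟨x, rfl⟩ := M.C1.mkQ_surjective q
  obtain ⟨t, rfl⟩ := e.surjective x
  induction t using TensorProduct.induction_on with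
  | zero => rw [map_zero, map_zero]; exact Submodule.zero_mem _
  | add a b ha hb =>
    rw [map_add, map_add]; exact Submodule.add_mem _ (ha trivial) (hb trivial)
  | tmul w y =>
    obtain ⟨w1, hw1, w0, hw0, rfl⟩ := Submodule.mem_sup.1 (hFtop ▸ Submodule.mem_top :
      w ∈ (MA i).C1 ⊔ F)
    obtain ⟨y1, hy1, y0, hy0, rfl⟩ := Submodule.mem_sup.1 (hGtop ▸ Submodule.mem_top :
      y ∈ (MB j).C1 ⊔ G)
    refine ⟨(⟨w0, hw0⟩ : F) ⊗ₜ (⟨y0, hy0⟩ : G), ?_⟩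
    change M.C1.mkQ (e (w0 ⊗ₜ y0)) = _
    rw [← sub_eq_zero, ← map_sub, Submodule.mkQ_apply, Submodule.Quotient.mk_eq_zero,
      TensorProduct.add_tmul, TensorProduct.tmul_add w0, map_add, map_add, ← sub_sub,
      sub_add_eq_sub_sub]
    convert Submodule.neg_mem _ (Submodule.add_mem _ (hl w1 hw1 (y1 + y0)) (hr y1 hy1 w0)) using 1
    abel

theorem conds (hA : A.Conds) (hB : B.Conds) : T.T.Conds :=
  ⟨T.condI hA hB, T.condII hA hB, T.condIII hA hB⟩

end TensorVOA

end TensorConds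

/-! ## Ordinary modules -/

section Ordinary

open Module.End

theorem exists_eigenvector {W : Type*} [AddCommGroup W] [Module ℂ W] {g : Module.End ℂ W} {k : ℕ}
    {x : W} (hx : x ≠ 0) (hk : (g ^ k) x = 0) : ∃ w, w ≠ 0 ∧ g w = 0 := by
  induction k generalizing x with
  | zero => exact absurd hk hx
  | succ k ih =>
    by_cases h : g x = 0
    · exact ⟨x, hx, h⟩
    · exact ih h (by rwa [pow_succ] at hk)

theorem tmul_left_injective {W Y : Type*} [AddCommGroup W] [Module ℂ W] [AddCommGroup Y]
    [Module ℂ Y] {y : Y} (hy : y ≠ 0) :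
    Function.Injective ((TensorProduct.mk ℂ W Y).flip y) := by
  obtain ⟨f, hf⟩ := not_forall.1 (mt (Module.forall_dual_apply_eq_zero_iff ℂ y).1 hy)
  rw [← LinearMap.ker_eq_bot, LinearMap.ker_eq_bot']
  intro w hw
  have := congrArg (TensorProduct.rid ℂ W ∘ f.lTensor W) hw
  exact (smul_eq_zero.1 (by simpa using this)).resolve_left hf

theorem tmul_right_injective {W Y : Type*} [AddCommGroup W] [Module ℂ W] [AddCommGroup Y]
    [Module ℂ Y] {w : W} (hw : w ≠ 0) :
    Function.Injective (TensorProduct.mk ℂ W Y w) := fun _ _ h =>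
  tmul_left_injective hw ((TensorProduct.comm ℂ W Y).congr_arg h)

namespace GenModule

variable {A : VOA} (N : GenModule A)

theorem exists_real_eigenvector (hN : N.IsIrred) (hreal : N.RealGraded) :
    ∃ (r : ℝ) (w : N.W), w ≠ 0 ∧ N.act A.ω 1 w = (r : ℂ) • w := by
  obtain ⟨x, hx⟩ := hN.1
  obtain ⟨n, hn⟩ : ∃ n, N.P n x ≠ 0 := by
    by_contra! h
    exact hx (by rw [← N.P_total x, finsum_congr h, finsum_zero])
  obtain ⟨k, hk⟩ := N.L0_gen n x
  obtain ⟨w, hw, h⟩ := exists_eigenvector hn hk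
  have him : n.im = 0 := hreal n fun h0 => hn (by rw [h0]; rfl)
  refine ⟨n.re, w, hw, ?_⟩
  rw [show ((n.re : ℝ) : ℂ) = n from Complex.ext rfl (by simp [him])]
  simpa [sub_eq_zero] using h

/-- The span of the eigenvectors of `L(0)` is stable. -/
theorem invAct_span_eigenvectors :
    InvAct N.act (Submodule.span ℂ {x | ∃ c : ℂ, N.act A.ω 1 x = c • x}) := by
  intro u n x hx
  induction u using A.homog_induction with
  | hadd u v hu hv => rw [N.act_add]; exact Submodule.add_mem _ hu hv
  | h0 => rw [N.isWeak.act_zero]; exact Submodule.zero_mem _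
  | h d u hu =>
    induction hx using Submodule.span_induction with
    | mem x hx =>
      obtain ⟨c, hc⟩ := hx
      refine Submodule.subset_span ⟨c + (d - n - 1), ?_⟩
      rw [N.isWeak.comm_L0 (A.L0_homog hu), hc, map_smul, add_smul]
    | zero => rw [map_zero]; exact Submodule.zero_mem _
    | add x y _ _ hx hy => rw [map_add]; exact Submodule.add_mem _ hx hy
    | smul c x _ hx => rw [map_smul]; exact Submodule.smul_mem _ _ hx

/-- `L(0)` is semisimple on an irreducible module. -/
theorem L0_semisimple (hN : N.IsIrred) (hreal : N.RealGraded) (n : ℂ) (x : N.W) :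
    N.act A.ω 1 (N.P n x) = n • N.P n x := by
  obtain ⟨r, w, hw, hr⟩ := N.exists_real_eigenvector hN hreal
  have htop := (hN.2 _ N.invAct_span_eigenvectors).resolve_left fun h0 => hw <| by
    have : w ∈ Submodule.span ℂ {x | ∃ c : ℂ, N.act A.ω 1 x = c • x} :=
      Submodule.subset_span ⟨_, hr⟩
    rw [h0] at this
    simpa using this
  have hx : x ∈ Submodule.span ℂ {x | ∃ c : ℂ, N.act A.ω 1 x = c • x} :=
    htop ▸ Submodule.mem_top
  induction hx using Submodule.span_induction with
  | mem x hx =>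
    obtain ⟨c, hc⟩ := hx
    have hcx : N.P c x = x := N.isGenProj.eq_self <| (mem_maxGen_iff _ _ _).2
      ⟨1, by simp [hc, Module.algebraMap_end_apply]⟩
    rw [← hcx, N.P_orth]
    split_ifs with h
    · rw [hcx, hc, h]
    · simp
  | zero => simp
  | add x y _ _ hx hy => rw [map_add, map_add, hx, hy, smul_add]
  | smul c x _ hx => rw [map_smul, map_smul, hx, smul_comm]

/-- A real graded irreducible generalized module with finite-dimensional graded pieces and weights
bounded below is an ordinary module. -/
def toVModule (hN : N.IsIrred) (hreal : N.RealGraded) (hlow : ∃ h : ℝ, ∀ r < h, N.P (r : ℝ) = 0)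
    (hfin : ∀ r : ℝ, Module.Finite ℂ (LinearMap.range (N.P r))) : VModule A where
  W := N.W
  P r := N.P r
  P_orth m n x := by simp [N.P_orth]
  P_finite x := (N.P_finite x).preimage Complex.ofReal_injective.injOn
  P_total x := by
    classical
    rw [← finsum_mem_range (f := fun n : ℂ => N.P n x) Complex.ofReal_injective]
    conv_rhs => rw [← N.P_total x]
    refine finsum_congr fun n => ?_
    by_cases hn : N.P n x = 0
    · simp [hn]
    · have hmem : n ∈ Set.range Complex.ofReal :=
        ⟨n.re, Complex.ext rfl (hreal n fun h0 => hn (by rw [h0]; rfl)).symm⟩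
      rw [finsum_eq_if, if_pos hmem]
  P_lower := hlow
  P_findim := hfin
  act := N.act
  act_add := N.act_add
  act_smul := N.act_smul
  trunc := N.trunc
  vac_id := N.vac_id
  L0_grading r x := N.L0_semisimple hN hreal r x
  borcherds := N.borcherds

variable {N}

/-- A module which embeds into an ordinary module up to a shift of weights satisfies the grading
restrictions. -/
theorem grading_restricted (hN : N.IsIrred) (hreal : N.RealGraded) {B : VOA} {M : VModule B}
    (e : N.W →ₗ[ℂ] M.W) (he : Function.Injective e) (μ : ℝ)
    (h : ∀ w, M.act B.ω 1 (e w) = e (N.act A.ω 1 w) + (μ : ℂ) • e w) :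
    (∃ h : ℝ, ∀ r < h, N.P (r : ℝ) = 0) ∧
      ∀ r : ℝ, Module.Finite ℂ (LinearMap.range (N.P r)) := by
  have key : ∀ (r : ℝ) x, M.P (r + μ) (e (N.P r x)) = e (N.P r x) := fun r x =>
    proj_eq_self M.P_orth M.P_finite M.P_total (c := fun r : ℝ => (r : ℂ))
      Complex.ofReal_injective M.L0_grading
      (by rw [h, N.L0_semisimple hN hreal, map_smul, ← add_smul, Complex.ofReal_add])
  constructor
  · obtain ⟨h0, hlow⟩ := M.P_lower
    refine ⟨h0 - μ, fun r hr => LinearMap.ext fun x => he ?_⟩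
    rw [← key, hlow (r + μ) (by linarith)]
    simp
  · intro r
    have := M.P_findim (r + μ)
    have hmem : ∀ x : LinearMap.range (N.P r), e x ∈ LinearMap.range (M.P (r + μ)) := by
      rintro ⟨_, x, rfl⟩
      exact ⟨_, key r x⟩
    refine Module.Finite.of_injective
      ((e ∘ₗ (LinearMap.range (N.P r)).subtype).codRestrict (LinearMap.range (M.P (r + μ))) hmem)
      fun x y hxy => Subtype.ext (he (congrArg Subtype.val hxy))

end GenModule

end Ordinary

/-! ## Decomposition of ordinary modules for the tensor product -/

section Decomposition

/-- An independent spanning finite family of images of injective maps is a direct sum. -/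
theorem exists_piEquiv {ι W : Type*} [Fintype ι] [DecidableEq ι] [AddCommGroup W] [Module ℂ W]
    {N : ι → Type*} [∀ i, AddCommGroup (N i)] [∀ i, Module ℂ (N i)] (τ : ∀ i, N i →ₗ[ℂ] W)
    (hinj : ∀ i, Function.Injective (τ i)) (hind : iSupIndep fun i => LinearMap.range (τ i))
    (htop : ⨆ i, LinearMap.range (τ i) = ⊤) :
    ∃ φ : (∀ i, N i) ≃ₗ[ℂ] W, ∀ i x, φ (Pi.single i x) = τ i x := by
  let f := LinearMap.lsum ℂ N ℂ τ
  have hf : ∀ x, f x = ∑ i, τ i (x i) := fun x => by simp [f]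
  have hs : ∀ i x, f (Pi.single i x) = τ i x := fun i x => by
    rw [hf, Finset.sum_eq_single i (fun j _ hj => by rw [Pi.single_eq_of_ne hj, map_zero])
      fun h => absurd (Finset.mem_univ i) h, Pi.single_eq_same]
  refine ⟨LinearEquiv.ofBijective f ⟨?_, ?_⟩, hs⟩
  · rw [← LinearMap.ker_eq_bot, LinearMap.ker_eq_bot']
    intro x hx
    rw [hf] at hx
    ext i
    refine hinj i ?_
    rw [Pi.zero_apply, map_zero]
    exact (iSupIndep_iff_finsetSum_eq_zero_imp_eq_zero _).1 hind Finset.univ _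
      (fun i _ => LinearMap.mem_range_self _ _) hx i (Finset.mem_univ i)
  · rw [← LinearMap.range_eq_top, eq_top_iff, ← htop]
    refine iSup_le fun i => ?_
    rintro _ ⟨x, rfl⟩
    exact ⟨_, hs i x⟩

namespace TensorVOA

variable {A B : VOA} (T : TensorVOA A B) (M : VModule T.T)

theorem L0_tmul {NA : GenModule A} {NB : GenModule B} {τ : NA.W ⊗[ℂ] NB.W →ₗ[ℂ] M.W}
    (hτ : IsTens NA.act NB.act (T.actL M.act) (T.actR M.act) τ) (w : NA.W) (y : NB.W) :
    M.act T.T.ω 1 (τ (w ⊗ₜ y)) = τ (NA.act A.ω 1 w ⊗ₜ y) + τ (w ⊗ₜ NB.act B.ω 1 y) := by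
  rw [T.L0_eq M.isWeak, LinearMap.add_apply, hτ.left, hτ.right]

/-- The irreducible constituents of an ordinary module are tensor products of ordinary modules. -/
theorem exists_vmodule {NA : GenModule A} {NB : GenModule B} (hA : NA.IsIrred ∧ NA.RealGraded)
    (hB : NB.IsIrred ∧ NB.RealGraded) {τ : NA.W ⊗[ℂ] NB.W →ₗ[ℂ] M.W}
    (hτ : IsTens NA.act NB.act (T.actL M.act) (T.actR M.act) τ)
    (hinj : Function.Injective τ) :
    ∃ (VA : VModule A) (VB : VModule B) (σ : VA.W ⊗[ℂ] VB.W →ₗ[ℂ] M.W), VA.IsIrred ∧ VB.IsIrred ∧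
      IsTens VA.act VB.act (T.actL M.act) (T.actR M.act) σ ∧ Function.Injective σ ∧
        LinearMap.range σ = LinearMap.range τ := by
  obtain ⟨r, w, hw, hr⟩ := NA.exists_real_eigenvector hA.1 hA.2
  obtain ⟨s, y, hy, hs⟩ := NB.exists_real_eigenvector hB.1 hB.2
  obtain ⟨hlow, hfin⟩ := GenModule.grading_restricted hA.1 hA.2
    (τ ∘ₗ (TensorProduct.mk ℂ NA.W NB.W).flip y) (hinj.comp (tmul_left_injective hy)) s
    fun x => by simp [T.L0_tmul M hτ, hs]
  obtain ⟨hlow', hfin'⟩ := GenModule.grading_restricted hB.1 hB.2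
    (τ ∘ₗ TensorProduct.mk ℂ NA.W NB.W w) (hinj.comp (tmul_right_injective hw)) r
    fun x => by
      change M.act T.T.ω 1 (τ (w ⊗ₜ x)) = τ (w ⊗ₜ NB.act B.ω 1 x) + (r : ℂ) • τ (w ⊗ₜ x)
      rw [T.L0_tmul M hτ, hr, ← TensorProduct.smul_tmul', map_smul, add_comm]
  exact ⟨NA.toVModule hA.1 hA.2 hlow hfin, NB.toVModule hB.1 hB.2 hlow' hfin', τ, hA.1, hB.1, hτ,
    hinj, rfl⟩

/-- The action on the image of a tensor product. -/
theorem act_tens {W : Type} [AddCommGroup W] [Module ℂ W] {act : T.T.V → ℤ → Module.End ℂ W}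
    (h : IsWeak T.T act) {X Y : Type*} [AddCommGroup X] [Module ℂ X] [AddCommGroup Y] [Module ℂ Y]
    {a : A.V → ℤ → Module.End ℂ X} {b : B.V → ℤ → Module.End ℂ Y} {τ : X ⊗[ℂ] Y →ₗ[ℂ] W}
    (hτ : IsTens a b (T.actL act) (T.actR act) τ) (hinj : Function.Injective τ) (u : A.V) (v : B.V)
    (n : ℤ) (x : X) (y : Y) :
    act (T.ψ (u ⊗ₜ v)) n (τ (x ⊗ₜ y)) = τ (∑ᶠ i : ℤ, a u i x ⊗ₜ b v (n - 1 - i) y) := by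
  rw [T.act_tmul h]
  refine Eq.trans ?_ (τ.toAddMonoidHom.map_finsum_of_injective hinj _).symm
  refine finsum_congr fun i => ?_
  change _ = τ _
  rw [hτ.left, hτ.right]

theorem finite_of_sSupIndep {k l : ℕ} {MA : Fin k → GenModule A} {MB : Fin l → GenModule B}
    (hMA : IrrList A MA) (hMB : IrrList B MB) {s : Set (Submodule ℂ M.W)}
    (hs : ∀ S ∈ s, ∃ i j, ∃ τ : (MA i).W ⊗[ℂ] (MB j).W →ₗ[ℂ] M.W,
      IsTens (MA i).act (MB j).act (T.actL M.act) (T.actR M.act) τ ∧ Function.Injective τ ∧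
        LinearMap.range τ = S) (hind : sSupIndep s) : s.Finite := by
  choose r w hw hr using fun i => (MA i).exists_real_eigenvector (hMA.1 i).1 (hMA.1 i).2
  choose t y hy ht using fun j => (MB j).exists_real_eigenvector (hMB.1 j).1 (hMB.1 j).2
  have hF := fun p : Fin k × Fin l => M.P_findim (r p.1 + t p.2)
  let F : Submodule ℂ M.W := ⨆ p : Fin k × Fin l, LinearMap.range (M.P (r p.1 + t p.2))
  have key : ∀ S : s, ∃ v : F, (v : M.W) ∈ S.1 ∧ (v : M.W) ≠ 0 := by
    rintro ⟨S, hS⟩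
    obtain ⟨i, j, τ, hτ, hinj, rfl⟩ := hs S hS
    refine ⟨⟨τ (w i ⊗ₜ y j), ?_⟩, ⟨_, rfl⟩, fun h0 => hw i (tmul_left_injective (hy j) ?_)⟩
    · refine Submodule.mem_iSup_of_mem (i, j) ⟨τ (w i ⊗ₜ y j), ?_⟩
      refine proj_eq_self M.P_orth M.P_finite M.P_total (c := fun r : ℝ => (r : ℂ))
        Complex.ofReal_injective M.L0_grading ?_
      rw [T.L0_tmul M hτ, hr, ht, Complex.ofReal_add, add_smul, TensorProduct.tmul_smul,
        ← TensorProduct.smul_tmul', map_smul, map_smul]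
    · rw [map_zero]
      exact hinj (h0.trans (map_zero τ).symm)
  choose v hv hv0 using key
  have hli : LinearIndependent ℂ v := LinearIndependent.of_comp F.subtype <|
    iSupIndep.linearIndependent (fun S : s => S.1) (sSupIndep_iff s |>.1 hind) hv hv0
  exact hli.finite_of_isNoetherian

theorem exists_decomposition (hA : A.Conds) (hB : B.Conds) :
    ∃ (k : ℕ) (MA : Fin k → VModule A) (MB : Fin k → VModule B)
      (φ : ((j : Fin k) → (MA j).W ⊗[ℂ] (MB j).W) ≃ₗ[ℂ] M.W),
      (∀ j, (MA j).IsIrred ∧ (MB j).IsIrred) ∧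
      ∀ (j : Fin k) (u : A.V) (v : B.V) (n : ℤ) (w : (MA j).W) (w' : (MB j).W),
        M.act (T.ψ (u ⊗ₜ[ℂ] v)) n (φ (Pi.single j (w ⊗ₜ[ℂ] w')))
          = φ (Pi.single j
              (∑ᶠ i : ℤ, (MA j).act u i w ⊗ₜ[ℂ] (MB j).act v (n - 1 - i) w')) := by
  obtain ⟨k, NA, hNA⟩ := hA.2.1
  obtain ⟨l, NB, hNB⟩ := hB.2.1
  obtain ⟨s, hs, hind, htop⟩ := exists_independent (act := M.act)
    (fun S hS => by
      obtain ⟨i, j, τ, hτ, h0, rfl⟩ := hS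
      exact T.simpleSub_range M.isWeak (hNA.1 i).1 (hNB.1 j).1 hτ h0)
    (T.sSup_range hA hB hNA hNB M.isWeak)
  have hs' : ∀ S ∈ s, ∃ i j, ∃ τ : (NA i).W ⊗[ℂ] (NB j).W →ₗ[ℂ] M.W,
      IsTens (NA i).act (NB j).act (T.actL M.act) (T.actR M.act) τ ∧ Function.Injective τ ∧
        LinearMap.range τ = S := fun S hS => by
    obtain ⟨i, j, τ, hτ, h0, h⟩ := hs hS
    obtain ⟨c, hc, hspan⟩ := GenModule.exists_countable_span (hNA.1 i).1
    exact ⟨i, j, τ, hτ, hτ.injective (hNA.1 i).1 (hNB.1 j).1 hc hspan h0, h⟩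
  have hfin : Finite s := T.finite_of_sSupIndep M hNA hNB hs' hind
  obtain ⟨m, ⟨e⟩⟩ := Finite.exists_equiv_fin s
  have key : ∀ S : s, ∃ (VA : VModule A) (VB : VModule B) (σ : VA.W ⊗[ℂ] VB.W →ₗ[ℂ] M.W),
      VA.IsIrred ∧ VB.IsIrred ∧ IsTens VA.act VB.act (T.actL M.act) (T.actR M.act) σ ∧
        Function.Injective σ ∧ LinearMap.range σ = S.1 := fun S => by
    obtain ⟨i, j, τ, hτ, hinj, h⟩ := hs' S.1 S.2
    rw [← h]
    exact T.exists_vmodule M (hNA.1 i) (hNB.1 j) hτ hinj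
  choose VA VB σ hVA hVB hσ hinj hrange using fun j : Fin m => key (e.symm j)
  obtain ⟨φ, hφ⟩ := exists_piEquiv σ hinj
    (by
      simp_rw [hrange]
      exact (sSupIndep_iff s |>.1 hind).comp e.symm.injective)
    (by
      simp_rw [hrange]
      rw [e.symm.iSup_comp (g := fun S : s => S.1), ← sSup_eq_iSup', htop])
  refine ⟨m, VA, VB, φ, fun j => ⟨hVA j, hVB j⟩, fun j u v n w w' => ?_⟩
  rw [hφ, hφ]
  exact T.act_tens M.isWeak (hσ j) (hinj j) u v n w w'

end TensorVOA

end Decomposition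

/-- Proposition 2.1 and Corollary 2.2 of Huang–Kong: if `V^L` and `V^R`
satisfy conditions (i)–(iii), then the tensor product vertex operator algebra
`V^L ⊗ V^R` satisfies conditions (i)–(iii) as well; consequently every module for
`V^L ⊗ V^R` is isomorphic to a finite direct sum of tensor products of irreducible
`V^L`- and `V^R`-modules. -/
theorem tensor_voa_conditions (VL VR : VOA) (hL : VL.Conds) (hR : VR.Conds)
    (T : TensorVOA VL VR) :
    T.T.Conds ∧
    ∀ M : VModule T.T,
      ∃ (k : ℕ) (MA : Fin k → VModule VL) (MB : Fin k → VModule VR)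
        (φ : ((j : Fin k) → TensorProduct ℂ (MA j).W (MB j).W) ≃ₗ[ℂ] M.W),
        (∀ j, (MA j).IsIrred ∧ (MB j).IsIrred) ∧
        (∀ (j : Fin k) (u : VL.V) (v : VR.V) (n : ℤ)
          (w : (MA j).W) (w' : (MB j).W),
          M.act (T.ψ (u ⊗ₜ[ℂ] v)) n (φ (Pi.single j (w ⊗ₜ[ℂ] w')))
            = φ (Pi.single j
                (∑ᶠ i : ℤ, (MA j).act u i w ⊗ₜ[ℂ] (MB j).act v (n - 1 - i) w'))) :=
  ⟨T.conds hL hR, fun M => T.exists_decomposition M hL hR⟩
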